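/- Let p be an odd prime number, P = 2p or p chosen so that P ≢ ±1 (mod 9), ι ∈ {1,2} defined as in the standing setup, and let l ≡ 2 (mod 3) be a prime number not dividing P. Suppose there exist integers a, b, c satisfying: (1) l = a³ + P^ι b³ + P^{2ι} c³ − 3 P^ι a b c; (2) a ≡ ±1 (mod p), b ≡ 0 (mod p), and c ≢ 0 (mod p); (3) if p = 5, then additionally c ≢ −a (mod 5); (4) if P = 3, then additionally c ≡ −a (mod 3). Then there exists a positive even integer m < p such that every primitive triple (x,y,z) ∈ ℤ³ with x³ + P^ι y³ = l^m z^{p^ι} satisfies x ≡ y ≡ 0 (mod l). -/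

import Mathlib

/-- The real cube root of a natural number. -/
noncomputable def cbrt (P : ℕ) : ℝ := (P : ℝ) ^ ((1 : ℝ) / 3)

/-- `u` belongs to the order `ℤ[P^{1/3}]` of `ℚ(P^{1/3})`. -/
def InOrder (P : ℕ) (u : ℝ) : Prop :=
  ∃ x y z : ℤ, u = (x : ℝ) + (y : ℝ) * cbrt P + (z : ℝ) * (cbrt P) ^ 2

/-- `u` is a unit of the order `ℤ[P^{1/3}]`. -/
def IsUnitOfOrder (P : ℕ) (u : ℝ) : Prop :=
  InOrder P u ∧ ∃ v : ℝ, InOrder P v ∧ u * v = 1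

/-- `ε` is the fundamental unit of `ℚ(P^{1/3})` (whose ring of integers is `ℤ[P^{1/3}]`
since `P ≢ ±1 mod 9`): the smallest unit greater than `1`, equivalently the generator
greater than `1` of the unit group modulo `±1`. -/
def IsFundamentalUnit (P : ℕ) (ε : ℝ) : Prop :=
  IsUnitOfOrder P ε ∧ 1 < ε ∧ ∀ u : ℝ, IsUnitOfOrder P u → 1 < u → ε ≤ u

open Polynomial in
/-- If the minimal polynomial over `ℤ` of a generator `g` is Eisenstein at a prime `q`, then the
index of `ℤ[g]` in the ring of integers is prime to `q`. -/
theorem mem_adjoin_of_nsmul_mem_of_isEisensteinAt {K : Type*} [Field K] [NumberField K]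
    {g : K} {f : ℤ[X]} (hmon : f.Monic) (hdeg : f.natDegree = Module.finrank ℚ K)
    (hroot : aeval g f = 0) {q : ℤ} (hq : Prime q)
    (hei : f.IsEisensteinAt (Ideal.span {q})) {z : K} (hz : IsIntegral ℤ z)
    (hqz : q • z ∈ Algebra.adjoin ℤ ({g} : Set K)) :
    z ∈ Algebra.adjoin ℤ ({g} : Set K) := by
  have hg : IsIntegral ℤ g := ⟨f, hmon, by simpa [aeval_def] using hroot⟩
  have hpos : 0 < f.natDegree := hdeg ▸ Module.finrank_pos
  have hirr : Irreducible f := hei.irreducible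
    ((Ideal.span_singleton_prime hq.ne_zero).2 hq) hmon.isPrimitive hpos
  have hmin : minpoly ℤ g = f := by
    have hdvd : minpoly ℤ g ∣ f := minpoly.isIntegrallyClosed_dvd hg hroot
    have hass : Associated (minpoly ℤ g) f :=
      (hirr.dvd_iff.1 hdvd).resolve_left (minpoly.not_isUnit ℤ g) |>.symm
    exact eq_of_monic_of_associated (minpoly.monic hg) hmon hass
  have hdegQ : (minpoly ℚ g).natDegree = Module.finrank ℚ K := by
    rw [minpoly.isIntegrallyClosed_eq_field_fractions' ℚ hg, hmin,
      (hmon).natDegree_map, hdeg]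
  have htop : IntermediateField.adjoin ℚ ({g} : Set K) = ⊤ :=
    (Field.primitive_element_iff_minpoly_natDegree_eq ℚ g).2 hdegQ
  let B : PowerBasis ℚ K := (IntermediateField.adjoin.powerBasis
    (IsIntegral.of_finite ℚ g)).map
      ((IntermediateField.equivOfEq htop).trans IntermediateField.topEquiv)
  have hB : B.gen = g := rfl
  have h := mem_adjoin_of_smul_prime_smul_of_minpoly_isEisensteinAt (B := B) (R := ℤ) hq
    (by rw [hB]; exact hg) hz (by rw [hB]; exact hqz) (by rw [hB, hmin]; exact hei)
  rwa [hB] at h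

/-- A pure cubic field `K = ℚ(π)`, `π ^ 3 = P` with `P` squarefree and `P ≢ ±1 mod 9`, together
with a real embedding. -/
structure PureCubic (P : ℕ) (K : Type*) [Field K] [NumberField K] where
  emb : K →+* ℝ
  root : K
  cube : root ^ 3 = P
  finrank : Module.finrank ℚ K = 3
  sqfree : Squarefree P
  two_lt : 2 < P
  mod9 : P % 9 ≠ 1 ∧ P % 9 ≠ 8

namespace PureCubic

variable {P : ℕ} {K : Type*} [Field K] [NumberField K] (S : PureCubic P K)
include S

open Polynomial

theorem one_lt : 1 < P := lt_trans one_lt_two S.two_lt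

omit [Field K] [NumberField K] S in
theorem natDegree_aux : (X ^ 3 - C (P : ℤ) : ℤ[X]).natDegree = 3 := by
  compute_degree!

omit [Field K] [NumberField K] S in
theorem isEisensteinAt_root (hsq : Squarefree P) {q : ℕ} (hq : q.Prime) (hqP : q ∣ P) :
    (X ^ 3 - C (P : ℤ) : ℤ[X]).IsEisensteinAt (Ideal.span {(q : ℤ)}) := by
  have hqZ : Prime (q : ℤ) := Nat.prime_iff_prime_int.1 hq
  refine ⟨?_, ?_, ?_⟩
  · have : (X ^ 3 - C (P : ℤ) : ℤ[X]).Monic := by monicity!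
    rw [this.leadingCoeff, Ideal.mem_span_singleton]
    exact fun h => hqZ.not_isUnit (isUnit_of_dvd_one h)
  · intro n hn
    rw [natDegree_aux] at hn
    rw [Ideal.mem_span_singleton]
    interval_cases n <;> simp [hqP, Int.natCast_dvd_natCast, coeff_X_pow]
  · rw [Ideal.span_singleton_pow, Ideal.mem_span_singleton]
    simp only [coeff_sub, coeff_X_pow, coeff_C]
    norm_num
    intro h
    have h2 : q * q ∣ P := by rw [← sq]; exact_mod_cast h
    exact hq.one_lt.ne' (Nat.isUnit_iff.1 (hsq q h2))

omit [Field K] [NumberField K] S in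
theorem natDegree_shift : (X ^ 3 + C (3 * P : ℤ) * X ^ 2 + C (3 * P ^ 2 : ℤ) * X +
    C ((P : ℤ) ^ 3 - P) : ℤ[X]).natDegree = 3 := by
  compute_degree!

theorem isEisensteinAt_three (h3 : ¬ 3 ∣ P) :
    (X ^ 3 + C (3 * P : ℤ) * X ^ 2 + C (3 * P ^ 2 : ℤ) * X +
    C ((P : ℤ) ^ 3 - P) : ℤ[X]).IsEisensteinAt (Ideal.span {(3 : ℤ)}) := by
  have hc := S.mod9
  have hmod : ((P : ℤ) ^ 3 - P) % 9 = 6 ∨ ((P : ℤ) ^ 3 - P) % 9 = 3 := by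
    have h : (P : ℤ) % 9 = 2 ∨ (P : ℤ) % 9 = 4 ∨ (P : ℤ) % 9 = 5 ∨ (P : ℤ) % 9 = 7 := by omega
    rcases h with h | h | h | h <;> simp [pow_succ, Int.sub_emod, Int.mul_emod, h]
  refine ⟨?_, ?_, ?_⟩
  · have : (X ^ 3 + C (3 * P : ℤ) * X ^ 2 + C (3 * P ^ 2 : ℤ) * X +
      C ((P : ℤ) ^ 3 - P) : ℤ[X]).Monic := by monicity!
    rw [this.leadingCoeff, Ideal.mem_span_singleton]
    norm_num
  · intro n hn
    rw [natDegree_shift] at hn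
    rw [Ideal.mem_span_singleton]
    interval_cases n <;> simp only [coeff_add, coeff_C_mul, coeff_X_pow, coeff_X, coeff_C] <;>
      norm_num
    omega
  · rw [Ideal.span_singleton_pow, Ideal.mem_span_singleton]
    simp only [coeff_add, coeff_C_mul, coeff_X_pow, coeff_X, coeff_C]
    norm_num
    omega

theorem isIntegral_root : IsIntegral ℤ S.root :=
  ⟨X ^ 3 - C (P : ℤ), by monicity!, by simp [S.cube]⟩

omit [Field K] [NumberField K] S in
theorem irreducible (hsq : Squarefree P) (h1 : 1 < P) : Irreducible (X ^ 3 - C (P : ℤ) : ℤ[X]) := by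
  obtain ⟨q, hq, hqP⟩ := Nat.exists_prime_and_dvd h1.ne'
  have hqZ : Prime (q : ℤ) := Nat.prime_iff_prime_int.1 hq
  have hm : (X ^ 3 - C (P : ℤ) : ℤ[X]).Monic := by monicity!
  exact (isEisensteinAt_root hsq hq hqP).irreducible
    ((Ideal.span_singleton_prime hqZ.ne_zero).2 hqZ) hm.isPrimitive 
    (by rw [natDegree_aux]; simp)

theorem minpoly_int : minpoly ℤ S.root = X ^ 3 - C (P : ℤ) := by
  have hdvd : minpoly ℤ S.root ∣ X ^ 3 - C (P : ℤ) :=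
    minpoly.isIntegrallyClosed_dvd S.isIntegral_root (by simp [S.cube])
  exact eq_of_monic_of_associated (minpoly.monic S.isIntegral_root) (by monicity!)
    (((irreducible S.sqfree S.one_lt).dvd_iff.1 hdvd).resolve_left (minpoly.not_isUnit ℤ _) |>.symm)

theorem minpoly_rat : minpoly ℚ S.root = X ^ 3 - C (P : ℚ) := by
  rw [minpoly.isIntegrallyClosed_eq_field_fractions' ℚ S.isIntegral_root, S.minpoly_int]
  simp

/-- The power basis of `K` given by the cube root. -/
noncomputable def powerBasis : PowerBasis ℚ K :=
  (IntermediateField.adjoin.powerBasis (IsIntegral.of_finite ℚ S.root)).map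
    ((IntermediateField.equivOfEq
      ((Field.primitive_element_iff_minpoly_natDegree_eq ℚ S.root).2 (by
        rw [S.minpoly_rat, S.finrank]; compute_degree!))).trans IntermediateField.topEquiv)

theorem powerBasis_gen : S.powerBasis.gen = S.root := rfl

theorem powerBasis_dim : S.powerBasis.dim = 3 := by
  rw [← S.finrank, S.powerBasis.finrank]

theorem norm_root : Algebra.norm ℚ S.root = P := by
  have h := Algebra.PowerBasis.norm_gen_eq_coeff_zero_minpoly S.powerBasis
  rw [powerBasis_dim, powerBasis_gen, minpoly_rat] at h
  rw [h]
  simp [coeff_X_pow]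
  ring

theorem discr_powerBasis : Algebra.discr ℚ S.powerBasis.basis = -27 * (P : ℚ) ^ 2 := by
  rw [Algebra.discr_powerBasis_eq_norm, powerBasis_gen, minpoly_rat, S.finrank]
  simp only [derivative_sub, derivative_X_pow, derivative_C, sub_zero]
  simp only [map_mul, aeval_C, map_pow, aeval_X, S.norm_root, Algebra.norm_algebraMap, S.finrank]
  norm_num

theorem mem_adjoin_of_nsmul_mem {n : ℕ} (hn : n ≠ 0) (hnP : ∀ q : ℕ, q.Prime → q ∣ n → q ∣ 3 * P)
    {z : K} (hz : IsIntegral ℤ z) (h : (n : ℤ) • z ∈ Algebra.adjoin ℤ ({S.root} : Set K)) :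
    z ∈ Algebra.adjoin ℤ ({S.root} : Set K) := by
  induction n using induction_on_primes generalizing z with
  | zero => exact absurd rfl hn
  | one => simpa using h
  | prime_mul q m hq ih =>
    have hqZ : Prime (q : ℤ) := Nat.prime_iff_prime_int.1 hq
    have hz' : (m : ℤ) • z ∈ Algebra.adjoin ℤ ({S.root} : Set K) := by
      have hInt : IsIntegral ℤ ((m : ℤ) • z) := hz.smul _
      rw [Nat.cast_mul, mul_smul] at h
      by_cases hqP : q ∣ P
      · exact mem_adjoin_of_nsmul_mem_of_isEisensteinAt (f := X ^ 3 - C (P : ℤ)) (by monicity!)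
          (by rw [natDegree_aux, S.finrank]) (by simp [S.cube]) hqZ
          (isEisensteinAt_root S.sqfree hq hqP) hInt h
      · have hq3 : q = 3 := by
          have := hnP q hq (dvd_mul_right _ _)
          exact (Nat.prime_dvd_prime_iff_eq hq Nat.prime_three).1
            ((hq.dvd_mul.1 this).resolve_right hqP)
        subst hq3
        have hadj : Algebra.adjoin ℤ ({S.root - (P : K)} : Set K) =
            Algebra.adjoin ℤ ({S.root} : Set K) := by
          apply le_antisymm
          · refine Algebra.adjoin_le (Set.singleton_subset_iff.2 ?_)
            exact sub_mem (Algebra.self_mem_adjoin_singleton ℤ _) (natCast_mem _ _)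
          · refine Algebra.adjoin_le (Set.singleton_subset_iff.2 ?_)
            have : S.root = (S.root - (P : K)) + (P : K) := by ring
            change S.root ∈ Algebra.adjoin ℤ ({S.root - (P : K)} : Set K)
            rw [this]
            exact add_mem (by simp)
              (natCast_mem _ _)
        rw [← hadj] at h ⊢
        refine mem_adjoin_of_nsmul_mem_of_isEisensteinAt (by monicity!)
          (by rw [natDegree_shift, S.finrank]) ?_ hqZ
          (S.isEisensteinAt_three hqP) hInt h
        simp only [map_add, map_sub, map_mul, map_pow, aeval_X, map_ofNat, map_natCast]
        linear_combination S.cube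
    exact ih (by rintro rfl; simp at hn) (fun r hr hrm => hnP r hr (dvd_mul_of_dvd_right hrm _))
      hz hz'

theorem mem_adjoin_root {z : K} (hz : IsIntegral ℤ z) :
    z ∈ Algebra.adjoin ℤ ({S.root} : Set K) := by
  have h := Algebra.discr_mul_isIntegral_mem_adjoin (K := ℚ) (R := ℤ) (B := S.powerBasis)
    S.isIntegral_root hz
  rw [S.discr_powerBasis, S.powerBasis_gen] at h
  have hP : P ≠ 0 := by have := S.one_lt; omega
  refine S.mem_adjoin_of_nsmul_mem (n := 27 * P ^ 2) (by positivity) ?_ hz ?_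
  · intro q hq h
    rcases hq.dvd_mul.1 h with h | h
    · exact dvd_mul_of_dvd_left (hq.dvd_of_dvd_pow (show q ∣ 3 ^ 3 by simpa using h)) _
    · exact dvd_mul_of_dvd_right (hq.dvd_of_dvd_pow h) _
  · have h2 := neg_mem h
    convert h2 using 1
    rw [← neg_smul, Algebra.smul_def, Algebra.smul_def]
    simp

theorem exists_coords {z : K} (hz : IsIntegral ℤ z) :
    ∃ a b c : ℤ, z = a + b * S.root + c * S.root ^ 2 := by
  have h := S.mem_adjoin_root hz
  rw [Algebra.adjoin_singleton_eq_range_aeval] at h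
  obtain ⟨f, rfl⟩ := h
  have hm : (X ^ 3 - C (P : ℤ) : ℤ[X]).Monic := by monicity!
  have h1 : aeval S.root f = aeval S.root (f %ₘ (X ^ 3 - C (P : ℤ))) := by
    conv_lhs => rw [← modByMonic_add_div f (X ^ 3 - C (P : ℤ))]
    simp [S.cube]
  refine ⟨(f %ₘ (X ^ 3 - C (P : ℤ))).coeff 0, (f %ₘ (X ^ 3 - C (P : ℤ))).coeff 1,
    (f %ₘ (X ^ 3 - C (P : ℤ))).coeff 2, ?_⟩
  have hd : (f %ₘ (X ^ 3 - C (P : ℤ))).natDegree < 3 := by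
    have := natDegree_modByMonic_lt f hm (by
      intro h
      have := natDegree_aux (P := P)
      rw [h] at this
      simp at this)
    rwa [natDegree_aux] at this
  change aeval S.root f = _
  rw [h1, aeval_eq_sum_range' hd]
  simp [Finset.sum_range_succ]

theorem coords_rat {a b c : ℚ} (h : (a : K) + b * S.root + c * S.root ^ 2 = 0) :
    a = 0 ∧ b = 0 ∧ c = 0 := by
  have hz : aeval S.root (C a + C b * X + C c * X ^ 2 : ℚ[X]) = 0 := by
    simpa using h
  have hf : (C a + C b * X + C c * X ^ 2 : ℚ[X]) = 0 := by
    by_contra hne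
    have h1 := minpoly.degree_le_of_ne_zero ℚ S.root hne hz
    rw [S.minpoly_rat] at h1
    have h2 : (X ^ 3 - C (P : ℚ)).degree = 3 := by compute_degree!
    have h3 : (C a + C b * X + C c * X ^ 2 : ℚ[X]).degree ≤ 2 := by compute_degree
    rw [h2] at h1
    exact absurd (h1.trans h3) (by decide)
  refine ⟨by simpa [coeff_X, coeff_C, coeff_X_pow] using congrArg (coeff · 0) hf,
    by simpa [coeff_X, coeff_C, coeff_X_pow] using congrArg (coeff · 1) hf, 
    by simpa [coeff_X, coeff_C, coeff_X_pow] using congrArg (coeff · 2) hf⟩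

theorem coords_ext {a b c a' b' c' : ℤ} (h : (a : K) + b * S.root + c * S.root ^ 2 =
    a' + b' * S.root + c' * S.root ^ 2) : a = a' ∧ b = b' ∧ c = c' := by
  have := S.coords_rat (a := ((a - a' : ℤ) : ℚ)) (b := ((b - b' : ℤ) : ℚ))
    (c := ((c - c' : ℤ) : ℚ)) (by push_cast; linear_combination h)
  obtain ⟨h1, h2, h3⟩ := this
  norm_cast at h1 h2 h3
  omega

open NumberField in
theorem discr_eq : discr K = -27 * (P : ℤ) ^ 2 := by
  let v : Fin 3 → 𝓞 K := fun i => ⟨S.root, S.isIntegral_root⟩ ^ (i : ℕ)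
  have hv : ∀ i, ((v i : 𝓞 K) : K) = S.root ^ (i : ℕ) := fun i => map_pow (algebraMap (𝓞 K) K) _ _
  have hli : LinearIndependent ℤ v := by
    rw [Fintype.linearIndependent_iff]
    intro g hg
    have h := congrArg (algebraMap (𝓞 K) K) hg
    rw [map_sum, Fin.sum_univ_three] at h
    simp only [zsmul_eq_mul, map_mul, map_intCast, map_zero] at h
    have := S.coords_ext (a := g 0) (b := g 1) (c := g 2) (a' := 0) (b' := 0) (c' := 0) (by
      simpa [hv] using h)
    intro i
    fin_cases i <;> simp [this]
  have hsp : ⊤ ≤ Submodule.span ℤ (Set.range v) := by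
    intro z _
    obtain ⟨a, b, c, h⟩ := S.exists_coords z.isIntegral_coe
    have hz : z = ∑ i, ![a, b, c] i • v i := by
      apply RingOfIntegers.ext
      refine h.trans ?_
      rw [Fin.sum_univ_three]
      simp [hv]
    rw [hz]
    exact Submodule.sum_mem _ fun i _ => Submodule.smul_mem _ _ (Submodule.subset_span ⟨i, rfl⟩)
  let b := Module.Basis.mk hli hsp
  have h1 := NumberField.discr_eq_discr K b
  have h2 : (Algebra.discr ℤ b : ℚ) = -27 * (P : ℚ) ^ 2 := by
    rw [← S.discr_powerBasis]
    have h3 := Algebra.discr_localizationLocalization ℤ (nonZeroDivisors ℤ) K (Rₘ := ℚ) b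
    rw [show ((Algebra.discr ℤ b : ℤ) : ℚ) = algebraMap ℤ ℚ (Algebra.discr ℤ b) from rfl, ← h3,
      ← Algebra.discr_reindex ℚ S.powerBasis.basis (finCongr S.powerBasis_dim)]
    congr 1
    ext i
    simp [b, hv, powerBasis_gen]
  rw [← h1]
  exact_mod_cast h2

end PureCubic

section OrderUnits

variable {P : ℕ}

theorem cbrt_pow_three (P : ℕ) : cbrt P ^ 3 = P := by
  rw [cbrt, ← Real.rpow_natCast, ← Real.rpow_mul (Nat.cast_nonneg P)]
  norm_num

theorem cbrt_nonneg (P : ℕ) : 0 ≤ cbrt P := Real.rpow_nonneg (Nat.cast_nonneg P) _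

theorem InOrder.mul {u v : ℝ} (hu : InOrder P u) (hv : InOrder P v) : InOrder P (u * v) := by
  obtain ⟨x, y, z, rfl⟩ := hu
  obtain ⟨x', y', z', rfl⟩ := hv
  refine ⟨x * x' + P * (y * z' + z * y'), x * y' + y * x' + P * (z * z'),
    x * z' + y * y' + z * x', ?_⟩
  push_cast
  linear_combination ((y : ℝ) * z' + z * y' + z * z' * cbrt P) * cbrt_pow_three P

theorem InOrder.neg {u : ℝ} (hu : InOrder P u) : InOrder P (-u) := by
  obtain ⟨x, y, z, rfl⟩ := hu
  exact ⟨-x, -y, -z, by push_cast; ring⟩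

theorem InOrder.one : InOrder P 1 := ⟨1, 0, 0, by simp⟩

theorem IsUnitOfOrder.mul {u v : ℝ} (hu : IsUnitOfOrder P u) (hv : IsUnitOfOrder P v) :
    IsUnitOfOrder P (u * v) := by
  obtain ⟨hu, u', hu', h⟩ := hu
  obtain ⟨hv, v', hv', h'⟩ := hv
  exact ⟨hu.mul hv, u' * v', hu'.mul hv', by linear_combination v * v' * h + h'⟩

theorem IsUnitOfOrder.neg {u : ℝ} (hu : IsUnitOfOrder P u) : IsUnitOfOrder P (-u) := by
  obtain ⟨hu, u', hu', h⟩ := hu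
  exact ⟨hu.neg, -u', hu'.neg, by linear_combination h⟩

theorem IsUnitOfOrder.inv {u : ℝ} (hu : IsUnitOfOrder P u) : IsUnitOfOrder P u⁻¹ := by
  obtain ⟨hu, u', hu', h⟩ := hu
  rw [inv_eq_of_mul_eq_one_right h]
  exact ⟨hu', u, hu, by rw [mul_comm]; exact h⟩

theorem IsUnitOfOrder.one : IsUnitOfOrder P 1 := ⟨InOrder.one, 1, InOrder.one, by simp⟩

theorem IsUnitOfOrder.ne_zero {u : ℝ} (hu : IsUnitOfOrder P u) : u ≠ 0 := by
  rintro rfl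
  obtain ⟨-, v, -, h⟩ := hu
  simp at h

theorem IsUnitOfOrder.pow {u : ℝ} (hu : IsUnitOfOrder P u) (n : ℕ) : IsUnitOfOrder P (u ^ n) := by
  induction n with
  | zero => simpa using IsUnitOfOrder.one
  | succ n ih => rw [pow_succ]; exact ih.mul hu

/-- Every unit of the order greater than or equal to `1` is a power of the fundamental unit. -/
theorem IsFundamentalUnit.exists_pow_of_one_le {ε : ℝ} (hε : IsFundamentalUnit P ε) {u : ℝ}
    (hu : IsUnitOfOrder P u) (h1 : 1 ≤ u) : ∃ n : ℕ, u = ε ^ n := by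
  obtain ⟨hεu, hε1, hmin⟩ := hε
  obtain ⟨n, hn1, hn2⟩ := exists_nat_pow_near h1 hε1
  refine ⟨n, ?_⟩
  have hpos : 0 < ε ^ n := by positivity
  by_contra hne
  have hlt : 1 < u * (ε ^ n)⁻¹ := by
    rw [← div_eq_mul_inv, one_lt_div hpos]
    exact lt_of_le_of_ne hn1 (Ne.symm hne)
  have := hmin _ (hu.mul (hεu.pow n).inv) hlt
  rw [← div_eq_mul_inv, le_div_iff₀ hpos] at this
  rw [pow_succ] at hn2
  linarith

theorem IsFundamentalUnit.exists_zpow {ε : ℝ} (hε : IsFundamentalUnit P ε) {u : ℝ}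
    (hu : IsUnitOfOrder P u) : ∃ k : ℤ, u = ε ^ k ∨ u = -ε ^ k := by
  have key : ∀ v : ℝ, IsUnitOfOrder P v → 0 < v → ∃ k : ℤ, v = ε ^ k := by
    intro v hv hpos
    rcases le_total 1 v with h | h
    · obtain ⟨n, hn⟩ := hε.exists_pow_of_one_le hv h
      exact ⟨n, by simpa using hn⟩
    · obtain ⟨n, hn⟩ := hε.exists_pow_of_one_le hv.inv (by rw [one_le_inv₀ hpos]; exact h)
      exact ⟨-n, by rw [zpow_neg, zpow_natCast, ← hn, inv_inv]⟩
  rcases lt_or_gt_of_ne hu.ne_zero with h | h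
  · obtain ⟨k, hk⟩ := key (-u) hu.neg (by linarith)
    exact ⟨k, Or.inr (by linarith)⟩
  · obtain ⟨k, hk⟩ := key u hu h
    exact ⟨k, Or.inl hk⟩

/-- The norm form of the order `ℤ[P^{1/3}]`. -/
theorem cubic_form_mul (P a b c a' b' c' : ℤ) :
    (a ^ 3 + P * b ^ 3 + P ^ 2 * c ^ 3 - 3 * P * a * b * c) *
      (a' ^ 3 + P * b' ^ 3 + P ^ 2 * c' ^ 3 - 3 * P * a' * b' * c') =
    (a * a' + P * (b * c' + c * b')) ^ 3 + P * (a * b' + b * a' + P * (c * c')) ^ 3 +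
      P ^ 2 * (a * c' + b * b' + c * a') ^ 3 -
      3 * P * (a * a' + P * (b * c' + c * b')) * (a * b' + b * a' + P * (c * c')) *
        (a * c' + b * b' + c * a') := by
  ring

end OrderUnits

namespace PureCubic

variable {P : ℕ} {K : Type*} [Field K] [NumberField K] (S : PureCubic P K)
include S

theorem emb_root : S.emb S.root = cbrt P := by
  have h : S.emb S.root ^ 3 = cbrt P ^ 3 := by
    rw [cbrt_pow_three, ← map_pow, S.cube, map_natCast]
  exact (Odd.strictMono_pow (by decide : Odd 3)).injective h

theorem real_coords_ext {a b c a' b' c' : ℤ} (h : (a : ℝ) + b * cbrt P + c * cbrt P ^ 2 =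
    a' + b' * cbrt P + c' * cbrt P ^ 2) : a = a' ∧ b = b' ∧ c = c' := by
  refine S.coords_ext (S.emb.injective ?_)
  simpa [S.emb_root] using h

/-- The norm form of a positive unit of the order is `1`. -/
theorem form_eq_one {a b c : ℤ} {u : ℝ} (hu : u = (a : ℝ) + b * cbrt P + c * cbrt P ^ 2)
    (hunit : IsUnitOfOrder P u) (hpos : 0 < u) :
    a ^ 3 + P * b ^ 3 + (P : ℤ) ^ 2 * c ^ 3 - 3 * P * a * b * c = 1 := by
  obtain ⟨-, v, ⟨a', b', c', hv⟩, huv⟩ := hunit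
  have hr := cbrt_pow_three P
  have h := S.real_coords_ext (a := a * a' + P * (b * c' + c * b'))
    (b := a * b' + b * a' + P * (c * c')) (c := a * c' + b * b' + c * a')
    (a' := 1) (b' := 0) (c' := 0) (by
      rw [hu, hv] at huv
      push_cast
      linear_combination huv - ((b : ℝ) * c' + c * b' + c * c' * cbrt P) * hr)
  have hmul := cubic_form_mul P a b c a' b' c'
  rw [h.1, h.2.1, h.2.2] at hmul
  have hmul' : (a ^ 3 + P * b ^ 3 + (P : ℤ) ^ 2 * c ^ 3 - 3 * P * a * b * c) *
    (a' ^ 3 + P * b' ^ 3 + (P : ℤ) ^ 2 * c' ^ 3 - 3 * P * a' * b' * c') = 1 := by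
      rw [hmul]; ring
  have hnn : 0 ≤ a ^ 3 + P * b ^ 3 + (P : ℤ) ^ 2 * c ^ 3 - 3 * P * a * b * c := by
    have : (0 : ℝ) ≤ ((a ^ 3 + P * b ^ 3 + (P : ℤ) ^ 2 * c ^ 3 - 3 * P * a * b * c : ℤ) : ℝ) := by
      have e : ((a ^ 3 + P * b ^ 3 + (P : ℤ) ^ 2 * c ^ 3 - 3 * P * a * b * c : ℤ) : ℝ) =
          u * (((a - b * cbrt P) ^ 2 + (b * cbrt P - c * cbrt P ^ 2) ^ 2 +
            (c * cbrt P ^ 2 - a) ^ 2) / 2) := by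
        rw [hu]
        push_cast
        rw [← hr]
        ring
      rw [e]
      positivity
    exact_mod_cast this
  rcases Int.mul_eq_one_iff_eq_one_or_neg_one.1 hmul' with h | h
  · exact h.1
  · omega

/-- A unit `u > 1` of the order satisfies `u * (3 w - u) ^ 2 ≤ 4` for each of the three
components `w` of `u`. -/
theorem unit_component_le {a b c : ℤ} {u : ℝ} (hu : u = (a : ℝ) + b * cbrt P + c * cbrt P ^ 2)
    (hunit : IsUnitOfOrder P u) (hpos : 0 < u) :
    u * (3 * (c * cbrt P ^ 2) - u) ^ 2 ≤ 4 ∧ u * (3 * (b * cbrt P) - u) ^ 2 ≤ 4 := by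
  have h := S.form_eq_one hu hunit hpos
  have h' : (a : ℝ) ^ 3 + P * b ^ 3 + (P : ℝ) ^ 2 * c ^ 3 - 3 * P * a * b * c = 1 := by
    exact_mod_cast h
  have hr := cbrt_pow_three P
  have e : u * (((a - b * cbrt P) ^ 2 + (b * cbrt P - c * cbrt P ^ 2) ^ 2 +
            (c * cbrt P ^ 2 - a) ^ 2) / 2) = 1 := by
    rw [← h', hu, ← hr]
    ring
  constructor
  · have : u * (3 * (c * cbrt P ^ 2) - u) ^ 2 + u * (3 * (a - b * cbrt P) ^ 2) =
      4 * (u * (((a - b * cbrt P) ^ 2 + (b * cbrt P - c * cbrt P ^ 2) ^ 2 +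
            (c * cbrt P ^ 2 - a) ^ 2) / 2)) := by
      rw [hu]; ring
    have : 0 ≤ u * (3 * (a - b * cbrt P) ^ 2) := by positivity
    linarith
  · have : u * (3 * (b * cbrt P) - u) ^ 2 + u * (3 * (a - c * cbrt P ^ 2) ^ 2) =
      4 * (u * (((a - b * cbrt P) ^ 2 + (b * cbrt P - c * cbrt P ^ 2) ^ 2 +
            (c * cbrt P ^ 2 - a) ^ 2) / 2)) := by
      rw [hu]; ring
    have : 0 ≤ u * (3 * (a - c * cbrt P ^ 2) ^ 2) := by positivity
    linarith

theorem cbrt_gt : 1.442 < cbrt P := by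
  have h3 : (3 : ℝ) ≤ P := by exact_mod_cast S.two_lt
  by_contra! h
  have h1 : cbrt P ^ 3 ≤ 1.442 ^ 3 := pow_le_pow_left₀ (cbrt_nonneg P) h 3
  rw [cbrt_pow_three] at h1
  norm_num at h1
  linarith

/-- A unit greater than `1` of the order `ℤ[P^{1/3}]` is greater than `3 P^{2/3} - 1`. -/
theorem unit_gt {u : ℝ} (hunit : IsUnitOfOrder P u) (h1 : 1 < u) :
    3 * cbrt P ^ 2 - 1 < u := by
  obtain ⟨a, b, c, hu⟩ := hunit.1
  obtain ⟨hc, hb⟩ := S.unit_component_le hu hunit (by linarith)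
  have hr := S.cbrt_gt
  have hc2 : (3 * (c * cbrt P ^ 2) - u) ^ 2 < 2 ^ 2 := by
    nlinarith [sq_nonneg (3 * (c * cbrt P ^ 2) - u)]
  have hb2 : (3 * (b * cbrt P) - u) ^ 2 < 2 ^ 2 := by nlinarith [sq_nonneg (3 * (b * cbrt P) - u)]
  rw [sq_lt_sq, abs_lt] at hc2 hb2
  norm_num at hc2 hb2
  have hr2 : 2.079 < cbrt P ^ 2 := by nlinarith
  have hc0 : 0 ≤ c := by
    by_contra! h
    have : (c : ℝ) ≤ -1 := by exact_mod_cast (by omega : c ≤ -1)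
    nlinarith
  have hc1 : 1 ≤ c := by
    by_contra! h
    have hc : c = 0 := by omega
    subst hc
    have hu2 : u < 2 := by
      have : u < 2 := by norm_num at hc2; linarith
      exact this
    have hu3 : u ^ 3 ≤ 4 := by
      norm_num at hc
      linarith
    have hu4 : u < 1.6 := by
      by_contra! h
      have : (1.6 : ℝ) ^ 3 ≤ u ^ 3 := by gcongr
      norm_num at this
      linarith
    have hb0 : b = 0 := by
      have h5 : -1 < b := by
        by_contra! h
        have : (b : ℝ) ≤ -1 := by exact_mod_cast h
        nlinarith
      have h6 : b < 1 := by
        by_contra! h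
        have : (1 : ℝ) ≤ b := by exact_mod_cast h
        nlinarith
      omega
    subst hb0
    have hf := S.form_eq_one hu hunit (by linarith)
    norm_num at hf hu
    have h7 : 1 < a := by exact_mod_cast hu ▸ h1
    nlinarith [sq_nonneg (a + 1)]
  have hc' : (1 : ℝ) ≤ c := by exact_mod_cast hc1
  have hcr : cbrt P ^ 2 ≤ c * cbrt P ^ 2 := by nlinarith
  have hu4 : 4.2 < u := by linarith
  have hc3 : (3 * (c * cbrt P ^ 2) - u) ^ 2 < 1 ^ 2 := by
    nlinarith [sq_nonneg (3 * (c * cbrt P ^ 2) - u)]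
  rw [sq_lt_sq, abs_lt] at hc3
  norm_num at hc3
  linarith

end PureCubic

namespace PureCubic

theorem cbrt_three_bounds : 1.44 < cbrt 3 ∧ cbrt 3 < 1.45 := by
  have h := cbrt_pow_three 3
  have h0 := cbrt_nonneg 3
  constructor
  · by_contra! hc
    have := pow_le_pow_left₀ h0 hc 3
    rw [h] at this
    norm_num at this
  · by_contra! hc
    have := pow_le_pow_left₀ (by norm_num) hc 3
    rw [h] at this
    norm_num at this

theorem cbrt_five_bounds : 1.7 < cbrt 5 ∧ cbrt 5 < 1.72 := by
  have h := cbrt_pow_three 5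
  have h0 := cbrt_nonneg 5
  constructor
  · by_contra! hc
    have := pow_le_pow_left₀ h0 hc 3
    rw [h] at this
    norm_num at this
  · by_contra! hc
    have := pow_le_pow_left₀ (by norm_num) hc 3
    rw [h] at this
    norm_num at this

theorem cbrt_six_bounds : 1.8 < cbrt 6 ∧ cbrt 6 < 1.82 := by
  have h := cbrt_pow_three 6
  have h0 := cbrt_nonneg 6
  constructor
  · by_contra! hc
    have := pow_le_pow_left₀ h0 hc 3
    rw [h] at this
    norm_num at this
  · by_contra! hc
    have := pow_le_pow_left₀ (by norm_num) hc 3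
    rw [h] at this
    norm_num at this

variable {K : Type*} [Field K] [NumberField K]

theorem fundamental_three (S : PureCubic 3 K) {ε : ℝ} (hε : IsFundamentalUnit 3 ε) :
    ε = (4 : ℤ) + (3 : ℤ) * cbrt 3 + (2 : ℤ) * cbrt 3 ^ 2 := by
  have hr := cbrt_pow_three 3
  obtain ⟨h1, h2⟩ := cbrt_three_bounds
  have hu : IsUnitOfOrder 3 ((4 : ℤ) + (3 : ℤ) * cbrt 3 + (2 : ℤ) * cbrt 3 ^ 2) := by
    refine ⟨⟨_, _, _, rfl⟩, _, ⟨-2, 0, 1, rfl⟩, ?_⟩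
    push_cast at hr ⊢
    linear_combination (3 + 2 * cbrt 3) * hr
  push_cast at hu ⊢
  obtain ⟨n, hn⟩ := hε.exists_pow_of_one_le hu (by nlinarith)
  have hgt := S.unit_gt hε.1 hε.2.1
  have hε5 : 5 < ε := by nlinarith
  have hn1 : n < 2 := by
    by_contra! h
    have h3 : ε ^ 2 ≤ ε ^ n := pow_le_pow_right₀ hε.2.1.le h
    nlinarith
  interval_cases n
  · nlinarith
  · linarith

theorem fundamental_five (S : PureCubic 5 K) {ε : ℝ} (hε : IsFundamentalUnit 5 ε) :
    ε = (41 : ℤ) + (24 : ℤ) * cbrt 5 + (14 : ℤ) * cbrt 5 ^ 2 := by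
  have hr := cbrt_pow_three 5
  obtain ⟨h1, h2⟩ := cbrt_five_bounds
  have hu : IsUnitOfOrder 5 ((41 : ℤ) + (24 : ℤ) * cbrt 5 + (14 : ℤ) * cbrt 5 ^ 2) := by
    refine ⟨⟨_, _, _, rfl⟩, _, ⟨1, -4, 2, rfl⟩, ?_⟩
    push_cast at hr ⊢
    linear_combination (-8 + 28 * cbrt 5) * hr
  push_cast at hu ⊢
  obtain ⟨n, hn⟩ := hε.exists_pow_of_one_le hu (by nlinarith)
  have hgt := S.unit_gt hε.1 hε.2.1
  have hε7 : 7.6 < ε := by nlinarith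
  have hn1 : n < 3 := by
    by_contra! h
    have h3 : ε ^ 3 ≤ ε ^ n := pow_le_pow_right₀ hε.2.1.le h
    have h4 : (7.6 : ℝ) ^ 3 ≤ ε ^ 3 := by gcongr
    norm_num at h4
    nlinarith
  interval_cases n
  · nlinarith
  · linarith
  · exfalso
    obtain ⟨a, b, c, hε⟩ := hε.1.1
    obtain ⟨e1, e2, e3⟩ := S.real_coords_ext (a := 41) (b := 24) (c := 14)
      (a' := a * a + 5 * (b * c + c * b)) (b' := a * b + b * a + 5 * (c * c))
      (c' := a * c + b * b + c * a) (by
        rw [hε] at hn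
        push_cast at hn hr ⊢
        linear_combination hn + (2 * b * c + c * c * cbrt 5) * hr)
    have ha : a % 2 = 0 ∨ a % 2 = 1 := by omega
    have hc : c % 2 = 0 ∨ c % 2 = 1 := by omega
    have hb : b % 2 = 0 ∨ b % 2 = 1 := by omega
    have e2' := congrArg (· % 2) e2
    have e3' := congrArg (· % 2) e3
    have hc0 : c % 2 = 0 := by
      rcases ha with ha | ha <;> rcases hb with hb | hb <;> rcases hc with hc | hc <;>
        simp [Int.add_emod, Int.mul_emod, ha, hb, hc] at e2' e3' ⊢
    have hb0 : b % 2 = 0 := by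
      rcases ha with ha | ha <;> rcases hb with hb | hb <;> rcases hc with hc | hc <;>
        simp [Int.add_emod, Int.mul_emod, ha, hb, hc] at e2' e3' ⊢
    obtain ⟨b', rfl⟩ := Int.dvd_of_emod_eq_zero hb0
    obtain ⟨c', rfl⟩ := Int.dvd_of_emod_eq_zero hc0
    have : (14 : ℤ) = 4 * (a * c' + b' * b') := by rw [e3]; ring
    omega

theorem fundamental_six (S : PureCubic 6 K) {ε : ℝ} (hε : IsFundamentalUnit 6 ε) :
    ε = (109 : ℤ) + (60 : ℤ) * cbrt 6 + (33 : ℤ) * cbrt 6 ^ 2 := by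
  have hr := cbrt_pow_three 6
  obtain ⟨h1, h2⟩ := cbrt_six_bounds
  have hu : IsUnitOfOrder 6 ((109 : ℤ) + (60 : ℤ) * cbrt 6 + (33 : ℤ) * cbrt 6 ^ 2) := by
    refine ⟨⟨_, _, _, rfl⟩, _, ⟨1, -6, 3, rfl⟩, ?_⟩
    push_cast at hr ⊢
    linear_combination (-18 + 99 * cbrt 6) * hr
  push_cast at hu ⊢
  obtain ⟨n, hn⟩ := hε.exists_pow_of_one_le hu (by nlinarith)
  have hgt := S.unit_gt hε.1 hε.2.1
  have hε7 : 8 < ε := by nlinarith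
  have hn1 : n < 3 := by
    by_contra! h
    have h3 : ε ^ 3 ≤ ε ^ n := pow_le_pow_right₀ hε.2.1.le h
    have h4 : (8 : ℝ) ^ 3 ≤ ε ^ 3 := by gcongr
    norm_num at h4
    nlinarith
  interval_cases n
  · nlinarith
  · linarith
  · exfalso
    obtain ⟨a, b, c, hε⟩ := hε.1.1
    obtain ⟨e1, e2, e3⟩ := S.real_coords_ext (a := 109) (b := 60) (c := 33)
      (a' := a * a + 6 * (b * c + c * b)) (b' := a * b + b * a + 6 * (c * c))
      (c' := a * c + b * b + c * a) (by
        rw [hε] at hn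
        push_cast at hn hr ⊢
        linear_combination hn + (2 * b * c + c * c * cbrt 6) * hr)
    have ha : a % 4 = 0 ∨ a % 4 = 1 ∨ a % 4 = 2 ∨ a % 4 = 3 := by omega
    have hb : b % 4 = 0 ∨ b % 4 = 1 ∨ b % 4 = 2 ∨ b % 4 = 3 := by omega
    have hc : c % 4 = 0 ∨ c % 4 = 1 ∨ c % 4 = 2 ∨ c % 4 = 3 := by omega
    have e1' := congrArg (· % 4) e1
    have e2' := congrArg (· % 4) e2
    have e3' := congrArg (· % 4) e3
    rcases ha with ha | ha | ha | ha <;> rcases hb with hb | hb | hb | hb <;>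
      rcases hc with hc | hc | hc | hc <;>
      simp [Int.add_emod, Int.mul_emod, ha, hb, hc] at e1' e2' e3'

end PureCubic

open Polynomial in
theorem exists_pureCubic {P : ℕ} (hsq : Squarefree P) (h2 : 2 < P)
    (h9 : P % 9 ≠ 1 ∧ P % 9 ≠ 8) :
    ∃ (K : Type) (_ : Field K) (_ : NumberField K), Nonempty (PureCubic P K) := by
  have hr := cbrt_pow_three P
  have hInt : IsIntegral ℚ (cbrt P) := ⟨X ^ 3 - C (P : ℚ), by monicity!, by simp [hr]⟩
  have hmon : (X ^ 3 - C (P : ℤ) : ℤ[X]).Monic := by monicity!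
  have hirr : Irreducible (X ^ 3 - C (P : ℚ) : ℚ[X]) := by
    have := (Monic.irreducible_iff_irreducible_map_fraction_map (K := ℚ) hmon).1
      (PureCubic.irreducible hsq (by omega))
    simpa using this
  have hmin : minpoly ℚ (cbrt P) = X ^ 3 - C (P : ℚ) :=
    (minpoly.eq_of_irreducible_of_monic hirr (by simp [hr]) (by monicity!)).symm
  have : FiniteDimensional ℚ (IntermediateField.adjoin ℚ {cbrt P}) :=
    IntermediateField.adjoin.finiteDimensional hInt
  have hnf : NumberField (IntermediateField.adjoin ℚ {cbrt P}) := ⟨⟩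
  refine ⟨IntermediateField.adjoin ℚ {cbrt P}, inferInstance, hnf, ⟨?_⟩⟩
  refine
    { emb := algebraMap _ ℝ
      root := IntermediateField.AdjoinSimple.gen ℚ (cbrt P)
      cube := ?_
      finrank := ?_
      sqfree := hsq
      two_lt := h2
      mod9 := h9 }
  · apply (algebraMap (IntermediateField.adjoin ℚ {cbrt P}) ℝ).injective
    rw [map_pow, IntermediateField.AdjoinSimple.algebraMap_gen, hr, map_natCast]
  · rw [IntermediateField.adjoin.finrank hInt, hmin]
    compute_degree!

namespace PureCubic

open NumberField

variable {P : ℕ} {K : Type*} [Field K] [NumberField K] (S : PureCubic P K)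
include S

theorem emb_eq_of_real (φ : K →+* ℝ) : φ = S.emb := by
  have h : φ S.root = S.emb S.root := by
    refine (Odd.strictMono_pow (by decide : Odd 3)).injective ?_
    rw [← map_pow, ← map_pow, S.cube, map_natCast, map_natCast]
  have h2 : φ.toRatAlgHom = S.emb.toRatAlgHom := S.powerBasis.algHom_ext h
  ext x
  exact DFunLike.congr_fun h2 x

/-- The real place of `K`. -/
noncomputable def realPlace : InfinitePlace K := InfinitePlace.mk (Complex.ofRealHom.comp S.emb)

theorem realPlace_apply (x : K) : S.realPlace x = |S.emb x| := by
  simp [realPlace, InfinitePlace.apply]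

theorem isReal_realPlace : S.realPlace.IsReal :=
  InfinitePlace.isReal_mk_iff.2 (by
    ext x
    simp)

theorem eq_realPlace {w : InfinitePlace K} (hw : w.IsReal) : w = S.realPlace := by
  have h := S.emb_eq_of_real (InfinitePlace.embedding_of_isReal hw)
  ext x
  rw [S.realPlace_apply, ← h, ← InfinitePlace.norm_embedding_of_isReal hw, Real.norm_eq_abs]

open scoped Classical in
theorem nrRealPlaces_eq : InfinitePlace.nrRealPlaces K = 1 := by
  rw [InfinitePlace.nrRealPlaces, Fintype.card_eq_one_iff]
  exact ⟨⟨S.realPlace, S.isReal_realPlace⟩, fun w => Subtype.ext (S.eq_realPlace w.2)⟩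

open scoped Classical in
theorem nrComplexPlaces_eq : InfinitePlace.nrComplexPlaces K = 1 := by
  have h := InfinitePlace.card_add_two_mul_card_eq_rank K
  rw [S.nrRealPlaces_eq, S.finrank] at h
  omega

open scoped Classical in
theorem exists_complexPlace : ∃ w : InfinitePlace K, w.IsComplex ∧
    (∀ w' : InfinitePlace K, w'.IsComplex → w' = w) ∧
    ∀ x : K, |S.emb x| * w x ^ 2 = |Algebra.norm ℚ x| := by
  have h := S.nrComplexPlaces_eq
  rw [InfinitePlace.nrComplexPlaces, Fintype.card_eq_one_iff] at h
  obtain ⟨⟨w, hw⟩, hu⟩ := h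
  have hu' : ∀ w' : InfinitePlace K, w'.IsComplex → w' = w :=
    fun w' hw' => congrArg Subtype.val (hu ⟨w', hw'⟩)
  refine ⟨w, hw, hu', fun x => ?_⟩
  rw [← InfinitePlace.prod_eq_abs_norm]
  have hne : S.realPlace ≠ w := fun h => InfinitePlace.not_isReal_iff_isComplex.2 hw
    (h ▸ S.isReal_realPlace)
  have huniv : (Finset.univ : Finset (InfinitePlace K)) = {S.realPlace, w} := by
    ext w'
    simp only [Finset.mem_univ, Finset.mem_insert, Finset.mem_singleton, true_iff]
    rcases w'.isReal_or_isComplex with h | h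
    · exact Or.inl (S.eq_realPlace h)
    · exact Or.inr (hu' w' h)
  rw [huniv, Finset.prod_pair hne, InfinitePlace.mult_isReal ⟨_, S.isReal_realPlace⟩,
    InfinitePlace.mult_isComplex ⟨_, hw⟩, pow_one, S.realPlace_apply]

/-- The cube root as an algebraic integer. -/
noncomputable def rootInt : 𝓞 K := ⟨S.root, S.isIntegral_root⟩

theorem coe_rootInt : (S.rootInt : K) = S.root := rfl

theorem rootInt_cube : S.rootInt ^ 3 = (P : 𝓞 K) := by
  apply RingOfIntegers.ext
  simp [coe_rootInt, S.cube]

theorem exists_coords_int (x : 𝓞 K) :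
    ∃ a b c : ℤ, x = a + b * S.rootInt + c * S.rootInt ^ 2 := by
  obtain ⟨a, b, c, h⟩ := S.exists_coords x.isIntegral_coe
  refine ⟨a, b, c, RingOfIntegers.ext ?_⟩
  refine h.trans ?_
  simp [coe_rootInt]

theorem coords_int_ext {a b c a' b' c' : ℤ} (h : (a : 𝓞 K) + b * S.rootInt + c * S.rootInt ^ 2 =
    a' + b' * S.rootInt + c' * S.rootInt ^ 2) : a = a' ∧ b = b' ∧ c = c' := by
  refine S.coords_ext ?_
  have := congrArg (algebraMap (𝓞 K) K) h
  simpa [coe_rootInt] using this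

theorem inOrder_emb (x : 𝓞 K) : InOrder P (S.emb x) := by
  obtain ⟨a, b, c, h⟩ := S.exists_coords x.isIntegral_coe
  refine ⟨a, b, c, ?_⟩
  rw [show (x : K) = _ from h]
  simp [S.emb_root]

theorem isUnitOfOrder_emb (u : (𝓞 K)ˣ) : IsUnitOfOrder P (S.emb ((u : 𝓞 K) : K)) := by
  refine ⟨S.inOrder_emb _, _, S.inOrder_emb ((u⁻¹ : (𝓞 K)ˣ) : 𝓞 K), ?_⟩
  rw [← map_mul, ← map_mul]
  simp

theorem exists_unit_of_isUnitOfOrder {ε : ℝ} (hε : IsUnitOfOrder P ε) :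
    ∃ u : (𝓞 K)ˣ, S.emb ((u : 𝓞 K) : K) = ε := by
  obtain ⟨⟨a, b, c, h⟩, v, ⟨a', b', c', h'⟩, hv⟩ := hε
  have e1 : S.emb (((a : 𝓞 K) + b * S.rootInt + c * S.rootInt ^ 2 : 𝓞 K) : K) = ε := by
    simp [coe_rootInt, S.emb_root, h]
  have e2 : S.emb (((a' : 𝓞 K) + b' * S.rootInt + c' * S.rootInt ^ 2 : 𝓞 K) : K) = v := by
    simp [coe_rootInt, S.emb_root, h']
  have e3 : ((a : 𝓞 K) + b * S.rootInt + c * S.rootInt ^ 2) *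
      ((a' : 𝓞 K) + b' * S.rootInt + c' * S.rootInt ^ 2) = 1 := by
    apply RingOfIntegers.ext
    apply S.emb.injective
    rw [show ∀ x y : 𝓞 K, ((x * y : 𝓞 K) : K) = x * y from fun _ _ => rfl, map_mul, e1, e2, hv]
    simp
  exact ⟨Units.mkOfMulEqOne _ _ e3, e1⟩

theorem emb_coe_injective {x y : 𝓞 K} (h : S.emb (x : K) = S.emb (y : K)) : x = y :=
  RingOfIntegers.ext (S.emb.injective h)

/-- The units of `𝓞 K` are, up to sign, the powers of the fundamental unit. -/
theorem exists_unit_zpow {ε : ℝ} (hε : IsFundamentalUnit P ε) :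
    ∃ η : (𝓞 K)ˣ, S.emb ((η : 𝓞 K) : K) = ε ∧ ∀ u : (𝓞 K)ˣ, ∃ k : ℤ, u = η ^ k ∨ u = -η ^ k := by
  obtain ⟨η, hη⟩ := S.exists_unit_of_isUnitOfOrder hε.1
  refine ⟨η, hη, fun u => ?_⟩
  have hpow : ∀ k : ℤ, S.emb (((η ^ k : (𝓞 K)ˣ) : 𝓞 K) : K) = ε ^ k := by
    intro k
    rw [← hη]
    have h := congrArg Units.val (map_zpow (Units.map
      ((S.emb.comp (algebraMap (𝓞 K) K) : 𝓞 K →+* ℝ) : 𝓞 K →* ℝ)) η k)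
    rw [Units.val_zpow_eq_zpow_val] at h
    exact h
  obtain ⟨k, hk | hk⟩ := hε.exists_zpow (S.isUnitOfOrder_emb u)
  · refine ⟨k, Or.inl (Units.ext (S.emb_coe_injective ?_))⟩
    rw [hk, hpow]
  · refine ⟨k, Or.inr (Units.ext (S.emb_coe_injective ?_))⟩
    rw [hk]
    simp [hpow]

end PureCubic

open MeasureTheory ENNReal in
theorem lintegral_comp_smul_addHaar {E : Type*} [NormedAddCommGroup E] [NormedSpace ℝ E]
    [MeasurableSpace E] [BorelSpace E] [FiniteDimensional ℝ E] (μ : Measure E)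
    [μ.IsAddHaarMeasure] {f : E → ℝ≥0∞} (hf : Measurable f) {r : ℝ} (hr : r ≠ 0) :
    ∫⁻ x, f (r • x) ∂μ =
      ENNReal.ofReal |(r ^ Module.finrank ℝ E)⁻¹| * ∫⁻ x, f x ∂μ := by
  rw [← lintegral_map hf (measurable_const_smul r), Measure.map_addHaar_smul μ hr,
    lintegral_smul_measure, smul_eq_mul]

open MeasureTheory ENNReal in
theorem lintegral_sq_le_measure_mul {α : Type*} [MeasurableSpace α] (μ : Measure α)
    {f : α → ℝ≥0∞} (hf : Measurable f) :
    (∫⁻ x, f x ∂μ) ^ 2 ≤ μ Set.univ * ∫⁻ x, f x ^ 2 ∂μ := by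
  have h := ENNReal.lintegral_mul_le_Lp_mul_Lq μ Real.HolderConjugate.two_two hf.aemeasurable
    (aemeasurable_const (b := (1 : ℝ≥0∞)))
  have h2 : (∫⁻ x, f x ∂μ) ≤ (∫⁻ x, f x ^ 2 ∂μ) ^ (1 / 2 : ℝ) * μ Set.univ ^ (1 / 2 : ℝ) := by
    simpa using h
  calc (∫⁻ x, f x ∂μ) ^ 2
      ≤ ((∫⁻ x, f x ^ 2 ∂μ) ^ (1 / 2 : ℝ) * μ Set.univ ^ (1 / 2 : ℝ)) ^ 2 := by gcongr
    _ = μ Set.univ * ∫⁻ x, f x ^ 2 ∂μ := by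
      rw [mul_pow, ← ENNReal.rpow_mul_natCast, ← ENNReal.rpow_mul_natCast]
      norm_num [mul_comm]

open MeasureTheory ENNReal in
/-- A lower bound for the theta series of a lattice: `∑ exp (-Q n)` is at least the integral of
`exp (-Q)` divided by the covolume. -/
theorem lintegral_exp_neg_le_covolume_mul_tsum {E : Type*} [NormedAddCommGroup E]
    [NormedSpace ℝ E] [MeasurableSpace E] [BorelSpace E] [FiniteDimensional ℝ E] (μ : Measure E)
    [μ.IsAddHaarMeasure] (L : AddSubgroup E) [Countable L] {F : Set E}
    (hF : IsAddFundamentalDomain L F μ) {Q : E → ℝ} (hQ : Measurable Q)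
    (hpar : ∀ x y, Q (x + y) + Q (x - y) = 2 * Q x + 2 * Q y)
    (hhom : ∀ (c : ℝ) x, Q (c • x) = c ^ 2 * Q x)
    (hfin : ∫⁻ x, ENNReal.ofReal (Real.exp (-Q x)) ∂μ ≠ ⊤) :
    ∫⁻ x, ENNReal.ofReal (Real.exp (-Q x)) ∂μ ≤
      μ F * ∑' n : L, ENNReal.ofReal (Real.exp (-Q n)) := by
  set e : E → ℝ≥0∞ := fun x => ENNReal.ofReal (Real.exp (-Q x)) with he
  have hem : Measurable e := by fun_prop
  set I := ∫⁻ x, e x ∂μ with hI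
  set d := Module.finrank ℝ E
  set g : E → ℝ≥0∞ := fun x => ENNReal.ofReal (Real.exp (-(2 * Q x))) with hg
  have hgm : Measurable g := by fun_prop
  set G : E → ℝ≥0∞ := fun x => ∑' n : L, g (n + x) with hG
  have hGm : Measurable G := Measurable.tsum fun n => by fun_prop
  have hunfold : ∀ f : E → ℝ≥0∞, ∫⁻ x, f x ∂μ = ∑' n : L, ∫⁻ x in F, f (n + x) ∂μ := by
    intro f
    rw [hF.lintegral_eq_tsum'' f]
    rfl
  have h1 : ∫⁻ x in F, G x ∂μ = ∫⁻ x, g x ∂μ := by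
    rw [hunfold g, lintegral_tsum fun n => by fun_prop]
  have h2 : ∫⁻ x, g x ∂μ = ENNReal.ofReal |(√2 ^ d)⁻¹| * I := by
    rw [hI, ← lintegral_comp_smul_addHaar μ hem (by positivity : √2 ≠ 0)]
    refine lintegral_congr fun x => ?_
    simp only [he, hg, hhom, Real.sq_sqrt (zero_le_two : (0 : ℝ) ≤ 2)]
  have hsq : ∀ x, G x ^ 2 = ∑' k : L, ∑' n : L, g (n + x) * g (n + x + k) := by
    intro x
    rw [sq, hG, ENNReal.tsum_comm]
    simp only
    rw [← ENNReal.tsum_mul_right]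
    refine tsum_congr fun n => ?_
    rw [← ENNReal.tsum_mul_left]
    rw [← (Equiv.addLeft n).tsum_eq]
    refine tsum_congr fun k => ?_
    congr 2
    simp only [Equiv.coe_addLeft, AddSubgroup.coe_add]
    abel
  have h3 : ∫⁻ x in F, G x ^ 2 ∂μ =
      ENNReal.ofReal |((2 : ℝ) ^ d)⁻¹| * I * ∑' k : L, e k := by
    simp_rw [hsq]
    rw [lintegral_tsum fun n => by fun_prop, ← ENNReal.tsum_mul_left]
    refine tsum_congr fun k => ?_
    rw [lintegral_tsum fun n => by fun_prop]
    have := hunfold fun x => g x * g (x + k)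
    rw [← this]
    have hprod : ∀ x, g x * g (x + k) = e ((2 : ℝ) • x + k) * e k := by
      intro x
      simp only [hg, he]
      rw [← ENNReal.ofReal_mul (Real.exp_pos _).le, ← ENNReal.ofReal_mul (Real.exp_pos _).le,
        ← Real.exp_add, ← Real.exp_add]
      have := hpar (x + k) x
      rw [show x + (k : E) + x = (2 : ℝ) • x + k by rw [two_smul]; abel,
        show x + (k : E) - x = k by abel] at this
      congr 2
      linarith
    simp_rw [hprod]
    rw [lintegral_mul_const _ (by fun_prop),
      lintegral_comp_smul_addHaar μ (f := fun x => e (x + k)) (by fun_prop) two_ne_zero,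
      lintegral_add_right_eq_self]
  have hCS := lintegral_sq_le_measure_mul (μ.restrict F) hGm
  rw [h1, h2, h3, Measure.restrict_apply_univ, mul_pow] at hCS
  have hc : ENNReal.ofReal |(√2 ^ d)⁻¹| ^ 2 = ENNReal.ofReal |((2 : ℝ) ^ d)⁻¹| := by
    rw [← ENNReal.ofReal_pow (abs_nonneg _), sq_abs, inv_pow, ← pow_mul, mul_comm d, pow_mul,
      Real.sq_sqrt zero_le_two, abs_of_nonneg (by positivity)]
  rw [hc] at hCS
  set c := ENNReal.ofReal |((2 : ℝ) ^ d)⁻¹| with hcdef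
  have hc0 : c ≠ 0 := by
    rw [hcdef, Ne, ENNReal.ofReal_eq_zero, not_le]
    positivity
  have hcT : c ≠ ⊤ := ENNReal.ofReal_ne_top
  rcases eq_or_ne I 0 with h0 | h0
  · rw [h0]; exact zero_le
  have h5 : (c * I) * I ≤ (c * I) * (μ F * ∑' k : L, e k) := by
    calc (c * I) * I = c * I ^ 2 := by ring
      _ ≤ _ := hCS
      _ = _ := by ring
  exact (ENNReal.mul_le_mul_iff_right (mul_ne_zero hc0 h0) (ENNReal.mul_ne_top hcT hfin)).1 h5

open Real MeasureTheory in
theorem lintegral_gaussian_complex {b : ℝ} (hb : 0 < b) :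
    ∫⁻ z : ℂ, ENNReal.ofReal (rexp (-(b * ‖z‖ ^ 2))) = ENNReal.ofReal (π / b) := by
  have h := GaussianFourier.integral_rexp_neg_mul_sq_norm (V := ℂ) hb
  have h2 : ∫ v : ℂ, rexp (-b * ‖v‖ ^ 2) = π / b := by
    rw [h]; simp
  rw [← h2, ofReal_integral_eq_lintegral_ofReal]
  · simp
  · by_contra hc
    rw [integral_undef hc] at h2
    have : 0 < π / b := by positivity
    linarith
  · exact ae_of_all _ fun _ => (exp_pos _).le

open Real MeasureTheory in
theorem lintegral_gaussian_real {b : ℝ} (hb : 0 < b) :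
    ∫⁻ x : ℝ, ENNReal.ofReal (rexp (-(b * x ^ 2))) = ENNReal.ofReal √(π / b) := by
  rw [← integral_gaussian, ofReal_integral_eq_lintegral_ofReal]
  · simp
  · exact integrable_exp_neg_mul_sq hb
  · exact ae_of_all _ fun _ => (exp_pos _).le

namespace PureCubic

open NumberField NumberField.mixedEmbedding MeasureTheory
open scoped nonZeroDivisors

variable {P : ℕ} {K : Type*} [Field K] [NumberField K] (S : PureCubic P K)
include S

open scoped Classical in
theorem lintegral_mixedSpace {w : InfinitePlace K} (hw : w.IsComplex)
    (hu : ∀ w' : InfinitePlace K, w'.IsComplex → w' = w) {f : ℝ → ENNReal} {g : ℂ → ENNReal}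
    (hf : Measurable f) (hg : Measurable g) :
    ∫⁻ v : mixedSpace K, f (v.1 ⟨S.realPlace, S.isReal_realPlace⟩) * g (v.2 ⟨w, hw⟩) =
      (∫⁻ x, f x) * ∫⁻ y, g y := by
  let u1 : Unique {w : InfinitePlace K // w.IsReal} :=
    ⟨⟨⟨S.realPlace, S.isReal_realPlace⟩⟩, fun w => Subtype.ext (S.eq_realPlace w.2)⟩
  let u2 : Unique {w : InfinitePlace K // w.IsComplex} :=
    ⟨⟨⟨w, hw⟩⟩, fun w => Subtype.ext (hu _ w.2)⟩
  have h1 := (volume_preserving_funUnique {w : InfinitePlace K // w.IsReal} ℝ).lintegral_comp hf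
  have h2 := (volume_preserving_funUnique {w : InfinitePlace K // w.IsComplex} ℂ).lintegral_comp hg
  rw [← h1, ← h2, ← lintegral_prod_mul (by fun_prop) (by fun_prop)]
  congr 1
  · rw [Measure.volume_eq_prod]
    congr 1 <;> simp only [volume_pi] <;> congr!

open scoped Classical in
theorem exists_fundamentalDomain (I : (FractionalIdeal (𝓞 K)⁰ K)ˣ) :
    ∃ F : Set (mixedSpace K), IsAddFundamentalDomain (idealLattice K I).toAddSubgroup F volume ∧
      volume F = ENNReal.ofReal (FractionalIdeal.absNorm I.1 * (√27 * P / 2)) := by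
  classical
  refine ⟨_, fundamentalDomain_idealLattice K I, ?_⟩
  rw [volume_fundamentalDomain_fractionalIdealLatticeBasis, volume_fundamentalDomain_latticeBasis,
    S.nrComplexPlaces_eq, S.discr_eq, ENNReal.ofReal_mul
      (Rat.cast_nonneg.2 (FractionalIdeal.absNorm_nonneg _))]
  congr 1
  have h : NNReal.sqrt ‖(-27 * (P : ℤ) ^ 2)‖₊ = Real.toNNReal (√27 * P) := by
    ext
    simp only [Real.coe_sqrt, coe_nnnorm, Int.norm_eq_abs]
    push_cast
    rw [abs_mul, abs_neg, abs_pow, Real.sqrt_mul (abs_nonneg _), Nat.abs_cast,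
      Real.sqrt_sq (Nat.cast_nonneg _), Real.coe_toNNReal _ (by positivity)]
    norm_num
  rw [h, div_eq_inv_mul, ENNReal.ofReal_mul (by positivity)]
  congr 1
  rw [ENNReal.ofReal_inv_of_pos two_pos]
  simp

open Real in
/-- A lower bound for the theta series of an ideal. -/
theorem theta_bound {w : InfinitePlace K} (hw : w.IsComplex)
    (hu : ∀ w' : InfinitePlace K, w'.IsComplex → w' = w) {J : Ideal (𝓞 K)} (hJ : J ≠ ⊥)
    {A B : ℝ} (hA : 0 < A) (hB : 0 < B) :
    ENNReal.ofReal (√(π / A) * (π / B)) ≤ ENNReal.ofReal (Ideal.absNorm J * (√27 * P / 2)) *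
      ∑' x : J, ENNReal.ofReal (rexp (-(A * S.emb (x : 𝓞 K) ^ 2 + B * w (x : 𝓞 K) ^ 2))) := by
  classical
  obtain ⟨F, hF, hFv⟩ := S.exists_fundamentalDomain
    (FractionalIdeal.mk0 K ⟨J, mem_nonZeroDivisors_of_ne_zero hJ⟩)
  set Q : mixedSpace K → ℝ := fun v =>
    A * v.1 ⟨S.realPlace, S.isReal_realPlace⟩ ^ 2 + B * ‖v.2 ⟨w, hw⟩‖ ^ 2 with hQ
  have hInt : ∫⁻ v, ENNReal.ofReal (rexp (-Q v)) = ENNReal.ofReal (√(π / A) * (π / B)) := by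
    have h := S.lintegral_mixedSpace hw hu (f := fun x => ENNReal.ofReal (rexp (-(A * x ^ 2))))
      (g := fun z => ENNReal.ofReal (rexp (-(B * ‖z‖ ^ 2)))) (by fun_prop) (by fun_prop)
    rw [lintegral_gaussian_complex hB, lintegral_gaussian_real hA, ← ENNReal.ofReal_mul
      (by positivity)] at h
    rw [← h]
    refine lintegral_congr fun v => ?_
    rw [← ENNReal.ofReal_mul (exp_pos _).le, ← exp_add, hQ]
    ring_nf
  rw [← hInt]
  have : Countable (idealLattice K (FractionalIdeal.mk0 K
      ⟨J, mem_nonZeroDivisors_of_ne_zero hJ⟩)).toAddSubgroup := by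
    change Countable (idealLattice K _)
    infer_instance
  refine (lintegral_exp_neg_le_covolume_mul_tsum volume _ hF (Q := Q) (by fun_prop) ?_ ?_ ?_).trans
    ?_
  · intro x y
    have := parallelogram_law_with_norm ℝ (x.2 ⟨w, hw⟩) (y.2 ⟨w, hw⟩)
    simp only [hQ, Prod.fst_add, Prod.snd_add, Prod.fst_sub, Prod.snd_sub, Pi.add_apply,
      Pi.sub_apply]
    linear_combination B * this
  · intro c x
    simp only [hQ, Prod.smul_fst, Prod.smul_snd, Pi.smul_apply, _root_.norm_smul, smul_eq_mul,
      Real.norm_eq_abs, mul_pow, sq_abs]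
    ring
  · rw [hInt]; exact ENNReal.ofReal_ne_top
  · rw [hFv, FractionalIdeal.coe_mk0, FractionalIdeal.coeIdeal_absNorm]
    simp only [Rat.cast_natCast]
    gcongr
    have hmem : ∀ v : (idealLattice K (FractionalIdeal.mk0 K
        ⟨J, mem_nonZeroDivisors_of_ne_zero hJ⟩)).toAddSubgroup,
        ∃ x : J, mixedEmbedding K (x : 𝓞 K) = v := by
      rintro ⟨v, hv⟩
      obtain ⟨y, hy, rfl⟩ := (mem_idealLattice K _).1 hv
      obtain ⟨x, hx, rfl⟩ := hy
      exact ⟨⟨x, hx⟩, rfl⟩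
    choose φ hφ using hmem
    have hinj : Function.Injective φ := fun u v h => Subtype.ext (by rw [← hφ u, ← hφ v, h])
    refine le_trans (le_of_eq ?_) (ENNReal.tsum_comp_le_tsum_of_injective hinj _)
    refine tsum_congr fun v => ?_
    rw [← hφ v]
    simp only [hQ, mixedEmbedding_apply_isReal, mixedEmbedding_apply_isComplex]
    rw [InfinitePlace.norm_embedding_eq,
      S.emb_eq_of_real (InfinitePlace.embedding_of_isReal S.isReal_realPlace)]

end PureCubic

open MeasureTheory in
theorem tsum_setLIntegral_Ioc_add_zsmul {R : ℝ} (hR : 0 < R) (φ : ℝ → ENNReal) :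
    ∑' k : ℤ, ∫⁻ t in Set.Ioc 0 R, φ (t + k * R) = ∫⁻ t, φ t := by
  rw [← setLIntegral_univ φ, ← iUnion_Ioc_zsmul hR,
    lintegral_iUnion (fun _ => measurableSet_Ioc) (Set.pairwise_disjoint_Ioc_zsmul R)]
  refine tsum_congr fun k => ?_
  have h := (measurePreserving_add_right volume ((k : ℝ) * R)).setLIntegral_comp_preimage_emb
    (MeasurableEquiv.addRight ((k : ℝ) * R)).measurableEmbedding φ
    (Set.Ioc (k • R) ((k + 1) • R))
  rw [← h]
  congr 2
  ext t
  simp only [Set.mem_Ioc, Set.mem_preimage, zsmul_eq_mul, Int.cast_add, Int.cast_one]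
  constructor <;> rintro ⟨h1, h2⟩ <;> constructor <;> linarith

theorem tsum_subtype_le_add_tsum_ne {α : Type*} (p : α → Prop) (a : α) (F : α → ENNReal) :
    ∑' x : {x // p x}, F x ≤ F a + ∑' x : {x // p x ∧ x ≠ a}, F x := by
  classical
  have hinj : Function.Injective (fun x : {x // p x} =>
      if h : x.1 = a then (none : Option {x // p x ∧ x ≠ a}) else some ⟨x.1, x.2, h⟩) := by
    rintro ⟨x, hx⟩ ⟨y, hy⟩ h
    by_cases h1 : x = a <;> by_cases h2 : y = a <;> simp_all
  have h := ENNReal.tsum_comp_le_tsum_of_injective hinj (fun o => o.elim (F a) (fun x => F x))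
  rw [← (Equiv.optionEquivSumPUnit.{0} {x // p x ∧ x ≠ a}).symm.tsum_eq,
    ENNReal.summable.tsum_sum ENNReal.summable, add_comm] at h
  refine le_trans (le_of_eq (tsum_congr fun x => ?_)) (h.trans (by simp))
  by_cases h1 : x.1 = a <;> simp [h1]

open MeasureTheory in
/-- The Mellin-type transform of the Gaussian of signature `(1, 1)`. -/
noncomputable def heatKernel (s : ℝ) : ENNReal :=
  ∫⁻ t : ℝ, ENNReal.ofReal (Real.exp (-(Real.exp (2 * t) + s * Real.exp (-t))))

open MeasureTheory in
theorem lintegral_eq_heatKernel {x y b : ℝ} (hx : x ≠ 0) :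
    ∫⁻ t : ℝ, ENNReal.ofReal
      (Real.exp (-(Real.exp (2 * t) * x ^ 2 + b * Real.exp (-t) * y ^ 2))) =
      heatKernel (b * (|x| * y ^ 2)) := by
  have hx' : 0 < |x| := abs_pos.2 hx
  refine Eq.symm (Eq.trans ?_ (lintegral_add_right_eq_self _ (-Real.log |x|)))
  rw [heatKernel]
  refine lintegral_congr fun t => ?_
  congr 3
  rw [mul_add, Real.exp_add, two_mul (-Real.log _), Real.exp_add, Real.exp_neg (Real.log _),
    Real.exp_log hx', neg_add, neg_neg, Real.exp_add (-t), Real.exp_log hx', ← sq, ← sq_abs x]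
  field_simp

namespace PureCubic

open NumberField MeasureTheory
open scoped nonZeroDivisors

variable {P : ℕ} {K : Type*} [Field K] [NumberField K] (S : PureCubic P K)
include S

theorem emb_zpow (η : (𝓞 K)ˣ) (k : ℤ) :
    S.emb (((η ^ k : (𝓞 K)ˣ) : 𝓞 K) : K) = S.emb ((η : 𝓞 K) : K) ^ k := by
  have h := congrArg Units.val (map_zpow (Units.map
    ((S.emb.comp (algebraMap (𝓞 K) K) : 𝓞 K →+* ℝ) : 𝓞 K →* ℝ)) η k)
  rw [Units.val_zpow_eq_zpow_val] at h
  exact h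

/-- Contribution of an ideal class to the class number estimate. -/
theorem class_bound {ε : ℝ} (hε : IsFundamentalUnit P ε) {μ b : ℝ} (hμ : 1 ≤ μ)
    (hb : b * (μ * (√27 * P / 2)) = √Real.pi * Real.pi) (C : ClassGroup (𝓞 K)) :
    ENNReal.ofReal (Real.log ε) * ENNReal.ofReal (μ - 1) ≤
      2 * ∑' 𝔞 : {𝔞 : (Ideal (𝓞 K))⁰ // ClassGroup.mk0 𝔞 = C},
        heatKernel (b * Ideal.absNorm (𝔞 : Ideal (𝓞 K))) := by
  obtain ⟨η, hη, hunits⟩ := S.exists_unit_zpow hε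
  obtain ⟨w, hw, hwu, hnorm⟩ := S.exists_complexPlace
  obtain ⟨⟨J, hJ⟩, hJC⟩ := ClassGroup.mk0_surjective C⁻¹
  have hJ0 : J ≠ ⊥ := nonZeroDivisors.ne_zero hJ
  have hP : (0 : ℝ) < P := by have := S.two_lt; positivity
  have hNJ : (0 : ℝ) < Ideal.absNorm J := by
    exact_mod_cast Nat.pos_of_ne_zero (Ideal.absNorm_ne_zero_of_nonZeroDivisors ⟨J, hJ⟩)
  have hε1 : 1 < ε := hε.2.1
  set R := Real.log ε with hR
  have hR0 : 0 < R := Real.log_pos hε1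
  have hpi := Real.pi_pos
  have hb0 : 0 < b := by
    by_contra! h
    have : 0 < √Real.pi * Real.pi := by positivity
    have h2 : 0 ≤ μ * (√27 * P / 2) := by positivity
    nlinarith
  set β := b / Ideal.absNorm J with hβ
  have hβ0 : 0 < β := by positivity
  set f : ℝ → 𝓞 K → ENNReal := fun t x => ENNReal.ofReal
    (Real.exp (-(Real.exp (2 * t) * S.emb x ^ 2 + β * Real.exp (-t) * w x ^ 2))) with hf
  have htheta : ∀ t, ENNReal.ofReal (μ - 1) ≤ ∑' x : {x : 𝓞 K // x ∈ J ∧ x ≠ 0}, f t x := by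
    intro t
    have h := S.theta_bound hw hwu hJ0 (Real.exp_pos (2 * t))
      (by positivity : 0 < β * Real.exp (-t))
    have hc : √(Real.pi / Real.exp (2 * t)) * (Real.pi / (β * Real.exp (-t))) =
        Ideal.absNorm J * (√27 * P / 2) * μ := by
      rw [two_mul, Real.exp_add, Real.sqrt_div hpi.le, Real.sqrt_mul_self (Real.exp_pos t).le,
        Real.exp_neg, hβ]
      field_simp
      linear_combination -2 * hb
    rw [hc, ENNReal.ofReal_mul (by positivity), ENNReal.mul_le_mul_iff_right
      (by simp only [ne_eq, ENNReal.ofReal_eq_zero, not_le]; positivity)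
      ENNReal.ofReal_ne_top] at h
    have h0 := h.trans (tsum_subtype_le_add_tsum_ne (fun x => x ∈ J) 0 (f t))
    rw [ENNReal.ofReal_sub _ zero_le_one, tsub_le_iff_left]
    simpa [hf] using h0
  have : Countable (𝓞 K) := by
    have hs : Function.Surjective (fun n : ℤ × ℤ × ℤ =>
        (n.1 : 𝓞 K) + n.2.1 * S.rootInt + n.2.2 * S.rootInt ^ 2) := fun x => by
      obtain ⟨a, b, c, h⟩ := S.exists_coords_int x
      exact ⟨(a, b, c), h.symm⟩
    exact hs.countable
  have hInt : ENNReal.ofReal R * ENNReal.ofReal (μ - 1) ≤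
      ∑' x : {x : 𝓞 K // x ∈ J ∧ x ≠ 0}, ∫⁻ t in Set.Ioc 0 R, f t x := by
    rw [← lintegral_tsum fun x => by fun_prop]
    calc _ = ∫⁻ t in Set.Ioc 0 R, ENNReal.ofReal (μ - 1) := by
          rw [setLIntegral_const, Real.volume_Ioc, sub_zero, mul_comm]
      _ ≤ _ := lintegral_mono fun t => htheta t
  have hprin : ∀ 𝔞 : {𝔞 : (Ideal (𝓞 K))⁰ // ClassGroup.mk0 𝔞 = C},
      ∃ x : 𝓞 K, x ≠ 0 ∧ (𝔞 : Ideal (𝓞 K)) * J = Ideal.span {x} := by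
    rintro ⟨⟨𝔞, h𝔞⟩, hC⟩
    have h1 : ClassGroup.mk0 (⟨𝔞 * J, mul_mem h𝔞 hJ⟩ : (Ideal (𝓞 K))⁰) = 1 := by
      have : (⟨𝔞 * J, mul_mem h𝔞 hJ⟩ : (Ideal (𝓞 K))⁰) = ⟨𝔞, h𝔞⟩ * ⟨J, hJ⟩ := rfl
      rw [this, map_mul, hC, hJC, mul_inv_cancel]
    obtain ⟨x, hx⟩ := ((ClassGroup.mk0_eq_one_iff _).1 h1).principal
    refine ⟨x, ?_, hx⟩
    rintro rfl
    exact nonZeroDivisors.ne_zero (mul_mem h𝔞 hJ) (hx.trans (by simp))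
  choose x0 hx0 hx0J using hprin
  have hex : ∀ x : {x : 𝓞 K // x ∈ J ∧ x ≠ 0},
      ∃ t : {𝔞 : (Ideal (𝓞 K))⁰ // ClassGroup.mk0 𝔞 = C} × ℤ × Bool,
        (x : 𝓞 K) = (if t.2.2 then 1 else -1) * ((η ^ t.2.1 : (𝓞 K)ˣ) : 𝓞 K) * x0 t.1 := by
    rintro ⟨x, hxJ, hx⟩
    obtain ⟨𝔞, h𝔞⟩ := Ideal.dvd_span_singleton.2 hxJ
    have hx' : Ideal.span {x} ≠ 0 := by simpa using hx
    have h𝔞0 : 𝔞 ∈ (Ideal (𝓞 K))⁰ := mem_nonZeroDivisors_of_ne_zero (by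
      rintro rfl; exact hx' (by rw [h𝔞, mul_zero]))
    have hC : ClassGroup.mk0 ⟨𝔞, h𝔞0⟩ = C := by
      have h1 : ClassGroup.mk0 (⟨J, hJ⟩ * ⟨𝔞, h𝔞0⟩ : (Ideal (𝓞 K))⁰) = 1 := by
        have : (⟨J, hJ⟩ * ⟨𝔞, h𝔞0⟩ : (Ideal (𝓞 K))⁰) = ⟨J * 𝔞, mul_mem hJ h𝔞0⟩ := rfl
        rw [this, ClassGroup.mk0_eq_one_iff, ← h𝔞]
        exact ⟨x, rfl⟩
      rw [map_mul, hJC] at h1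
      exact (inv_mul_eq_one.1 h1).symm
    have hass : Associated (x0 ⟨⟨𝔞, h𝔞0⟩, hC⟩) x := by
      rw [← Ideal.span_singleton_eq_span_singleton, ← hx0J, h𝔞, mul_comm]
    obtain ⟨u, hu⟩ := hass
    obtain ⟨k, rfl | rfl⟩ := hunits u
    · exact ⟨⟨⟨⟨𝔞, h𝔞0⟩, hC⟩, k, true⟩, by simp [← hu, mul_comm]⟩
    · exact ⟨⟨⟨⟨𝔞, h𝔞0⟩, hC⟩, k, false⟩, by simp [← hu, mul_comm]⟩
  choose τ hτ using hex
  have hinj : Function.Injective τ := fun x y h => Subtype.ext (by rw [hτ x, hτ y, h])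
  have hshift : ∀ (k : ℤ) (s : Bool) (x : 𝓞 K) (t : ℝ),
      f t ((if s then 1 else -1) * ((η ^ k : (𝓞 K)ˣ) : 𝓞 K) * x) = f (t + k * R) x := by
    intro k s x t
    have hexp : ε ^ k = Real.exp (k * R) := by
      rw [hR, ← Real.rpow_intCast, Real.rpow_def_of_pos (by positivity), mul_comm]
    have hcoe : (((if s then 1 else -1) * ((η ^ k : (𝓞 K)ˣ) : 𝓞 K) * x : 𝓞 K) : K) =
        (if s then 1 else -1) * (((η ^ k : (𝓞 K)ˣ) : 𝓞 K) : K) * (x : K) := by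
      rcases s <;> simp
    have h1 : S.emb ((if s then 1 else -1) * ((η ^ k : (𝓞 K)ˣ) : 𝓞 K) * x : 𝓞 K) ^ 2 =
        Real.exp (2 * (k * R)) * S.emb x ^ 2 := by
      rw [hcoe, map_mul, map_mul, mul_pow, mul_pow, S.emb_zpow, hη, hexp]
      rcases s <;> simp [two_mul, Real.exp_add, sq]
    have h2 : w ((if s then 1 else -1) * ((η ^ k : (𝓞 K)ˣ) : 𝓞 K) * x : 𝓞 K) ^ 2 =
        Real.exp (-(k * R)) * w x ^ 2 := by
      rw [hcoe, map_mul, map_mul, mul_pow, mul_pow]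
      have h3 := hnorm (((η ^ k : (𝓞 K)ˣ) : 𝓞 K) : K)
      rw [S.emb_zpow, hη, hexp, abs_of_pos (Real.exp_pos _), NumberField.Units.norm] at h3
      rw [Real.exp_neg]
      have h4 : w (((η ^ k : (𝓞 K)ˣ) : 𝓞 K) : K) ^ 2 = (Real.exp (k * R))⁻¹ := by
        refine eq_inv_of_mul_eq_one_right ?_
        rw [h3]
        simp
      have h5 : w (if s then 1 else -1) ^ 2 = 1 := by
        rw [← map_pow]
        rcases s <;> simp
      rw [h4, h5, one_mul]
    simp only [hf]
    rw [h1, h2, mul_add, Real.exp_add, neg_add (t), Real.exp_add]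
    congr 3
    ring
  have hval : ∀ 𝔞, ∫⁻ t, f t (x0 𝔞) = heatKernel (b * Ideal.absNorm (𝔞 : Ideal (𝓞 K))) := by
    intro 𝔞
    have hx : S.emb (x0 𝔞 : K) ≠ 0 := by
      rw [map_ne_zero]
      exact_mod_cast hx0 𝔞
    have h1 := congrArg Ideal.absNorm (hx0J 𝔞)
    rw [map_mul, Ideal.absNorm_span_singleton] at h1
    have h2 : ((((Algebra.norm ℤ) (x0 𝔞)).natAbs : ℕ) : ℝ) = |S.emb (x0 𝔞)| * w (x0 𝔞) ^ 2 := by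
      rw [hnorm, ← Algebra.coe_norm_int, Nat.cast_natAbs]
      push_cast
      rfl
    rw [lintegral_eq_heatKernel hx, ← h2, ← h1]
    congr 1
    rw [hβ]
    push_cast
    field_simp
  refine hInt.trans ?_
  calc ∑' x : {x : 𝓞 K // x ∈ J ∧ x ≠ 0}, ∫⁻ t in Set.Ioc 0 R, f t x
      = ∑' x : {x : 𝓞 K // x ∈ J ∧ x ≠ 0}, ∫⁻ t in Set.Ioc 0 R,
          f (t + ((τ x).2.1 : ℤ) * R) (x0 (τ x).1) := by
        refine tsum_congr fun x => ?_
        conv_lhs => rw [hτ x]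
        simp_rw [hshift]
    _ ≤ ∑' y : {𝔞 : (Ideal (𝓞 K))⁰ // ClassGroup.mk0 𝔞 = C} × ℤ × Bool,
          ∫⁻ t in Set.Ioc 0 R, f (t + (y.2.1 : ℤ) * R) (x0 y.1) :=
        ENNReal.tsum_comp_le_tsum_of_injective hinj
          (fun y => ∫⁻ t in Set.Ioc 0 R, f (t + (y.2.1 : ℤ) * R) (x0 y.1))
    _ = 2 * ∑' 𝔞 : {𝔞 : (Ideal (𝓞 K))⁰ // ClassGroup.mk0 𝔞 = C},
        heatKernel (b * Ideal.absNorm (𝔞 : Ideal (𝓞 K))) := by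
        rw [← ENNReal.tsum_mul_left, ENNReal.tsum_prod']
        refine tsum_congr fun 𝔞 => ?_
        rw [ENNReal.tsum_prod', ← hval, ← tsum_setLIntegral_Ioc_add_zsmul hR0,
          ← ENNReal.tsum_mul_left]
        refine tsum_congr fun k => ?_
        simp [two_mul]

theorem classNumber_mul_le {ε : ℝ} (hε : IsFundamentalUnit P ε) {μ b : ℝ} (hμ : 1 ≤ μ)
    (hb : b * (μ * (√27 * P / 2)) = √Real.pi * Real.pi) :
    (classNumber K : ENNReal) * (ENNReal.ofReal (Real.log ε) * ENNReal.ofReal (μ - 1)) ≤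
      2 * ∑' 𝔞 : (Ideal (𝓞 K))⁰, heatKernel (b * Ideal.absNorm (𝔞 : Ideal (𝓞 K))) := by
  rw [← ENNReal.tsum_fiberwise _ (ClassGroup.mk0 (R := 𝓞 K)), tsum_fintype, Finset.mul_sum,
    classNumber, ← nsmul_eq_mul, ← Finset.card_univ, ← Finset.sum_const]
  exact Finset.sum_le_sum fun C _ => S.class_bound hε hμ hb C

end PureCubic

section

open MeasureTheory Real

theorem setLIntegral_ofReal_eq {s : Set ℝ} (hs : MeasurableSet s) {h : ℝ → ℝ} {c : ℝ}
    (hc : c ≠ 0) (hInt : ∫ x in s, h x = c) (hnn : ∀ x ∈ s, 0 ≤ h x) :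
    ∫⁻ x in s, ENNReal.ofReal (h x) = ENNReal.ofReal c := by
  rw [← hInt, ofReal_integral_eq_lintegral_ofReal]
  · by_contra h2
    exact hc (hInt ▸ integral_undef h2)
  · exact (ae_restrict_iff' hs).2 (ae_of_all _ hnn)

theorem setLIntegral_pow_mul_exp {v : ℝ} (hv : 0 < v) (n : ℕ) :
    ∫⁻ y in Set.Ioi (0 : ℝ), ENNReal.ofReal (y ^ n * exp (-(v * y))) =
      ENNReal.ofReal (n.factorial / v ^ (n + 1)) := by
  refine setLIntegral_ofReal_eq measurableSet_Ioi (by positivity) ?_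
    fun x hx => mul_nonneg (pow_nonneg (le_of_lt hx) _) (exp_pos _).le
  have h := integral_rpow_mul_exp_neg_mul_Ioi (a := n + 1) (by positivity) hv
  rw [Gamma_nat_eq_factorial] at h
  simp only [add_sub_cancel_right, rpow_natCast] at h
  rw [h, ← Nat.cast_add_one, rpow_natCast, one_div, inv_pow]
  field_simp

theorem ofReal_exp_eq_setLIntegral {v : ℝ} (hv : 0 < v) (n : ℝ) :
    ENNReal.ofReal (exp (-(v * n))) =
      ∫⁻ y in Set.Ioi n, ENNReal.ofReal (v * exp (-(v * y))) := by
  symm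
  refine setLIntegral_ofReal_eq measurableSet_Ioi (exp_pos _).ne' ?_
    fun x _ => mul_nonneg hv.le (exp_pos _).le
  have h := integral_exp_mul_Ioi (neg_lt_zero.2 hv) n
  simp only [neg_mul] at h
  rw [integral_const_mul, h]
  field_simp

/-- A counting bound `#{N ≤ X} ≤ a X + c X ^ 2` gives a bound for the sum of `exp (-v N)`. -/
theorem tsum_exp_neg_le {ι : Type*} {N : ι → ℕ} {a c : ℝ} (ha : 0 ≤ a) (hc : 0 ≤ c)
    (hfin : ∀ X : ℕ, {i | N i ≤ X}.Finite)
    (hcount : ∀ X : ℕ, ({i | N i ≤ X}.ncard : ℝ) ≤ a * X + c * X ^ 2) {v : ℝ} (hv : 0 < v) :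
    ∑' i, ENNReal.ofReal (exp (-(v * N i))) ≤ ENNReal.ofReal (a / v + 2 * c / v ^ 2) := by
  have hcard : ∀ y : ℝ, 0 < y → ∑' i, (Set.Ioi (N i : ℝ)).indicator (1 : ℝ → ENNReal) y ≤
      ENNReal.ofReal (a * y + c * y ^ 2) := by
    intro y hy
    have h1 : ∀ i, (Set.Ioi (N i : ℝ)).indicator (1 : ℝ → ENNReal) y ≤
        {i | N i ≤ ⌊y⌋₊}.indicator (1 : ι → ENNReal) i := by
      intro i
      by_cases h : (N i : ℝ) < y
      · have h' : N i ≤ ⌊y⌋₊ := Nat.le_floor h.le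
        simp [h, h']
      · simp [h]
    refine (ENNReal.tsum_le_tsum h1).trans ?_
    rw [← tsum_subtype]
    simp only [Pi.one_apply]
    rw [ENNReal.tsum_set_one, ← (hfin _).cast_ncard_eq]
    have h2 : ((({i | N i ≤ ⌊y⌋₊}.ncard : ℕ) : ENat) : ENNReal) =
        ENNReal.ofReal ({i | N i ≤ ⌊y⌋₊}.ncard : ℝ) := by
      simp
    rw [h2]
    refine ENNReal.ofReal_le_ofReal ((hcount _).trans ?_)
    have := Nat.floor_le hy.le
    gcongr
  have hcountable : Countable ι := by
    have h : (⋃ X : ℕ, {i | N i ≤ X}) = Set.univ := by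
      ext i
      simpa using ⟨N i, le_rfl⟩
    rw [← Set.countable_univ_iff, ← h]
    exact Set.countable_iUnion fun X => (hfin X).countable
  calc ∑' i, ENNReal.ofReal (exp (-(v * N i)))
      = ∑' i, ∫⁻ y in Set.Ioi (0 : ℝ), (Set.Ioi (N i : ℝ)).indicator (1 : ℝ → ENNReal) y *
          ENNReal.ofReal (v * exp (-(v * y))) := by
        refine tsum_congr fun i => ?_
        rw [ofReal_exp_eq_setLIntegral hv, ← lintegral_indicator measurableSet_Ioi,
          ← lintegral_indicator measurableSet_Ioi]
        refine lintegral_congr fun y => ?_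
        by_cases h : (N i : ℝ) < y
        · have h' : 0 < y := (Nat.cast_nonneg _).trans_lt h
          simp [h, h']
        · simp [Set.indicator, h]
    _ = ∫⁻ y in Set.Ioi (0 : ℝ), ∑' i, (Set.Ioi (N i : ℝ)).indicator (1 : ℝ → ENNReal) y *
          ENNReal.ofReal (v * exp (-(v * y))) := by
        rw [lintegral_tsum]
        intro i
        have : Measurable ((Set.Ioi (N i : ℝ)).indicator (1 : ℝ → ENNReal)) :=
          measurable_one.indicator measurableSet_Ioi
        fun_prop
    _ ≤ ∫⁻ y in Set.Ioi (0 : ℝ), (ENNReal.ofReal (a * v) * ENNReal.ofReal (y ^ 1 * exp (-(v * y))) +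
          ENNReal.ofReal (c * v) * ENNReal.ofReal (y ^ 2 * exp (-(v * y)))) := by
        refine setLIntegral_mono' measurableSet_Ioi fun y hy => ?_
        have hy0 : 0 < y := hy
        rw [ENNReal.tsum_mul_right]
        refine (mul_le_mul_left (hcard y hy) _).trans (le_of_eq ?_)
        rw [← ENNReal.ofReal_mul (by positivity), ← ENNReal.ofReal_mul (by positivity),
          ← ENNReal.ofReal_mul (by positivity), ← ENNReal.ofReal_add (by positivity)
          (by positivity)]
        ring_nf
    _ = ENNReal.ofReal (a / v + 2 * c / v ^ 2) := by
        rw [lintegral_add_left (by fun_prop), lintegral_const_mul _ (by fun_prop),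
          lintegral_const_mul _ (by fun_prop), setLIntegral_pow_mul_exp hv,
          setLIntegral_pow_mul_exp hv, ← ENNReal.ofReal_mul (by positivity),
          ← ENNReal.ofReal_mul (by positivity), ← ENNReal.ofReal_add (by positivity)
          (by positivity)]
        congr 1
        norm_num [Nat.factorial]
        field_simp

theorem lintegral_exp_comp (g : ℝ → ENNReal) :
    ∫⁻ t, ENNReal.ofReal (exp t) * g (exp t) = ∫⁻ u in Set.Ioi (0 : ℝ), g u := by
  have h := lintegral_image_eq_lintegral_abs_deriv_mul MeasurableSet.univ
    (fun x _ => (hasDerivAt_exp x).hasDerivWithinAt) exp_injective.injOn g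
  rw [Set.image_univ, range_exp] at h
  rw [h, setLIntegral_univ]
  simp

theorem tsum_heatKernel_le {ι : Type*} {N : ι → ℕ} {a c : ℝ} (ha : 0 ≤ a) (hc : 0 ≤ c)
    (hfin : ∀ X : ℕ, {i | N i ≤ X}.Finite)
    (hcount : ∀ X : ℕ, ({i | N i ≤ X}.ncard : ℝ) ≤ a * X + c * X ^ 2) {b : ℝ} (hb : 0 < b) :
    ∑' i, heatKernel (b * N i) ≤ ENNReal.ofReal (a * √π / (2 * b) + c / b ^ 2) := by
  have hcountable : Countable ι := by
    have h : (⋃ X : ℕ, {i | N i ≤ X}) = Set.univ := by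
      ext i
      simpa using ⟨N i, le_rfl⟩
    rw [← Set.countable_univ_iff, ← h]
    exact Set.countable_iUnion fun X => (hfin X).countable
  have hpt : ∀ t : ℝ, ∑' i, ENNReal.ofReal (exp (-(exp (2 * t) + b * N i * exp (-t)))) ≤
      ENNReal.ofReal (a / b) * (ENNReal.ofReal (exp t) * ENNReal.ofReal (exp (-(1 * exp t ^ 2)))) +
      ENNReal.ofReal (2 * c / b ^ 2) * (ENNReal.ofReal (exp t) *
        ENNReal.ofReal (exp t * exp (-exp t ^ 2))) := by
    intro t
    have h := tsum_exp_neg_le ha hc hfin hcount (mul_pos hb (exp_pos (-t)))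
    have h2 := mul_le_mul_right h (ENNReal.ofReal (exp (-exp (2 * t))))
    rw [← ENNReal.tsum_mul_left] at h2
    refine le_trans (le_of_eq (tsum_congr fun i => ?_)) (h2.trans (le_of_eq ?_))
    · rw [← ENNReal.ofReal_mul (exp_pos _).le, ← exp_add]
      ring_nf
    · have := exp_pos t
      simp only [← ENNReal.ofReal_mul (exp_pos _).le]
      rw [← ENNReal.ofReal_mul (by positivity),
        ← ENNReal.ofReal_mul (by positivity), ← ENNReal.ofReal_add (by positivity)
        (by positivity), exp_neg t, two_mul, exp_add]
      congr 1
      rw [one_mul, sq (exp t)]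
      field_simp
  have h1 : ∫⁻ t, ENNReal.ofReal (exp t) * ENNReal.ofReal (exp (-(1 * exp t ^ 2))) =
      ENNReal.ofReal (√π / 2) := by
    rw [lintegral_exp_comp fun u => ENNReal.ofReal (exp (-(1 * u ^ 2)))]
    refine setLIntegral_ofReal_eq measurableSet_Ioi (by positivity) ?_ fun x _ => (exp_pos _).le
    simpa using integral_gaussian_Ioi 1
  have h2 : ∫⁻ t, ENNReal.ofReal (exp t) * ENNReal.ofReal (exp t * exp (-exp t ^ 2)) =
      ENNReal.ofReal (1 / 2) := by
    rw [lintegral_exp_comp fun u => ENNReal.ofReal (u * exp (-u ^ 2))]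
    refine setLIntegral_ofReal_eq measurableSet_Ioi (by positivity) ?_
      fun x hx => mul_nonneg (le_of_lt hx) (exp_pos _).le
    have := integral_rpow_mul_exp_neg_rpow (p := 2) (q := 1) two_pos (by norm_num)
    norm_num at this
    rw [this]
  simp only [heatKernel]
  rw [← lintegral_tsum fun i => by fun_prop]
  refine (lintegral_mono hpt).trans (le_of_eq ?_)
  rw [lintegral_add_left (by fun_prop), lintegral_const_mul _ (by fun_prop),
    lintegral_const_mul _ (by fun_prop), h1, h2, ← ENNReal.ofReal_mul (by positivity),
    ← ENNReal.ofReal_mul (by positivity), ← ENNReal.ofReal_add (by positivity) (by positivity)]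
  congr 1
  field_simp

end

section IdealCounting

open UniqueFactorizationMonoid

variable {R : Type*} [CommRing R] [IsDedekindDomain R] [Module.Free ℤ R] [Module.Finite ℤ R]
  [CharZero R]

theorem Ideal.ncard_absNorm_mul_le {m n : ℕ} (h : m.Coprime n) :
    {I : Ideal R | Ideal.absNorm I = m * n}.ncard ≤
      {I : Ideal R | Ideal.absNorm I = m}.ncard * {I : Ideal R | Ideal.absNorm I = n}.ncard := by
  rw [← Set.ncard_prod]
  have hsub : {I : Ideal R | Ideal.absNorm I = m * n} ⊆ (fun x : Ideal R × Ideal R => x.1 * x.2) ''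
      ({I : Ideal R | Ideal.absNorm I = m} ×ˢ {I : Ideal R | Ideal.absNorm I = n}) := by
    intro I (hI : _ = _)
    have hdvd : I ∣ Ideal.span {(m : R)} * Ideal.span {(n : R)} := by
      rw [Ideal.span_singleton_mul_span_singleton, Ideal.dvd_span_singleton, ← Nat.cast_mul, ← hI]
      exact Ideal.absNorm_mem I
    obtain ⟨D, E, hD, hE, rfl⟩ := exists_dvd_and_dvd_of_dvd_mul hdvd
    have hD' := Ideal.absNorm_dvd_absNorm_of_le (Ideal.le_of_dvd hD)
    have hE' := Ideal.absNorm_dvd_absNorm_of_le (Ideal.le_of_dvd hE)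
    rw [Ideal.absNorm_span_natCast] at hD' hE'
    rw [map_mul] at hI
    have hDn : (Ideal.absNorm D).Coprime n := (h.pow_left _).coprime_dvd_left hD'
    have hEm : (Ideal.absNorm E).Coprime m := (h.symm.pow_left _).coprime_dvd_left hE'
    refine ⟨(D, E), ⟨Nat.dvd_antisymm (hDn.dvd_of_dvd_mul_right (Dvd.intro _ hI))
      (hEm.symm.dvd_of_dvd_mul_right (Dvd.intro _ hI.symm)),
      Nat.dvd_antisymm (hEm.dvd_of_dvd_mul_left (Dvd.intro_left _ hI))
      (hDn.symm.dvd_of_dvd_mul_left (Dvd.intro_left _ hI.symm))⟩, rfl⟩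
  have hfin := (Ideal.finite_setOfPred_absNorm_eq (S := R) m).prod
    (Ideal.finite_setOfPred_absNorm_eq (S := R) n)
  exact (Set.ncard_le_ncard hsub (hfin.image _)).trans (Set.ncard_image_le hfin)

/-- The primes above `q`, their degrees, and the fact that an ideal of `q`-power norm is determined
by its valuations at these primes. -/
theorem Ideal.exists_primes_above {q : ℕ} (hq : q.Prime) :
    ∃ (T : Finset (Ideal R)) (f : Ideal R → ℕ) (v : Ideal R → Ideal R → ℕ),
      (∀ 𝔭 ∈ T, 𝔭.IsPrime ∧ (q : R) ∈ 𝔭 ∧ Ideal.absNorm 𝔭 = q ^ f 𝔭 ∧ 1 ≤ f 𝔭) ∧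
      ∑ 𝔭 ∈ T, f 𝔭 ≤ Module.finrank ℤ R ∧
      (∀ k I, Ideal.absNorm I = q ^ k → ∑ 𝔭 ∈ T, f 𝔭 * v I 𝔭 = k) ∧
      ∀ k I J, Ideal.absNorm I = q ^ k → Ideal.absNorm J = q ^ k →
        (∀ 𝔭 ∈ T, v I 𝔭 = v J 𝔭) → I = J := by
  classical
  have hq0 : Ideal.span {(q : R)} ≠ ⊥ := by simpa using hq.ne_zero
  set T := (normalizedFactors (Ideal.span {(q : R)})).toFinset with hT
  have hTmem (𝔭 : Ideal R) : 𝔭 ∈ T ↔ Prime 𝔭 ∧ (q : R) ∈ 𝔭 := by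
    rw [hT, Multiset.mem_toFinset, UniqueFactorizationMonoid.mem_normalizedFactors_iff hq0,
      Ideal.dvd_span_singleton]
  have hnorm (𝔭 : Ideal R) (h : 𝔭 ∈ T) : ∃ f, Ideal.absNorm 𝔭 = q ^ f := by
    have := Ideal.absNorm_dvd_absNorm_of_le
      ((Ideal.span_singleton_le_iff_mem (I := 𝔭)).2 ((hTmem 𝔭).1 h).2)
    rw [Ideal.absNorm_span_natCast] at this
    obtain ⟨f, -, hf⟩ := (Nat.dvd_prime_pow hq).1 this
    exact ⟨f, hf⟩
  choose! f hf using hnorm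
  have hsub (k : ℕ) (I : Ideal R) (hI : Ideal.absNorm I = q ^ k) :
      I = ∏ 𝔭 ∈ T, 𝔭 ^ (normalizedFactors I).count 𝔭 := by
    have hI0 : I ≠ ⊥ := by
      rintro rfl
      simp only [Ideal.absNorm_bot] at hI
      exact (pow_pos hq.pos k).ne hI
    rw [← Finset.prod_multiset_count_of_subset, Ideal.prod_normalizedFactors_eq_self hI0]
    intro 𝔭 h𝔭
    rw [Multiset.mem_toFinset, UniqueFactorizationMonoid.mem_normalizedFactors_iff hI0] at h𝔭
    refine (hTmem 𝔭).2 ⟨h𝔭.1, ?_⟩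
    have := (Ideal.isPrime_of_prime h𝔭.1)
    refine this.mem_of_pow_mem k ?_
    rw [← Nat.cast_pow, ← hI]
    exact Ideal.le_of_dvd h𝔭.2 (Ideal.absNorm_mem I)
  refine ⟨T, f, fun I 𝔭 => (normalizedFactors I).count 𝔭, fun 𝔭 h => ?_, ?_, fun k I hI => ?_,
    fun k I J hI hJ h => ?_⟩
  · obtain ⟨h1, h2⟩ := (hTmem 𝔭).1 h
    refine ⟨Ideal.isPrime_of_prime h1, h2, hf 𝔭 h, Nat.one_le_iff_ne_zero.2 fun h0 => ?_⟩
    have := hf 𝔭 h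
    rw [h0, pow_zero, Ideal.absNorm_eq_one_iff] at this
    exact (Ideal.isPrime_of_prime h1).ne_top this
  · have hdvd : ∏ 𝔭 ∈ T, 𝔭 ∣ Ideal.span {(q : R)} :=
      Finset.prod_primes_dvd _ (fun 𝔭 h => ((hTmem 𝔭).1 h).1)
        fun 𝔭 h => Ideal.dvd_span_singleton.2 ((hTmem 𝔭).1 h).2
    have := Ideal.absNorm_dvd_absNorm_of_le (Ideal.le_of_dvd hdvd)
    rwa [Ideal.absNorm_span_natCast, map_prod, Finset.prod_congr rfl hf, Finset.prod_pow_eq_pow_sum,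
      Nat.pow_dvd_pow_iff_le_right hq.one_lt] at this
  · have h := congrArg Ideal.absNorm (hsub k I hI)
    rw [hI, map_prod, Finset.prod_congr rfl fun 𝔭 h => by rw [map_pow, hf 𝔭 h, ← pow_mul],
      Finset.prod_pow_eq_pow_sum] at h
    exact (Nat.pow_right_injective hq.two_le h).symm
  · rw [hsub k I hI, hsub k J hJ]
    exact Finset.prod_congr rfl fun 𝔭 h𝔭 => congrArg (𝔭 ^ ·) (h 𝔭 h𝔭)

theorem Ideal.ncard_absNorm_prime_pow_le {q : ℕ} (hq : q.Prime) (hR : Module.finrank ℤ R = 3)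
    (k : ℕ) : {I : Ideal R | Ideal.absNorm I = q ^ k}.ncard ≤ (k + 2).choose 2 := by
  classical
  obtain ⟨T, f, v, hT, hf, hsum, hinj⟩ := Ideal.exists_primes_above (R := R) hq
  have hcard : T.card ≤ 3 := by
    rw [← hR]
    refine le_trans ?_ hf
    rw [Finset.card_eq_sum_ones]
    exact Finset.sum_le_sum fun 𝔭 h => (hT 𝔭 h).2.2.2
  have h1 : {I : Ideal R | Ideal.absNorm I = q ^ k}.ncard ≤
      (T.finsuppAntidiag k : Set (Ideal R →₀ ℕ)).ncard := by
    refine Set.ncard_le_ncard_of_injOn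
      (fun I => Finsupp.onFinset T (fun 𝔭 => if 𝔭 ∈ T then f 𝔭 * v I 𝔭 else 0) ?_) ?_ ?_
      (Finset.finite_toSet _)
    · intro 𝔭 h
      by_contra h2
      exact h (if_neg h2)
    · intro I hI
      simp only [Finset.mem_coe, Finset.mem_finsuppAntidiag]
      refine ⟨?_, Finsupp.support_onFinset_subset⟩
      refine Eq.trans ?_ (hsum k I hI)
      exact Finset.sum_congr rfl fun 𝔭 h => if_pos h
    · intro I hI J hJ h
      refine hinj k I J hI hJ fun 𝔭 h𝔭 => ?_
      have := DFunLike.congr_fun h 𝔭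
      simp only [Finsupp.onFinset_apply, if_pos h𝔭] at this
      exact Nat.eq_of_mul_eq_mul_left (hT 𝔭 h𝔭).2.2.2 this
  rw [Set.ncard_coe_finset, Finset.card_finsuppAntidiag_nat_eq_choose] at h1
  refine h1.trans ?_
  calc (T.card + k - 1).choose k ≤ (k + 2).choose k := Nat.choose_le_choose k (by omega)
    _ = (k + 2).choose 2 := by rw [Nat.choose_symm_add]

theorem Ideal.ncard_absNorm_prime_pow_le_one {q : ℕ} (hq : q.Prime)
    (h : ∀ 𝔭 𝔮 : Ideal R, 𝔭.IsPrime → 𝔮.IsPrime → (q : R) ∈ 𝔭 → (q : R) ∈ 𝔮 → 𝔭 = 𝔮)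
    (k : ℕ) : {I : Ideal R | Ideal.absNorm I = q ^ k}.ncard ≤ 1 := by
  obtain ⟨T, f, v, hT, hf, hsum, hinj⟩ := Ideal.exists_primes_above (R := R) hq
  rw [Set.ncard_le_one (Ideal.finite_setOfPred_absNorm_eq _)]
  intro I hI J hJ
  refine hinj k I J hI hJ fun 𝔭 h𝔭 => ?_
  have hT' : T = {𝔭} := Finset.eq_singleton_iff_unique_mem.2 ⟨h𝔭, fun 𝔮 h𝔮 =>
    h 𝔮 𝔭 (hT 𝔮 h𝔮).1 (hT 𝔭 h𝔭).1 (hT 𝔮 h𝔮).2.1 (hT 𝔭 h𝔭).2.1⟩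
  have h1 := hsum k I hI
  have h2 := hsum k J hJ
  rw [hT', Finset.sum_singleton] at h1 h2
  exact Nat.eq_of_mul_eq_mul_left (hT 𝔭 h𝔭).2.2.2 (h1.trans h2.symm)

theorem Ideal.ncard_absNorm_prime_pow_le_half {q : ℕ} (hq : q.Prime) (hR : Module.finrank ℤ R = 3)
    (h : ∀ 𝔭 𝔮 : Ideal R, 𝔭.IsPrime → 𝔮.IsPrime → Ideal.absNorm 𝔭 = q → Ideal.absNorm 𝔮 = q →
      𝔭 = 𝔮)
    (k : ℕ) : {I : Ideal R | Ideal.absNorm I = q ^ k}.ncard ≤ k / 2 + 1 := by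
  classical
  obtain ⟨T, f, v, hT, hf, hsum, hinj⟩ := Ideal.exists_primes_above (R := R) hq
  rw [hR] at hf
  have huniq : ∀ 𝔭 ∈ T, ∀ 𝔮 ∈ T, f 𝔭 < 2 → f 𝔮 < 2 → 𝔭 = 𝔮 := fun 𝔭 h𝔭 𝔮 h𝔮 h1 h2 => by
    obtain ⟨hp1, -, hp2, hp3⟩ := hT 𝔭 h𝔭
    obtain ⟨hq1, -, hq2, hq3⟩ := hT 𝔮 h𝔮
    refine h 𝔭 𝔮 hp1 hq1 ?_ ?_
    · rw [hp2, show f 𝔭 = 1 by omega, pow_one]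
    · rw [hq2, show f 𝔮 = 1 by omega, pow_one]
  obtain ⟨𝔮, h𝔮, hT'⟩ : ∃ 𝔮, (𝔮 ∈ T → 2 ≤ f 𝔮) ∧
      ∀ 𝔭 ∈ T, 𝔭 ≠ 𝔮 → ∀ 𝔭' ∈ T, 𝔭' ≠ 𝔮 → 𝔭 = 𝔭' := by
    by_cases hex : ∃ 𝔮 ∈ T, 2 ≤ f 𝔮
    · obtain ⟨𝔮, h𝔮, h2⟩ := hex
      refine ⟨𝔮, fun _ => h2, fun 𝔭 h𝔭 hne 𝔭' h𝔭' hne' => ?_⟩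
      refine huniq 𝔭 h𝔭 𝔭' h𝔭' ?_ ?_
      · have := Finset.add_sum_erase T f h𝔮
        have h3 := Finset.single_le_sum (f := f) (fun i _ => Nat.zero_le _)
          (Finset.mem_erase.2 ⟨hne, h𝔭⟩)
        omega
      · have := Finset.add_sum_erase T f h𝔮
        have h3 := Finset.single_le_sum (f := f) (fun i _ => Nat.zero_le _)
          (Finset.mem_erase.2 ⟨hne', h𝔭'⟩)
        omega
    · push Not at hex
      refine ⟨⊥, fun h => ?_, fun 𝔭 h𝔭 _ 𝔭' h𝔭' _ => huniq _ h𝔭 _ h𝔭' (hex _ h𝔭) (hex _ h𝔭')⟩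
      have := (hT ⊥ h).2.1
      simp [hq.ne_zero] at this
  have hle : {I : Ideal R | Ideal.absNorm I = q ^ k}.ncard ≤
      (Finset.range (k / 2 + 1) : Set ℕ).ncard := by
    refine Set.ncard_le_ncard_of_injOn (fun I => if 𝔮 ∈ T then v I 𝔮 else 0) ?_ ?_
      (Finset.finite_toSet _)
    · intro I hI
      simp only [Finset.mem_coe, Finset.mem_range]
      split_ifs with hm
      · have h1 := Finset.single_le_sum (f := fun 𝔭 => f 𝔭 * v I 𝔭) (fun i _ => Nat.zero_le _) hm
        have h2 := hsum k I hI
        have h3 := Nat.mul_le_mul_right (v I 𝔮) (h𝔮 hm)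
        omega
      · omega
    · intro I hI J hJ hIJ
      simp only at hIJ
      refine hinj k I J hI hJ fun 𝔭 h𝔭 => ?_
      by_cases hpq : 𝔭 = 𝔮
      · subst hpq
        simpa [h𝔭] using hIJ
      · have herase : T.erase 𝔮 = {𝔭} := by
          refine Finset.eq_singleton_iff_unique_mem.2
            ⟨Finset.mem_erase.2 ⟨hpq, h𝔭⟩, fun 𝔭' h' => ?_⟩
          rw [Finset.mem_erase] at h'
          exact hT' 𝔭' h'.2 h'.1 𝔭 h𝔭 hpq
        have h1 := hsum k I hI
        have h2 := hsum k J hJ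
        by_cases hm : 𝔮 ∈ T
        · rw [← Finset.add_sum_erase T _ hm, herase, Finset.sum_singleton] at h1 h2
          simp only [hm, if_true] at hIJ
          rw [hIJ] at h1
          exact Nat.eq_of_mul_eq_mul_left (hT 𝔭 h𝔭).2.2.2 (by omega)
        · rw [← Finset.erase_eq_of_notMem hm, herase, Finset.sum_singleton] at h1 h2
          exact Nat.eq_of_mul_eq_mul_left (hT 𝔭 h𝔭).2.2.2 (by omega)
  rwa [Set.ncard_coe_finset, Finset.card_range] at hle

end IdealCounting

section

open NumberField

theorem ZMod.eq_of_pow_three_eq {q : ℕ} [Fact q.Prime] (hq : q % 3 = 2) {x y : ZMod q}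
    (h : x ^ 3 = y ^ 3) : x = y := by
  have key (x : ZMod q) : (x ^ 3) ^ (2 * (q / 3) + 1) = x := by
    have h1 : 3 * (2 * (q / 3) + 1) = q + (q - 1) := by omega
    have h2 : q = q - 1 + 1 := by omega
    rw [← pow_mul, h1, pow_add, ZMod.pow_card, ← pow_succ', ← h2, ZMod.pow_card]
  rw [← key x, h, key]

namespace PureCubic

variable {P : ℕ} {K : Type*} [Field K] [NumberField K] (S : PureCubic P K)

include S

theorem finrank_int : Module.finrank ℤ (𝓞 K) = 3 := by
  rw [RingOfIntegers.rank, S.finrank]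

omit S in
theorem intCast_mem_iff {q : ℕ} (hq : q.Prime) {𝔭 : Ideal (𝓞 K)} (h𝔭 : 𝔭.IsPrime)
    (hq𝔭 : (q : 𝓞 K) ∈ 𝔭) (n : ℤ) : (n : 𝓞 K) ∈ 𝔭 ↔ (q : ℤ) ∣ n := by
  constructor
  · intro h
    by_contra hn
    obtain ⟨u, v, huv⟩ := ((Nat.prime_iff_prime_int.1 hq).coprime_iff_not_dvd).2 hn
    refine h𝔭.ne_top ((Ideal.eq_top_iff_one _).2 ?_)
    have := 𝔭.add_mem (𝔭.mul_mem_left (u : 𝓞 K) hq𝔭) (𝔭.mul_mem_left (v : 𝓞 K) h)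
    convert this
    exact_mod_cast huv.symm
  · rintro ⟨m, rfl⟩
    push_cast
    exact 𝔭.mul_mem_right _ hq𝔭

theorem mem_iff_of_sub_mem {q : ℕ} (hq : q.Prime) {𝔭 : Ideal (𝓞 K)} (h𝔭 : 𝔭.IsPrime)
    (hq𝔭 : (q : 𝓞 K) ∈ 𝔭) {r : ℤ} (hr : S.rootInt - r ∈ 𝔭) (a b c : ℤ) :
    (a : 𝓞 K) + b * S.rootInt + c * S.rootInt ^ 2 ∈ 𝔭 ↔ (q : ℤ) ∣ a + b * r + c * r ^ 2 := by
  rw [← intCast_mem_iff hq h𝔭 hq𝔭]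
  have : (a : 𝓞 K) + b * S.rootInt + c * S.rootInt ^ 2 =
      (S.rootInt - r) * (b + c * (S.rootInt + r)) + ((a + b * r + c * r ^ 2 : ℤ) : 𝓞 K) := by
    push_cast
    ring
  rw [this]
  exact 𝔭.add_mem_iff_right (𝔭.mul_mem_right _ hr)

theorem prime_ext {q : ℕ} (hq : q.Prime) {𝔭 𝔮 : Ideal (𝓞 K)} (h𝔭 : 𝔭.IsPrime) (h𝔮 : 𝔮.IsPrime)
    (hq𝔭 : (q : 𝓞 K) ∈ 𝔭) (hq𝔮 : (q : 𝓞 K) ∈ 𝔮) {r s : ℤ} (hr : S.rootInt - r ∈ 𝔭)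
    (hs : S.rootInt - s ∈ 𝔮) (hrs : (q : ℤ) ∣ r - s) : 𝔭 = 𝔮 := by
  have hs' : S.rootInt - r ∈ 𝔮 := by
    have := 𝔮.sub_mem hs ((intCast_mem_iff hq h𝔮 hq𝔮 _).2 hrs)
    convert this using 1
    push_cast
    ring
  ext x
  obtain ⟨a, b, c, rfl⟩ := S.exists_coords_int x
  rw [S.mem_iff_of_sub_mem hq h𝔭 hq𝔭 hr, S.mem_iff_of_sub_mem hq h𝔮 hq𝔮 hs']

theorem prime_above_three_unique {𝔭 𝔮 : Ideal (𝓞 K)} (h𝔭 : 𝔭.IsPrime) (h𝔮 : 𝔮.IsPrime)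
    (h3𝔭 : ((3 : ℕ) : 𝓞 K) ∈ 𝔭) (h3𝔮 : ((3 : ℕ) : 𝓞 K) ∈ 𝔮) : 𝔭 = 𝔮 := by
  have key (𝔭 : Ideal (𝓞 K)) (h𝔭 : 𝔭.IsPrime) (h3𝔭 : ((3 : ℕ) : 𝓞 K) ∈ 𝔭) :
      S.rootInt - ((P : ℤ) : 𝓞 K) ∈ 𝔭 := by
    refine h𝔭.mem_of_pow_mem 3 ?_
    obtain ⟨t, ht⟩ : (3 : ℤ) ∣ P - P ^ 3 := by
      have : (P : ℤ) % 3 = 0 ∨ (P : ℤ) % 3 = 1 ∨ (P : ℤ) % 3 = 2 := by omega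
      rcases this with h | h | h <;>
      · refine Int.dvd_of_emod_eq_zero ?_
        simp [Int.sub_emod, pow_succ, Int.mul_emod, h]
    have : (S.rootInt - ((P : ℤ) : 𝓞 K)) ^ 3 =
        ((3 : ℕ) : 𝓞 K) * (t - P * S.rootInt ^ 2 + P ^ 2 * S.rootInt) := by
      have ht' : ((P : 𝓞 K) - P ^ 3) = 3 * t := by exact_mod_cast congrArg (Int.cast (R := 𝓞 K)) ht
      push_cast
      linear_combination S.rootInt_cube + ht'
    rw [this]
    exact 𝔭.mul_mem_right _ h3𝔭
  exact S.prime_ext Nat.prime_three h𝔭 h𝔮 h3𝔭 h3𝔮 (key _ h𝔭 h3𝔭) (key _ h𝔮 h3𝔮) (by simp)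

theorem exists_sub_mem_of_absNorm_prime {q : ℕ} (hq : q.Prime) {𝔭 : Ideal (𝓞 K)}
    (h𝔭 : Ideal.absNorm 𝔭 = q) : ∃ r : ℤ, S.rootInt - r ∈ 𝔭 := by
  have : Fact q.Prime := ⟨hq⟩
  have hcard : Nat.card (𝓞 K ⧸ 𝔭) = q := h𝔭
  have hne : (Ideal.Quotient.mk 𝔭 1) ≠ 0 := by
    rw [Ne, Ideal.Quotient.eq_zero_iff_mem, ← Ideal.eq_top_iff_one, ← Ideal.absNorm_eq_one_iff, h𝔭]
    exact hq.one_lt.ne'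
  obtain ⟨r, hr⟩ := AddSubgroup.mem_zmultiples_iff.1
    (mem_zmultiples_of_prime_card hcard hne (g' := Ideal.Quotient.mk 𝔭 S.rootInt))
  refine ⟨r, ?_⟩
  rw [← Ideal.Quotient.eq_zero_iff_mem, map_sub, ← hr]
  simp

theorem dvd_pow_three_sub {q : ℕ} (hq : q.Prime) {𝔭 : Ideal (𝓞 K)} (h𝔭 : 𝔭.IsPrime)
    (hq𝔭 : (q : 𝓞 K) ∈ 𝔭) {r : ℤ} (hr : S.rootInt - r ∈ 𝔭) : (q : ℤ) ∣ r ^ 3 - P := by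
  rw [← intCast_mem_iff hq h𝔭 hq𝔭]
  have : ((r ^ 3 - P : ℤ) : 𝓞 K) =
      (S.rootInt - r) * (-(S.rootInt ^ 2 + S.rootInt * r + r ^ 2)) := by
    push_cast
    linear_combination S.rootInt_cube
  rw [this]
  exact 𝔭.mul_mem_right _ hr

theorem degree_one_prime_unique {q : ℕ} (hq : q.Prime) (hq3 : q % 3 = 2) {𝔭 𝔮 : Ideal (𝓞 K)}
    (h𝔭 : 𝔭.IsPrime) (h𝔮 : 𝔮.IsPrime) (hN𝔭 : Ideal.absNorm 𝔭 = q) (hN𝔮 : Ideal.absNorm 𝔮 = q) :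
    𝔭 = 𝔮 := by
  have : Fact q.Prime := ⟨hq⟩
  obtain ⟨r, hr⟩ := S.exists_sub_mem_of_absNorm_prime hq hN𝔭
  obtain ⟨s, hs⟩ := S.exists_sub_mem_of_absNorm_prime hq hN𝔮
  have hq𝔭 : (q : 𝓞 K) ∈ 𝔭 := hN𝔭 ▸ Ideal.absNorm_mem 𝔭
  have hq𝔮 : (q : 𝓞 K) ∈ 𝔮 := hN𝔮 ▸ Ideal.absNorm_mem 𝔮
  refine S.prime_ext hq h𝔭 h𝔮 hq𝔭 hq𝔮 hr hs ?_
  have h := dvd_sub (S.dvd_pow_three_sub hq h𝔭 hq𝔭 hr) (S.dvd_pow_three_sub hq h𝔮 hq𝔮 hs)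
  rw [sub_sub_sub_cancel_right, ← ZMod.intCast_zmod_eq_zero_iff_dvd] at h
  rw [← ZMod.intCast_zmod_eq_zero_iff_dvd]
  push_cast at h ⊢
  exact sub_eq_zero.2 (ZMod.eq_of_pow_three_eq hq3 (sub_eq_zero.1 h))

end PureCubic

end

section

open NumberField
open scoped ArithmeticFunction.zeta

/-- The nontrivial Dirichlet character modulo `3`. -/
def chiThree : ArithmeticFunction ℤ :=
  ⟨fun n => if n % 3 = 1 then 1 else if n % 3 = 2 then -1 else 0, rfl⟩

/-- The principal Dirichlet character modulo `3`. -/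
def coprimeThree : ArithmeticFunction ℤ := ⟨fun n => if n % 3 = 0 then 0 else 1, rfl⟩

theorem chiThree_apply (n : ℕ) :
    chiThree n = if n % 3 = 1 then 1 else if n % 3 = 2 then -1 else 0 := rfl

theorem coprimeThree_apply (n : ℕ) : coprimeThree n = if n % 3 = 0 then 0 else 1 := rfl

theorem chiThree_mul (m n : ℕ) : chiThree (m * n) = chiThree m * chiThree n := by
  have hm := Nat.mod_lt m three_pos
  have hn := Nat.mod_lt n three_pos
  simp only [chiThree_apply, Nat.mul_mod m n]
  interval_cases m % 3 <;> interval_cases n % 3 <;> rfl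

theorem coprimeThree_mul (m n : ℕ) : coprimeThree (m * n) = coprimeThree m * coprimeThree n := by
  have hm := Nat.mod_lt m three_pos
  have hn := Nat.mod_lt n three_pos
  simp only [coprimeThree_apply, Nat.mul_mod m n]
  interval_cases m % 3 <;> interval_cases n % 3 <;> rfl

theorem chiThree_pow (n k : ℕ) : chiThree (n ^ k) = chiThree n ^ k := by
  induction k with
  | zero => simp [chiThree_apply]
  | succ k ih => rw [pow_succ, chiThree_mul, ih, pow_succ]

theorem coprimeThree_pow (n k : ℕ) : coprimeThree (n ^ k) = coprimeThree n ^ k := by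
  induction k with
  | zero => simp [coprimeThree_apply]
  | succ k ih => rw [pow_succ, coprimeThree_mul, ih, pow_succ]

/-- The number of divisors prime to `3`. -/
def divisorsCoprimeThree : ArithmeticFunction ℤ :=
  coprimeThree * ((ζ : ArithmeticFunction ℕ) : ArithmeticFunction ℤ)

/-- A multiplicative majorant for the number of ideals of a given norm in a pure cubic field. -/
def idealMajorant : ArithmeticFunction ℤ := chiThree * divisorsCoprimeThree

theorem isMultiplicative_divisorsCoprimeThree : divisorsCoprimeThree.IsMultiplicative :=
  ArithmeticFunction.IsMultiplicative.mul ⟨rfl, fun _ => coprimeThree_mul _ _⟩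
    ArithmeticFunction.isMultiplicative_zeta.natCast

theorem isMultiplicative_idealMajorant : idealMajorant.IsMultiplicative :=
  ArithmeticFunction.IsMultiplicative.mul ⟨rfl, fun _ => chiThree_mul _ _⟩
    isMultiplicative_divisorsCoprimeThree

theorem ArithmeticFunction.mul_apply_prime_pow {R : Type*} [Semiring R]
    (f g : ArithmeticFunction R) {q : ℕ} (hq : q.Prime) (k : ℕ) :
    (f * g) (q ^ k) = ∑ i ∈ Finset.range (k + 1), f (q ^ i) * g (q ^ (k - i)) := by
  rw [ArithmeticFunction.mul_apply, Nat.sum_divisorsAntidiagonal fun i j => f i * g j,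
    Nat.sum_divisors_prime_pow hq]
  refine Finset.sum_congr rfl fun i hi => ?_
  rw [Nat.pow_div (Finset.mem_range_succ_iff.1 hi) hq.pos]

theorem divisorsCoprimeThree_prime_pow {q : ℕ} (hq : q.Prime) (k : ℕ) :
    divisorsCoprimeThree (q ^ k) = ∑ i ∈ Finset.range (k + 1), coprimeThree q ^ i := by
  rw [divisorsCoprimeThree, ArithmeticFunction.mul_apply_prime_pow _ _ hq]
  refine Finset.sum_congr rfl fun i hi => ?_
  rw [coprimeThree_pow, ArithmeticFunction.natCoe_apply, ArithmeticFunction.zeta_apply_ne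
    (pow_ne_zero _ hq.ne_zero), Nat.cast_one, mul_one]

theorem divisorsCoprimeThree_three_pow (k : ℕ) : divisorsCoprimeThree (3 ^ k) = 1 := by
  rw [divisorsCoprimeThree_prime_pow Nat.prime_three, Finset.sum_range_succ']
  simp [coprimeThree_apply]

theorem divisorsCoprimeThree_prime_pow_of_ne {q : ℕ} (hq : q.Prime) (h3 : q % 3 ≠ 0) (k : ℕ) :
    divisorsCoprimeThree (q ^ k) = k + 1 := by
  rw [divisorsCoprimeThree_prime_pow hq]
  simp [coprimeThree_apply, h3]

theorem idealMajorant_prime_pow {q : ℕ} (hq : q.Prime) (k : ℕ) :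
    idealMajorant (q ^ k) =
      ∑ i ∈ Finset.range (k + 1), chiThree q ^ (k - i) * divisorsCoprimeThree (q ^ i) := by
  rw [idealMajorant, ArithmeticFunction.mul_apply_prime_pow _ _ hq, ← Finset.sum_range_reflect]
  refine Finset.sum_congr rfl fun i hi => ?_
  rw [Finset.mem_range_succ_iff] at hi
  rw [chiThree_pow]
  congr 3; omega

theorem idealMajorant_three_pow (k : ℕ) : idealMajorant (3 ^ k) = 1 := by
  rw [idealMajorant_prime_pow Nat.prime_three, Finset.sum_range_succ,
    Finset.sum_eq_zero, divisorsCoprimeThree_three_pow]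
  · simp
  · intro i hi
    rw [Finset.mem_range] at hi
    rw [show chiThree 3 = 0 from rfl, zero_pow (by omega), zero_mul]

theorem idealMajorant_prime_pow_of_mod_one {q : ℕ} (hq : q.Prime) (h : q % 3 = 1) (k : ℕ) :
    idealMajorant (q ^ k) = ((k + 2).choose 2 : ℕ) := by
  rw [idealMajorant_prime_pow hq]
  induction k with
  | zero => simp [divisorsCoprimeThree_prime_pow_of_ne hq (by omega)]
  | succ k ih =>
    have hchi : chiThree q = 1 := by rw [chiThree_apply, if_pos h]
    simp only [hchi, one_pow, one_mul] at ih ⊢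
    rw [Finset.sum_range_succ, ih, divisorsCoprimeThree_prime_pow_of_ne hq (by omega),
      Nat.choose_succ_succ' (k + 2) 1]
    push_cast [Nat.choose_one_right]
    ring

theorem idealMajorant_prime_pow_of_mod_two {q : ℕ} (hq : q.Prime) (h : q % 3 = 2) (k : ℕ) :
    idealMajorant (q ^ k) = (k / 2 + 1 : ℕ) := by
  rw [idealMajorant_prime_pow hq]
  induction k with
  | zero => simp [divisorsCoprimeThree_prime_pow_of_ne hq (by omega)]
  | succ k ih =>
    have hchi : chiThree q = -1 := by rw [chiThree_apply, if_neg (by omega), if_pos h]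
    have hstep : ∑ i ∈ Finset.range (k + 1), chiThree q ^ (k + 1 - i) * divisorsCoprimeThree (q ^ i)
        = -∑ i ∈ Finset.range (k + 1), chiThree q ^ (k - i) * divisorsCoprimeThree (q ^ i) := by
      rw [← Finset.sum_neg_distrib]
      refine Finset.sum_congr rfl fun i hi => ?_
      rw [Finset.mem_range_succ_iff] at hi
      rw [Nat.succ_sub hi, pow_succ, hchi]
      ring
    rw [Finset.sum_range_succ, hstep, ih, divisorsCoprimeThree_prime_pow_of_ne hq (by omega)]
    simp only [tsub_self, pow_zero, one_mul]
    push_cast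
    omega

theorem PureCubic.ncard_absNorm_le {P : ℕ} {K : Type*} [Field K] [NumberField K]
    (S : PureCubic P K) {n : ℕ} (hn : n ≠ 0) :
    ({I : Ideal (𝓞 K) | Ideal.absNorm I = n}.ncard : ℤ) ≤ idealMajorant n := by
  induction n using Nat.recOnPosPrimePosCoprime with
  | prime_pow q k hq hk =>
    have h3 : q % 3 = 0 ∨ q % 3 = 1 ∨ q % 3 = 2 := by omega
    rcases h3 with h | h | h
    · obtain rfl : q = 3 := ((Nat.prime_dvd_prime_iff_eq Nat.prime_three hq).1
        (Nat.dvd_of_mod_eq_zero h)).symm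
      rw [idealMajorant_three_pow]
      exact_mod_cast Ideal.ncard_absNorm_prime_pow_le_one hq
        (fun 𝔭 𝔮 h1 h2 h3 h4 => S.prime_above_three_unique h1 h2 h3 h4) k
    · rw [idealMajorant_prime_pow_of_mod_one hq h]
      exact_mod_cast Ideal.ncard_absNorm_prime_pow_le hq S.finrank_int k
    · rw [idealMajorant_prime_pow_of_mod_two hq h]
      exact_mod_cast Ideal.ncard_absNorm_prime_pow_le_half hq S.finrank_int
        (fun 𝔭 𝔮 h1 h2 h3 h4 => S.degree_one_prime_unique hq h h1 h2 h3 h4) k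
  | zero => exact absurd rfl hn
  | one => simp [Ideal.absNorm_eq_one_iff, isMultiplicative_idealMajorant.1]
  | coprime a b ha hb hab iha ihb =>
    rw [isMultiplicative_idealMajorant.2 hab]
    calc _ ≤ (({I : Ideal (𝓞 K) | Ideal.absNorm I = a}.ncard *
          {I : Ideal (𝓞 K) | Ideal.absNorm I = b}.ncard : ℕ) : ℤ) := by
          exact_mod_cast Ideal.ncard_absNorm_mul_le hab
      _ ≤ _ := by
          push_cast
          exact mul_le_mul (iha (by omega)) (ihb (by omega)) (by positivity)
            ((Nat.cast_nonneg _).trans (iha (by omega)))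

end

section

open NumberField

theorem sum_Ioc_chiThree_mul_le {u : ℕ → ℤ} (hanti : ∀ e, 0 < e → u (e + 1) ≤ u e)
    (hnn : ∀ e, 0 ≤ u e) (n : ℕ) :
    ∑ e ∈ Finset.Ioc 0 (n + 4), chiThree e * u e ≤ u 1 - u 2 + u 4 := by
  have key : ∑ e ∈ Finset.Ioc 0 (n + 4), chiThree e * u e ≤
      u 1 - u 2 + u 4 - if (n + 4) % 3 = 1 then 0 else u (n + 4) := by
    induction n with
    | zero =>
      refine le_of_eq ?_
      rw [show Finset.Ioc 0 (0 + 4) = {1, 2, 3, 4} by decide]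
      simp [chiThree_apply]
      ring
    | succ n ih =>
      rw [Finset.sum_Ioc_succ_top (by omega)]
      have h1 := hanti (n + 4) (by omega)
      have h2 := hnn (n + 4)
      rw [show n + 1 + 4 = n + 4 + 1 by omega]
      have h3 : (n + 4) % 3 = 0 ∨ (n + 4) % 3 = 1 ∨ (n + 4) % 3 = 2 := by omega
      rw [chiThree_apply]
      rcases h3 with h | h | h
      · have h' : (n + 4 + 1) % 3 = 1 := by omega
        simp only [h, h'] at ih ⊢
        norm_num at ih ⊢
        linarith
      · have h' : (n + 4 + 1) % 3 = 2 := by omega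
        simp only [h, h'] at ih ⊢
        norm_num at ih ⊢
        linarith
      · have h' : (n + 4 + 1) % 3 = 0 := by omega
        simp only [h, h'] at ih ⊢
        norm_num at ih ⊢
        linarith
  refine key.trans (sub_le_self _ ?_)
  split_ifs
  · exact le_rfl
  · exact hnn _

theorem divisorsCoprimeThree_nonneg (n : ℕ) : 0 ≤ divisorsCoprimeThree n := by
  rw [divisorsCoprimeThree, ArithmeticFunction.mul_apply]
  refine Finset.sum_nonneg fun x _ => mul_nonneg ?_ ?_
  · rw [coprimeThree_apply]
    split_ifs <;> norm_num
  · rw [ArithmeticFunction.natCoe_apply]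
    exact Nat.cast_nonneg _

theorem sum_Ioc_div_divisorsCoprimeThree (X : ℕ) {k : ℕ} (hk : 0 < k) :
    ∑ n ∈ Finset.Ioc 0 (X / k), divisorsCoprimeThree n =
      ∑ d ∈ Finset.Ioc 0 X, (if k ∣ d then coprimeThree (d / k) else 0) * ((X / d : ℕ) : ℤ) := by
  rw [divisorsCoprimeThree, ArithmeticFunction.sum_Ioc_mul_zeta_eq_sum]
  simp only [ite_mul, zero_mul]
  rw [← Finset.sum_filter]
  refine Finset.sum_bij' (fun f _ => k * f) (fun d _ => d / k) ?_ ?_ ?_ ?_ ?_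
  · intro f hf
    simp only [Finset.mem_Ioc, Finset.mem_filter] at hf ⊢
    exact ⟨⟨Nat.mul_pos hk hf.1, (Nat.mul_le_mul_left k hf.2).trans (Nat.mul_div_le X k)⟩,
      dvd_mul_right _ _⟩
  · intro d hd
    simp only [Finset.mem_Ioc, Finset.mem_filter] at hd ⊢
    exact ⟨Nat.div_pos (Nat.le_of_dvd hd.1.1 hd.2) hk, Nat.div_le_div_right hd.1.2⟩
  · intro f _
    exact Nat.mul_div_cancel_left _ hk
  · intro d hd
    exact Nat.mul_div_cancel' (Finset.mem_filter.1 hd).2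
  · intro f _
    rw [Nat.mul_div_cancel_left _ hk, Nat.div_div_eq_div_mul]

/-- The indicator function of the residues `1, 4, 5, 7, 8, 11` modulo `12`. -/
def weightTwelve (d : ℕ) : ℕ :=
  if d % 12 = 1 ∨ d % 12 = 4 ∨ d % 12 = 5 ∨ d % 12 = 7 ∨ d % 12 = 8 ∨ d % 12 = 11 then 1 else 0

theorem weightTwelve_eq (d : ℕ) : (if 1 ∣ d then coprimeThree (d / 1) else 0) -
    (if 2 ∣ d then coprimeThree (d / 2) else 0) + (if 4 ∣ d then coprimeThree (d / 4) else 0) =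
      (weightTwelve d : ℤ) := by
  obtain ⟨t, r, hr, rfl⟩ : ∃ t r, r < 12 ∧ d = 12 * t + r :=
    ⟨d / 12, d % 12, Nat.mod_lt _ (by norm_num), (Nat.div_add_mod d 12).symm⟩
  simp only [coprimeThree_apply, weightTwelve, Nat.dvd_iff_mod_eq_zero]
  have h1 : (12 * t + r) % 12 = r % 12 := by omega
  have h2 : (12 * t + r) % 2 = r % 2 := by omega
  have h3 : (12 * t + r) % 4 = r % 4 := by omega
  have h4 : (12 * t + r) / 1 % 3 = r % 3 := by omega
  have h5 : (12 * t + r) / 2 % 3 = r / 2 % 3 := by omega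
  have h6 : (12 * t + r) / 4 % 3 = r / 4 % 3 := by omega
  rw [h1, h2, h3, h4, h5, h6, Nat.mod_one]
  clear h1 h2 h3 h4 h5 h6
  interval_cases r <;> rfl

theorem sum_idealMajorant_le (X : ℕ) : ∑ n ∈ Finset.Ioc 0 X, idealMajorant n ≤
    ∑ d ∈ Finset.Ioc 0 X, (weightTwelve d : ℤ) * ((X / d : ℕ) : ℤ) := by
  set u : ℕ → ℤ := fun e => ∑ m ∈ Finset.Ioc 0 (X / e), divisorsCoprimeThree m with hu
  have h1 : ∑ n ∈ Finset.Ioc 0 X, idealMajorant n =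
      ∑ e ∈ Finset.Ioc 0 (X + 4), chiThree e * u e := by
    rw [idealMajorant, ArithmeticFunction.sum_Ioc_mul_eq_sum_sum]
    refine Finset.sum_subset (Finset.Ioc_subset_Ioc_right (by omega)) fun e he he' => ?_
    simp only [Finset.mem_Ioc, not_and, not_le] at he he'
    rw [Nat.div_eq_of_lt (he' he.1)]
    simp
  rw [h1]
  refine (sum_Ioc_chiThree_mul_le (fun e he => ?_) (fun e => ?_) X).trans (le_of_eq ?_)
  · exact Finset.sum_le_sum_of_subset_of_nonneg
      (Finset.Ioc_subset_Ioc_right (Nat.div_le_div_left (by omega) he))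
      fun _ _ _ => divisorsCoprimeThree_nonneg _
  · exact Finset.sum_nonneg fun _ _ => divisorsCoprimeThree_nonneg _
  · simp only [hu]
    rw [sum_Ioc_div_divisorsCoprimeThree X one_pos, sum_Ioc_div_divisorsCoprimeThree X two_pos,
      sum_Ioc_div_divisorsCoprimeThree X four_pos, ← Finset.sum_sub_distrib,
      ← Finset.sum_add_distrib]
    exact Finset.sum_congr rfl fun d _ => by rw [← weightTwelve_eq]; ring

theorem PureCubic.ncard_absNorm_le_sum {P : ℕ} {K : Type*} [Field K] [NumberField K]
    (S : PureCubic P K) (X : ℕ) :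
    ({I : nonZeroDivisors (Ideal (𝓞 K)) | Ideal.absNorm (I : Ideal (𝓞 K)) ≤ X}.ncard : ℝ) ≤
      X * ∑ d ∈ Finset.Ioc 0 X, (weightTwelve d : ℝ) / d := by
  have h1 : {I : nonZeroDivisors (Ideal (𝓞 K)) | Ideal.absNorm (I : Ideal (𝓞 K)) ≤ X}.ncard ≤
      ∑ n ∈ Finset.Ioc 0 X, {I : Ideal (𝓞 K) | Ideal.absNorm I = n}.ncard := by
    have hsub : Subtype.val '' {I : nonZeroDivisors (Ideal (𝓞 K)) |
        Ideal.absNorm (I : Ideal (𝓞 K)) ≤ X} ⊆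
        ⋃ n ∈ Finset.Ioc 0 X, {I : Ideal (𝓞 K) | Ideal.absNorm I = n} := by
      rintro _ ⟨I, hI, rfl⟩
      simp only [Set.mem_iUnion, Set.mem_ofPred_eq, Finset.mem_Ioc, exists_prop, exists_eq_right']
      exact ⟨Ideal.absNorm_pos_of_nonZeroDivisors I, hI⟩
    rw [← Set.ncard_image_of_injective _ Subtype.val_injective]
    refine (Set.ncard_le_ncard hsub ?_).trans (Finset.set_ncard_biUnion_le _ _)
    exact Set.Finite.biUnion (Finset.finite_toSet _) fun n _ => Ideal.finite_setOfPred_absNorm_eq n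
  have h2 : ((∑ n ∈ Finset.Ioc 0 X, {I : Ideal (𝓞 K) | Ideal.absNorm I = n}.ncard : ℕ) : ℤ) ≤
      ((∑ d ∈ Finset.Ioc 0 X, weightTwelve d * (X / d) : ℕ) : ℤ) := by
    push_cast
    refine le_trans (Finset.sum_le_sum fun n hn => ?_) (sum_idealMajorant_le X)
    exact S.ncard_absNorm_le (Finset.mem_Ioc.1 hn).1.ne'
  have h3 := h1.trans (Int.ofNat_le.1 h2)
  refine (Nat.cast_le.2 h3).trans ?_
  push_cast
  rw [Finset.mul_sum]
  refine Finset.sum_le_sum fun d _ => ?_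
  have := mul_le_mul_of_nonneg_left (Nat.cast_div_le (α := ℝ) (m := X) (n := d))
    (Nat.cast_nonneg (α := ℝ) (weightTwelve d))
  refine this.trans (le_of_eq ?_)
  ring

end

section

open NumberField

/-- The number of `d ∈ [1, n]` with residue `1, 4, 5, 7, 8` or `11` modulo `12`. -/
def weightCount (n : ℕ) : ℕ :=
  (n + 11) / 12 + (n + 8) / 12 + (n + 7) / 12 + (n + 5) / 12 + (n + 4) / 12 + (n + 1) / 12

theorem weightCount_succ (n : ℕ) : weightCount (n + 1) = weightCount n + weightTwelve (n + 1) := by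
  obtain ⟨t, r, hr, rfl⟩ : ∃ t r, r < 12 ∧ n = 12 * t + r :=
    ⟨n / 12, n % 12, Nat.mod_lt _ (by norm_num), (Nat.div_add_mod n 12).symm⟩
  rw [weightCount, weightCount, weightTwelve]
  interval_cases r <;> split_ifs <;> omega

theorem two_mul_weightCount_le (n : ℕ) : 2 * weightCount n ≤ n + 2 := by
  obtain ⟨t, r, hr, rfl⟩ : ∃ t r, r < 12 ∧ n = 12 * t + r :=
    ⟨n / 12, n % 12, Nat.mod_lt _ (by norm_num), (Nat.div_add_mod n 12).symm⟩
  rw [weightCount]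
  interval_cases r <;> omega

theorem weightTwelve_le_one (n : ℕ) : weightTwelve n ≤ 1 := by
  rw [weightTwelve]
  split_ifs <;> norm_num

theorem sum_weightTwelve_div_le_log_weightCount (n : ℕ) :
    ∑ d ∈ Finset.Ioc 0 (n + 8), (weightTwelve d : ℝ) / d ≤
      1 / 2 * Real.log (2 * weightCount (n + 8) - 1) + 0.62 := by
  induction n with
  | zero =>
    have h1 : Real.log 9 = 2 * Real.log 3 := by
      rw [show (9 : ℝ) = 3 ^ 2 by norm_num, Real.log_pow]
      norm_num
    have h2 := Real.log_three_gt_d9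
    rw [show Finset.Ioc 0 (0 + 8) = {1, 2, 3, 4, 5, 6, 7, 8} by decide]
    norm_num [weightTwelve, weightCount, h1]
    linarith
  | succ n ih =>
    rw [show n + 1 + 8 = n + 8 + 1 by omega, Finset.sum_Ioc_succ_top (by omega), weightCount_succ]
    rcases Nat.le_one_iff_eq_zero_or_eq_one.1 (weightTwelve_le_one (n + 8 + 1)) with h | h
    · simpa [h] using ih
    · rw [h]
      have hk1 : 1 ≤ weightCount (n + 8) := by
        rw [weightCount]
        omega
      have hk2 : 2 * weightCount (n + 8) ≤ n + 8 + 1 := by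
        have := two_mul_weightCount_le (n + 8 + 1)
        rw [weightCount_succ, h] at this
        omega
      have hk1' : (1 : ℝ) ≤ weightCount (n + 8) := by exact_mod_cast hk1
      have hk2' : 2 * (weightCount (n + 8) : ℝ) ≤ n + 8 + 1 := by exact_mod_cast hk2
      push_cast
      generalize (weightCount (n + 8) : ℝ) = k at *
      have hlog := Real.sum_range_le_log_div (x := 1 / (2 * k)) (by positivity)
        (by rw [div_lt_one (by linarith)]; linarith) 1
      have hquot : (1 + 1 / (2 * k)) / (1 - 1 / (2 * k)) = (2 * k + 1) / (2 * k - 1) := by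
        rw [div_eq_div_iff]
        · field_simp
        · rw [Ne, sub_eq_zero, eq_div_iff (by positivity)]
          intro h
          linarith
        · intro h
          linarith
      rw [hquot, Real.log_div (by linarith) (by linarith)] at hlog
      norm_num at hlog
      have hinv : (1 : ℝ) / ((n + 8 + 1 : ℕ) : ℝ) ≤ k⁻¹ * 2⁻¹ := by
        rw [← mul_inv, one_div]
        push_cast
        exact inv_anti₀ (by linarith) (by linarith)
      push_cast at hinv ⊢
      rw [show 2 * (k + 1) - 1 = 2 * k + 1 by ring]
      norm_num at hinv ih ⊢
      linarith

theorem sum_weightTwelve_div_le_log (n : ℕ) :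
    ∑ d ∈ Finset.Ioc 0 n, (weightTwelve d : ℝ) / d ≤ 1 / 2 * Real.log (n + 1) + 0.654 := by
  rcases lt_or_ge n 8 with h | h
  · have h2 := Real.log_two_gt_d9
    have h3 := Real.log_three_gt_d9
    have h4 : Real.log 4 = 2 * Real.log 2 := by
      rw [show (4 : ℝ) = 2 ^ 2 by norm_num, Real.log_pow]
      norm_num
    have h5 : Real.log 4 ≤ Real.log 5 := Real.log_le_log (by norm_num) (by norm_num)
    have h6 : Real.log 6 = Real.log 2 + Real.log 3 := by
      rw [← Real.log_mul (by norm_num) (by norm_num)]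
      norm_num
    have h7 : Real.log 6 ≤ Real.log 7 := Real.log_le_log (by norm_num) (by norm_num)
    have h8 : Real.log 8 = 3 * Real.log 2 := by
      rw [show (8 : ℝ) = 2 ^ 3 by norm_num, Real.log_pow]
      norm_num
    interval_cases n <;> simp only [Finset.sum_Ioc_succ_top (Nat.zero_le _), Finset.Ioc_self,
      Finset.sum_empty] <;> norm_num [weightTwelve] <;> linarith
  · obtain ⟨m, rfl⟩ := Nat.exists_eq_add_of_le' h
    refine (sum_weightTwelve_div_le_log_weightCount m).trans ?_
    have h1 : (2 * (weightCount (m + 8) : ℝ)) ≤ (m + 8 : ℕ) + 2 := by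
      exact_mod_cast two_mul_weightCount_le (m + 8)
    have hk1 : 1 ≤ weightCount (m + 8) := by
      rw [weightCount]
      omega
    have hk1' : (1 : ℝ) ≤ weightCount (m + 8) := by exact_mod_cast hk1
    have h2 : Real.log (2 * weightCount (m + 8) - 1) ≤ Real.log ((m + 8 : ℕ) + 1) :=
      Real.log_le_log (by linarith) (by linarith)
    linarith

namespace PureCubic

variable {P : ℕ} {K : Type*} [Field K] [NumberField K] (S : PureCubic P K)

include S

theorem ncard_absNorm_le_quadratic {M : ℝ} (hM : 0 < M) (X : ℕ) :
    ({I : nonZeroDivisors (Ideal (𝓞 K)) | Ideal.absNorm (I : Ideal (𝓞 K)) ≤ X}.ncard : ℝ) ≤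
      (1 / 2 * Real.log M + 0.154 + 1 / (2 * M)) * X + 1 / (2 * M) * X ^ 2 := by
  refine (S.ncard_absNorm_le_sum X).trans ?_
  have h1 := sum_weightTwelve_div_le_log X
  have h2 := Real.log_le_sub_one_of_pos (x := (X + 1) / M) (by positivity)
  rw [Real.log_div (by positivity) hM.ne'] at h2
  have h3 : ∑ d ∈ Finset.Ioc 0 X, (weightTwelve d : ℝ) / d ≤
      (1 / 2 * Real.log M + 0.154 + 1 / (2 * M)) + 1 / (2 * M) * X := by
    refine h1.trans ?_
    have : ((X : ℝ) + 1) / M = 2 * (1 / (2 * M) + 1 / (2 * M) * X) := by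
      field_simp
      ring
    rw [this] at h2
    linarith
  calc _ ≤ (X : ℝ) * ((1 / 2 * Real.log M + 0.154 + 1 / (2 * M)) + 1 / (2 * M) * X) := by gcongr
    _ = _ := by ring

theorem classNumber_mul_log_le {ε : ℝ} (hε : IsFundamentalUnit P ε) :
    classNumber K * Real.log ε ≤ P * (0.5169 * Real.log P + 1.1766) + 0.194 := by
  have hP : (3 : ℝ) ≤ P := by exact_mod_cast S.two_lt
  have hpi1 := Real.pi_gt_d6
  have hs : √27 ≤ 5.1962 := Real.sqrt_le_iff.2 (by norm_num)
  have hs0 : 0 < √27 := Real.sqrt_pos.2 (by norm_num)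
  have hspi : √Real.pi ^ 2 = Real.pi := Real.sq_sqrt Real.pi_pos.le
  have hspi0 : 0 < √Real.pi := Real.sqrt_pos.2 Real.pi_pos
  set b : ℝ := √Real.pi * Real.pi / (5 * (√27 * P / 2)) with hb
  have hb0 : 0 < b := by positivity
  set M : ℝ := 8 * P / 3 with hM
  have hM0 : 0 < M := by positivity
  have hlogM : Real.log M = 3 * Real.log 2 - Real.log 3 + Real.log P := by
    rw [hM, Real.log_div (by positivity) (by norm_num), Real.log_mul (by norm_num) (by positivity),
      show (8 : ℝ) = 2 ^ 3 by norm_num, Real.log_pow]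
    push_cast
    ring
  have hlogP : 0 ≤ Real.log P := Real.log_nonneg (by linarith)
  have hl2 := Real.log_two_gt_d9
  have hl2' := Real.log_two_lt_d9
  have hl3 := Real.log_three_gt_d9
  have hl3' := Real.log_three_lt_d9
  have ha0 : 0 ≤ 1 / 2 * Real.log M + 0.154 + 1 / (2 * M) := by
    have : 0 ≤ Real.log M := by
      rw [hlogM]
      linarith
    positivity
  have hheat := tsum_heatKernel_le ha0 (c := 1 / (2 * M)) (by positivity)
    (fun X => Ideal.finite_setOfPred_absNorm_le₀ (S := 𝓞 K) X)
    (fun X => S.ncard_absNorm_le_quadratic hM0 X) hb0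
  have hmain := (S.classNumber_mul_le hε (μ := 5) (b := b) (by norm_num)
    (by rw [hb]; field_simp)).trans (mul_le_mul_right hheat 2)
  have hlogε : 0 ≤ Real.log ε := Real.log_nonneg hε.2.1.le
  rw [← ENNReal.ofReal_natCast, ← ENNReal.ofReal_mul hlogε,
    ← ENNReal.ofReal_mul (Nat.cast_nonneg _), ← ENNReal.ofReal_ofNat 2,
    ← ENNReal.ofReal_mul (by norm_num),
    ENNReal.ofReal_le_ofReal_iff (by positivity)] at hmain
  have hcoef1 : √Real.pi / b ≤ 4.1352 * P := by
    rw [hb, div_div_eq_mul_div, div_le_iff₀ (by positivity)]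
    have : 5 * (√27 * P / 2) ≤ 4.1352 * P * Real.pi := by nlinarith
    nlinarith
  have hcoef2 : 1 / b ^ 2 ≤ 5.4429 * P ^ 2 := by
    have hpi3 : 31.0062 ≤ Real.pi ^ 3 := by
      have : (3.141592 : ℝ) ^ 3 ≤ Real.pi ^ 3 := pow_le_pow_left₀ (by norm_num) hpi1.le 3
      refine le_trans (by norm_num) this
    have h27 : √27 ^ 2 = 27 := Real.sq_sqrt (by norm_num)
    have : b ^ 2 = Real.pi ^ 3 / (675 / 4 * P ^ 2) := by
      rw [hb, div_pow, mul_pow, hspi, mul_pow, div_pow, mul_pow, h27]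
      ring
    rw [this, one_div_div, div_le_iff₀ (by positivity)]
    have : 0 < (P : ℝ) ^ 2 := by positivity
    nlinarith
  have hexp : 2 * ((1 / 2 * Real.log M + 0.154 + 1 / (2 * M)) * √Real.pi / (2 * b) +
      1 / (2 * M) / b ^ 2) = (1 / 2 * Real.log M + 0.154 + 1 / (2 * M)) * (√Real.pi / b) +
      1 / M * (1 / b ^ 2) := by
    field_simp
  rw [hexp] at hmain
  have h4 := mul_le_mul_of_nonneg_left hcoef1 ha0
  have h5 := mul_le_mul_of_nonneg_left hcoef2 (a := 1 / M) (by positivity)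
  have h6 : (1 / 2 * Real.log M + 0.154 + 1 / (2 * M)) * (4.1352 * P) =
      4.1352 * P * (1 / 2 * Real.log M + 0.154) + 4.1352 * 3 / 16 := by
    rw [hM]
    field_simp
    ring
  have h7 : 1 / M * (5.4429 * P ^ 2) = 5.4429 * 3 / 8 * P := by
    rw [hM]
    field_simp
  rw [h6, hlogM] at h4
  rw [h7] at h5
  have h8 : (P : ℝ) * (3 * Real.log 2 - Real.log 3) ≤ P * 0.98083 :=
    mul_le_mul_of_nonneg_left (by linarith) (by linarith)
  have h9 : 0 ≤ (P : ℝ) * Real.log P := by positivity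
  nlinarith

theorem classNumber_lt_of_log_le {ε t : ℝ} (hε : IsFundamentalUnit P ε) {n : ℕ}
    (ht : t ≤ Real.log ε) (ht0 : 0 ≤ t)
    (hn : P * (0.5169 * Real.log P + 1.1766) + 0.194 < n * t) : classNumber K < n := by
  by_contra! h
  have h1 := S.classNumber_mul_log_le hε
  have h2 : (n : ℝ) * t ≤ classNumber K * Real.log ε :=
    mul_le_mul (by exact_mod_cast h) ht ht0 (Nat.cast_nonneg _)
  linarith

theorem classNumber_lt {ε : ℝ} (hε : IsFundamentalUnit P ε) (hP : 7 ≤ P) : classNumber K < P := by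
  have hP' : (7 : ℝ) ≤ P := by exact_mod_cast hP
  have hl2 := Real.log_two_gt_d9
  have hl2' := Real.log_two_lt_d9
  have hl3 := Real.log_three_gt_d9
  have hl5 := Real.log_five_lt_d9
  have hcube := cbrt_pow_three P
  have hc0 := cbrt_nonneg P
  have hc : (1.9 : ℝ) < cbrt P := by
    by_contra! h
    have := pow_le_pow_left₀ hc0 h 3
    rw [hcube] at this
    norm_num at this
    linarith
  have hlogP : Real.log P = 3 * Real.log (cbrt P) := by
    rw [← hcube, Real.log_pow]
    norm_num
  have hlog6 : Real.log 2 + Real.log 3 ≤ Real.log P := by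
    rw [← Real.log_mul (by norm_num) (by norm_num)]
    exact Real.log_le_log (by norm_num) (by linarith)
  have hlog27 : Real.log 2.7 = 3 * Real.log 3 - Real.log 2 - Real.log 5 := by
    rw [show (2.7 : ℝ) = 3 ^ 3 / 2 / 5 by norm_num, Real.log_div (by norm_num) (by norm_num),
      Real.log_div (by norm_num) (by norm_num), Real.log_pow]
    norm_num
  have hlog : Real.log 2.7 + 2 * Real.log (cbrt P) ≤ Real.log ε := by
    have : Real.log 2.7 + 2 * Real.log (cbrt P) = Real.log (2.7 * cbrt P ^ 2) := by
      rw [Real.log_mul (by norm_num) (by positivity), Real.log_pow]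
      norm_num
    rw [this]
    refine Real.log_le_log (by positivity) ?_
    have := S.unit_gt hε.1 hε.2.1
    nlinarith
  refine S.classNumber_lt_of_log_le hε hlog (by linarith) ?_
  have : 0.194 <
      (P : ℝ) * (Real.log 2.7 + 2 / 3 * Real.log P - (0.5169 * Real.log P + 1.1766)) := by
    have : (0.03 : ℝ) ≤ Real.log 2.7 + 2 / 3 * Real.log P - (0.5169 * Real.log P + 1.1766) := by
      rw [hlog27]
      norm_num at hl2 hl2' hl3 hl5 ⊢
      linarith
    nlinarith
  rw [hlogP] at *
  linarith

end PureCubic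

theorem classNumber_lt_three_of_three {K : Type*} [Field K] [NumberField K] (S : PureCubic 3 K)
    {ε : ℝ} (hε : IsFundamentalUnit 3 ε) : classNumber K < 3 := by
  have hl2 := Real.log_two_gt_d9
  have hl3 := Real.log_three_gt_d9
  have hl3' := Real.log_three_lt_d9
  have hb := PureCubic.cbrt_three_bounds
  have hlog : 2 * Real.log 2 + Real.log 3 ≤ Real.log ε := by
    have : 2 * Real.log 2 + Real.log 3 = Real.log 12 := by
      rw [show (12 : ℝ) = 2 ^ 2 * 3 by norm_num, Real.log_mul (by norm_num) (by norm_num),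
        Real.log_pow]
      norm_num
    rw [this]
    refine Real.log_le_log (by norm_num) ?_
    rw [PureCubic.fundamental_three S hε]
    push_cast
    nlinarith
  refine S.classNumber_lt_of_log_le hε hlog (by linarith) ?_
  push_cast
  linarith

theorem classNumber_lt_three_of_five {K : Type*} [Field K] [NumberField K] (S : PureCubic 5 K)
    {ε : ℝ} (hε : IsFundamentalUnit 5 ε) : classNumber K < 3 := by
  have hl2 := Real.log_two_gt_d9
  have hl3 := Real.log_three_gt_d9
  have hl5 := Real.log_five_gt_d9
  have hl5' := Real.log_five_lt_d9
  have hb := PureCubic.cbrt_five_bounds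
  have hlog : 3 * Real.log 2 + Real.log 3 + Real.log 5 ≤ Real.log ε := by
    have : 3 * Real.log 2 + Real.log 3 + Real.log 5 = Real.log 120 := by
      rw [show (120 : ℝ) = 2 ^ 3 * 3 * 5 by norm_num, Real.log_mul (by norm_num) (by norm_num),
        Real.log_mul (by norm_num) (by norm_num), Real.log_pow]
      norm_num
    rw [this]
    refine Real.log_le_log (by norm_num) ?_
    rw [PureCubic.fundamental_five S hε]
    push_cast
    nlinarith
  refine S.classNumber_lt_of_log_le hε hlog (by linarith) ?_
  push_cast
  linarith

theorem classNumber_lt_three_of_six {K : Type*} [Field K] [NumberField K] (S : PureCubic 6 K)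
    {ε : ℝ} (hε : IsFundamentalUnit 6 ε) : classNumber K < 3 := by
  have hl2 := Real.log_two_gt_d9
  have hl2' := Real.log_two_lt_d9
  have hl3' := Real.log_three_lt_d9
  have hl5 := Real.log_five_gt_d9
  have hb := PureCubic.cbrt_six_bounds
  have hlog : 6 * Real.log 2 + Real.log 5 ≤ Real.log ε := by
    have : 6 * Real.log 2 + Real.log 5 = Real.log 320 := by
      rw [show (320 : ℝ) = 2 ^ 6 * 5 by norm_num, Real.log_mul (by norm_num) (by norm_num),
        Real.log_pow]
      norm_num
    rw [this]
    refine Real.log_le_log (by norm_num) ?_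
    rw [PureCubic.fundamental_six S hε]
    push_cast
    nlinarith
  refine S.classNumber_lt_of_log_le hε hlog (by linarith) ?_
  have h6 : Real.log 6 = Real.log 2 + Real.log 3 := by
    rw [← Real.log_mul (by norm_num) (by norm_num)]
    norm_num
  push_cast
  rw [h6]
  linarith

end

section

open NumberField

theorem Ideal.exists_span_singleton_of_pow_eq {R : Type*} [CommRing R] [IsDedekindDomain R]
    [Fintype (ClassGroup R)] {n : ℕ} (hn : n.Coprime (Fintype.card (ClassGroup R))) (hn0 : n ≠ 0)
    {x : R} (hx : x ≠ 0) {I : Ideal R} (hI : Ideal.span {x} = I ^ n) :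
    ∃ (u : Rˣ) (g : R), x = u * g ^ n := by
  have hI0 : I ≠ 0 := by
    rintro rfl
    rw [zero_pow hn0] at hI
    exact hx (Ideal.span_singleton_eq_bot.1 hI)
  set J : nonZeroDivisors (Ideal R) := ⟨I, mem_nonZeroDivisors_of_ne_zero hI0⟩ with hJ
  have h1 : ClassGroup.mk0 J ^ n = 1 := by
    rw [← map_pow, ClassGroup.mk0_eq_one_iff]
    exact ⟨x, by simpa [hJ] using hI.symm⟩
  have h2 : ClassGroup.mk0 J = 1 := by
    rw [← orderOf_eq_one_iff]
    exact Nat.eq_one_of_dvd_coprimes hn (orderOf_dvd_of_pow_eq_one h1) (orderOf_dvd_card)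
  obtain ⟨g, hg⟩ := (ClassGroup.mk0_eq_one_iff J.2).1 h2
  have hg' : I = Ideal.span {g} := by simpa [hJ] using hg
  rw [hg', Ideal.span_singleton_pow, Ideal.span_singleton_eq_span_singleton] at hI
  obtain ⟨u, hu⟩ := hI.symm
  exact ⟨u, g, by rw [← hu, mul_comm]⟩

theorem Ideal.exists_eq_pow_of_mul_eq_pow {R : Type*} [CommRing R] [IsDedekindDomain R]
    {x y z : R} {n : ℕ} (hxy : IsCoprime x y) (h : x * y = z ^ n) :
    ∃ I : Ideal R, Ideal.span {x} = I ^ n := by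
  refine exists_eq_pow_of_mul_eq_pow_of_coprime (a := Ideal.span {x}) (b := Ideal.span {y})
    (c := Ideal.span {z}) (n := n) ((Ideal.isCoprime_span_singleton_iff x y).2 hxy) ?_
  rw [Ideal.span_singleton_mul_span_singleton, h, Ideal.span_singleton_pow]

namespace PureCubic

variable {P : ℕ} {K : Type*} [Field K] [NumberField K] (S : PureCubic P K)

include S

theorem cube_coords {N : ℕ} {w : 𝓞 K} (hw : w ^ 3 = N) :
    (∃ x : ℤ, (N : ℤ) = x ^ 3) ∨ (P : ℤ) ∣ N := by
  obtain ⟨x, y, z, rfl⟩ := S.exists_coords_int w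
  have hcube := S.rootInt_cube
  have hc : ((x ^ 3 + P * y ^ 3 + P ^ 2 * z ^ 3 + 6 * P * x * y * z : ℤ) : 𝓞 K) +
      ((3 * (x ^ 2 * y + P * x * z ^ 2 + P * y ^ 2 * z) : ℤ) : 𝓞 K) * S.rootInt +
      ((3 * (x ^ 2 * z + x * y ^ 2 + P * y * z ^ 2) : ℤ) : 𝓞 K) * S.rootInt ^ 2 =
      ((N : ℤ) : 𝓞 K) + ((0 : ℤ) : 𝓞 K) * S.rootInt + ((0 : ℤ) : 𝓞 K) * S.rootInt ^ 2 := by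
    push_cast
    rw [← hcube]
    linear_combination hw
  obtain ⟨h0, h1, h2⟩ := S.coords_int_ext hc
  have h1' : ((x : ℝ) ^ 2 * y + P * x * z ^ 2 + P * y ^ 2 * z) = 0 := by
    have : x ^ 2 * y + P * x * z ^ 2 + P * y ^ 2 * z = 0 := by linarith
    exact_mod_cast this
  have h2' : ((x : ℝ) ^ 2 * z + x * y ^ 2 + P * y * z ^ 2) = 0 := by
    have : x ^ 2 * z + x * y ^ 2 + P * y * z ^ 2 = 0 := by linarith
    exact_mod_cast this
  have hcr := cbrt_pow_three P
  have hprod : ((x : ℝ) - y * cbrt P) * (y * cbrt P - z * cbrt P ^ 2) * (z * cbrt P ^ 2 - x) =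
      0 := by
    rw [← hcr] at h1' h2'
    linear_combination cbrt P ^ 2 * h2' - cbrt P * h1'
  have hzero : (x = 0 ∧ y = 0) ∨ (y = 0 ∧ z = 0) ∨ (x = 0 ∧ z = 0) := by
    rcases mul_eq_zero.1 hprod with h | h
    · rcases mul_eq_zero.1 h with h | h
      · have : (x : ℝ) + ((-y : ℤ) : ℝ) * cbrt P + ((0 : ℤ) : ℝ) * cbrt P ^ 2 =
            ((0 : ℤ) : ℝ) + ((0 : ℤ) : ℝ) * cbrt P + ((0 : ℤ) : ℝ) * cbrt P ^ 2 := by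
          push_cast
          linear_combination h
        have := S.real_coords_ext this
        omega
      · have : ((0 : ℤ) : ℝ) + (y : ℝ) * cbrt P + ((-z : ℤ) : ℝ) * cbrt P ^ 2 =
            ((0 : ℤ) : ℝ) + ((0 : ℤ) : ℝ) * cbrt P + ((0 : ℤ) : ℝ) * cbrt P ^ 2 := by
          push_cast
          linear_combination h
        have := S.real_coords_ext this
        omega
    · have : ((-x : ℤ) : ℝ) + ((0 : ℤ) : ℝ) * cbrt P + (z : ℝ) * cbrt P ^ 2 =
            ((0 : ℤ) : ℝ) + ((0 : ℤ) : ℝ) * cbrt P + ((0 : ℤ) : ℝ) * cbrt P ^ 2 := by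
        push_cast
        linear_combination h
      have := S.real_coords_ext this
      omega
  rcases hzero with ⟨rfl, rfl⟩ | ⟨rfl, rfl⟩ | ⟨rfl, rfl⟩
  · exact Or.inr ⟨P * z ^ 3, by rw [← h0]; ring⟩
  · exact Or.inl ⟨x, by rw [← h0]; ring⟩
  · exact Or.inr ⟨y ^ 3, by rw [← h0]; ring⟩

omit S [NumberField K] in
theorem isCoprime_intCast {m n : ℤ} (h : IsCoprime m n) : IsCoprime (m : 𝓞 K) (n : 𝓞 K) :=
  h.map (Int.castRingHom (𝓞 K))

theorem three_eq_unit_mul_cube (h3 : ¬ 3 ∣ P)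
    (hcop : (3 : ℕ).Coprime (Fintype.card (ClassGroup (𝓞 K)))) :
    ∃ (u : (𝓞 K)ˣ) (g : 𝓞 K), (3 : 𝓞 K) = u * g ^ 3 := by
  have hcube := S.rootInt_cube
  obtain ⟨h91, h98⟩ := S.mod9
  obtain ⟨t, ht, ht3⟩ : ∃ t : ℤ, (P : ℤ) - P ^ 3 = 3 * t ∧ ¬ 3 ∣ t := by
    have h9 : ∀ r : ZMod 9, r ≠ 0 → r ≠ 1 → r ≠ 8 → r ≠ 3 → r ≠ 6 → r - r ^ 3 ≠ 0 ∧
      3 * (r - r ^ 3) = 0 := by decide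
    have hr := h9 (P : ZMod 9)
    have hne (k : ℕ) (hk : k < 9) (hkP : P % 9 ≠ k) : (P : ZMod 9) ≠ (k : ℕ) := by
      rw [Ne, ZMod.natCast_eq_natCast_iff', Nat.mod_eq_of_lt hk]
      exact hkP
    obtain ⟨hr1, hr2⟩ := hr (by simpa using hne 0 (by omega) (by omega))
      (by simpa using hne 1 (by omega) (by omega)) (by simpa using hne 8 (by omega) (by omega))
      (by simpa using hne 3 (by omega) (by omega)) (by simpa using hne 6 (by omega) (by omega))
    have hd1 : ¬ (9 : ℤ) ∣ (P - P ^ 3 : ℤ) := by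
      rw [show (9 : ℤ) = ((9 : ℕ) : ℤ) from rfl, ← ZMod.intCast_zmod_eq_zero_iff_dvd]
      exact_mod_cast hr1
    have hd2 : (9 : ℤ) ∣ 3 * (P - P ^ 3 : ℤ) := by
      rw [show (9 : ℤ) = ((9 : ℕ) : ℤ) from rfl, ← ZMod.intCast_zmod_eq_zero_iff_dvd]
      push_cast
      exact hr2
    generalize (P - P ^ 3 : ℤ) = Q at *
    exact ⟨Q / 3, by omega, by omega⟩
  set s : 𝓞 K := S.rootInt - P with hs
  set c : 𝓞 K := t - P * S.rootInt * s with hc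
  have ht' : ((P : 𝓞 K) - P ^ 3) = 3 * t := by exact_mod_cast congrArg (Int.cast (R := 𝓞 K)) ht
  have hsc : 3 * c = s ^ 3 := by
    rw [hc, hs]
    linear_combination -hcube - ht'
  have hcop3 : IsCoprime (3 : 𝓞 K) c := by
    have h1 : IsCoprime (3 : 𝓞 K) ((t : 𝓞 K) ^ 3) := by
      have : IsCoprime (3 : ℤ) t := (Int.prime_three.coprime_iff_not_dvd).2 ht3
      exact_mod_cast (isCoprime_intCast this).pow_right
    have h2 : (t : 𝓞 K) ^ 3 = c * (3 * P ^ 4 + c ^ 2 + 3 * c * (P * S.rootInt * s) +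
        3 * (P * S.rootInt * s) ^ 2) := by
      have : (P * S.rootInt * s) ^ 3 = P ^ 4 * (3 * c) := by
        rw [hsc, mul_pow, mul_pow, hcube]
        ring
      have h3 : (t : 𝓞 K) = c + P * S.rootInt * s := by rw [hc]; ring
      rw [h3]
      linear_combination this
    rw [h2] at h1
    exact h1.of_mul_right_left
  obtain ⟨I, hI⟩ := Ideal.exists_eq_pow_of_mul_eq_pow hcop3 hsc
  exact Ideal.exists_span_singleton_of_pow_eq hcop three_ne_zero (by norm_num) hI

theorem two_eq_unit_mul_cube {p : ℕ} (hP : P = 2 * p) (hp : Odd p)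
    (hcop : (3 : ℕ).Coprime (Fintype.card (ClassGroup (𝓞 K)))) :
    ∃ (u : (𝓞 K)ˣ) (g : 𝓞 K), (2 : 𝓞 K) = u * g ^ 3 := by
  have hcop2 : IsCoprime (2 : 𝓞 K) (p : 𝓞 K) := by
    have : IsCoprime (2 : ℤ) p := by
      rw [show (2 : ℤ) = (2 : ℕ) from rfl, Nat.isCoprime_iff_coprime]
      exact Nat.coprime_two_left.2 hp
    exact_mod_cast isCoprime_intCast this
  have hmul : (2 : 𝓞 K) * p = S.rootInt ^ 3 := by
    rw [S.rootInt_cube, hP]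
    push_cast
    rfl
  obtain ⟨I, hI⟩ := Ideal.exists_eq_pow_of_mul_eq_pow hcop2 hmul
  exact Ideal.exists_span_singleton_of_pow_eq hcop three_ne_zero two_ne_zero hI

theorem not_coprime_three_classNumber {ε : ℝ} (hε : IsFundamentalUnit P ε) {p : ℕ} (hp : p.Prime)
    (h5 : 5 ≤ p) (hP : P = 2 * p) : ¬ (3 : ℕ).Coprime (Fintype.card (ClassGroup (𝓞 K))) := by
  intro hcop
  have hpodd : Odd p := hp.odd_of_ne_two (by omega)
  have hP3 : ¬ 3 ∣ P := by
    rw [hP, Nat.prime_three.dvd_mul]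
    rintro (h | h)
    · omega
    · have := (Nat.prime_dvd_prime_iff_eq Nat.prime_three hp).1 h
      omega
  obtain ⟨η, -, hη⟩ := S.exists_unit_zpow hε
  have hform {n : 𝓞 K} (h : ∃ (u : (𝓞 K)ˣ) (g : 𝓞 K), n = u * g ^ 3) :
      ∃ (i : ℤ) (g : 𝓞 K), n = ((η ^ i : (𝓞 K)ˣ) : 𝓞 K) * g ^ 3 := by
    obtain ⟨u, g, rfl⟩ := h
    obtain ⟨k, rfl | rfl⟩ := hη u
    · exact ⟨k, g, rfl⟩
    · exact ⟨k, -g, by push_cast; ring⟩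
  obtain ⟨i, g, hg⟩ := hform (S.two_eq_unit_mul_cube hP hpodd hcop)
  obtain ⟨j, g', hg'⟩ := hform (S.three_eq_unit_mul_cube hP3 hcop)
  have hcontra {N : ℕ} (hN : N = 2 ∨ N = 3 ∨ N = 6 ∨ N = 18) (w : 𝓞 K) : w ^ 3 ≠ N := by
    intro hw
    rcases S.cube_coords hw with ⟨x, hx⟩ | h
    · have hx1 : 0 < x := by
        by_contra! h
        have : x ^ 3 ≤ 0 := Odd.pow_nonpos (by decide) h
        omega
      have hx2 : x < 3 := by
        by_contra! h
        have : (3 : ℤ) ^ 3 ≤ x ^ 3 := pow_le_pow_left₀ (by norm_num) h 3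
        omega
      interval_cases x <;> omega
    · have hpN : p ∣ N := (Dvd.intro_left 2 hP.symm).trans (Int.natCast_dvd_natCast.1 h)
      have : p ∣ 2 * 3 ^ 2 := by
        refine hpN.trans ?_
        rcases hN with rfl | rfl | rfl | rfl <;> norm_num
      rcases hp.dvd_mul.1 this with h | h
      · have := Nat.le_of_dvd (by norm_num) h
        omega
      · have := Nat.le_of_dvd (by norm_num) (hp.dvd_of_dvd_pow h)
        omega
  have hpow (k : ℤ) (hk : k % 3 = 0) : ∃ v : 𝓞 K, ((η ^ k : (𝓞 K)ˣ) : 𝓞 K) = v ^ 3 := by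
    refine ⟨((η ^ (k / 3) : (𝓞 K)ˣ) : 𝓞 K), ?_⟩
    rw [← Units.val_pow_eq_pow_val, ← zpow_natCast, ← zpow_mul]
    congr 2
    push_cast
    omega
  have hcases : i % 3 = 0 ∨ j % 3 = 0 ∨ (i + j) % 3 = 0 ∨ (i + 2 * j) % 3 = 0 := by
    have hi : i % 3 = 0 ∨ i % 3 = 1 ∨ i % 3 = 2 := by omega
    have hj : j % 3 = 0 ∨ j % 3 = 1 ∨ j % 3 = 2 := by omega
    rcases hi with hi | hi | hi <;> rcases hj with hj | hj | hj <;> omega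
  rcases hcases with h | h | h | h
  · obtain ⟨v, hv⟩ := hpow i h
    exact hcontra (N := 2) (by norm_num) (v * g) (by rw [mul_pow, ← hv]; exact_mod_cast hg.symm)
  · obtain ⟨v, hv⟩ := hpow j h
    exact hcontra (N := 3) (by norm_num) (v * g') (by rw [mul_pow, ← hv]; exact_mod_cast hg'.symm)
  · obtain ⟨v, hv⟩ := hpow _ h
    refine hcontra (N := 6) (by norm_num) (v * g * g') ?_
    rw [mul_pow, mul_pow, ← hv, zpow_add]
    have : ((6 : ℕ) : 𝓞 K) = 2 * 3 := by norm_num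
    rw [this]
    push_cast
    linear_combination -3 * hg - ((η ^ i : (𝓞 K)ˣ) : 𝓞 K) * g ^ 3 * hg'
  · obtain ⟨v, hv⟩ := hpow _ h
    refine hcontra (N := 18) (by norm_num) (v * g * g' ^ 2) ?_
    have : ((18 : ℕ) : 𝓞 K) = 2 * 3 ^ 2 := by norm_num
    rw [this, mul_pow, mul_pow, ← hv, zpow_add, two_mul, zpow_add]
    push_cast
    linear_combination -9 * hg - ((η ^ i : (𝓞 K)ˣ) : 𝓞 K) * g ^ 3 *
      (3 + ((η ^ j : (𝓞 K)ˣ) : 𝓞 K) * g' ^ 3) * hg'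

theorem coprime_classNumber {ε : ℝ} (hε : IsFundamentalUnit P ε) {p : ℕ} (hp : p.Prime)
    (hpodd : Odd p) (hP : P = 2 * p ∨ P = p) : p.Coprime (Fintype.card (ClassGroup (𝓞 K))) := by
  rw [hp.coprime_iff_not_dvd]
  intro hdvd
  have hpos : 0 < Fintype.card (ClassGroup (𝓞 K)) := Fintype.card_pos
  have hle := Nat.le_of_dvd hpos hdvd
  have hp3 : 3 ≤ p := by
    have := hp.two_le
    rcases hpodd with ⟨k, hk⟩
    omega
  rcases lt_or_ge P 7 with h7 | h7
  · have hlt : Fintype.card (ClassGroup (𝓞 K)) < 3 := by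
      have hcases : P = 3 ∨ P = 5 ∨ P = 6 := by
        rcases hpodd with ⟨k, hk⟩
        omega
      rcases hcases with rfl | rfl | rfl
      · exact classNumber_lt_three_of_three S hε
      · exact classNumber_lt_three_of_five S hε
      · exact classNumber_lt_three_of_six S hε
    omega
  · have hlt : Fintype.card (ClassGroup (𝓞 K)) < P := S.classNumber_lt hε h7
    rcases hP with hP | hP
    · have hcard : Fintype.card (ClassGroup (𝓞 K)) = p := by
        obtain ⟨k, hk⟩ := hdvd
        rw [hk, hP, mul_comm 2 p] at hlt
        have hk2 := Nat.lt_of_mul_lt_mul_left hlt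
        have hk1 : k ≠ 0 := by
          rintro rfl
          omega
        rw [hk, show k = 1 by omega, mul_one]
      have hp5 : 5 ≤ p := by
        rcases hpodd with ⟨k, hk⟩
        omega
      refine S.not_coprime_three_classNumber hε hp hp5 hP ?_
      rw [hcard, Nat.coprime_primes Nat.prime_three hp]
      omega
    · omega

end PureCubic

end

theorem ZMod.eq_of_sq_add_sq_add_sq_eq {q : ℕ} [Fact q.Prime] (hq : q % 3 = 2) {u v w : ZMod q}
    (h : u ^ 2 + v ^ 2 + w ^ 2 - u * v - v * w - w * u = 0) : u = v ∧ v = w := by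
  have h1 : u - v = v - w := by
    refine ZMod.eq_of_pow_three_eq hq ?_
    linear_combination (u - 2 * v + w) * h
  have h3 : (3 : ZMod q) ≠ 0 := by
    intro h
    have : (q : ℤ) ∣ 3 := (ZMod.intCast_zmod_eq_zero_iff_dvd 3 q).1 (by exact_mod_cast h)
    have : q ∣ 3 := by exact_mod_cast this
    rcases (Nat.dvd_prime Nat.prime_three).1 this with rfl | rfl <;> omega
  have h4 : v - w = 0 := by
    have : 3 * (v - w) ^ 2 = 0 := by
      have hu : u = 2 * v - w := by linear_combination h1
      rw [hu] at h
      linear_combination h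
    exact pow_eq_zero_iff two_ne_zero |>.1 ((mul_eq_zero.1 this).resolve_left h3)
  exact ⟨by rw [h4] at h1; exact sub_eq_zero.1 h1, sub_eq_zero.1 h4⟩

theorem dvd_mul_cofactor {l : ℕ} (hl : l.Prime) (hl3 : l % 3 = 2) {Q a b c x y : ℤ}
    (h : (l : ℤ) = a ^ 3 + Q * b ^ 3 + Q ^ 2 * c ^ 3 - 3 * Q * a * b * c)
    (hxy : (l : ℤ) ∣ x ^ 3 + Q * y ^ 3) (hx : ¬ (l : ℤ) ∣ x) :
    (l : ℤ) ∣ x * (a ^ 2 - Q * b * c) + Q * y * (b ^ 2 - a * c) ∧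
    (l : ℤ) ∣ x * (Q * c ^ 2 - a * b) + y * (a ^ 2 - Q * b * c) ∧
    (l : ℤ) ∣ x * (b ^ 2 - a * c) + y * (Q * c ^ 2 - a * b) ∧
    ¬ (l : ℤ) ∣ y ^ 2 * (a ^ 2 - Q * b * c) - x * y * (Q * c ^ 2 - a * b) +
      x ^ 2 * (b ^ 2 - a * c) := by
  have : Fact l.Prime := ⟨hl⟩
  have hnorm : (l : ℤ) ^ 2 = (a ^ 2 - Q * b * c) ^ 3 + Q * (Q * c ^ 2 - a * b) ^ 3 +
      Q ^ 2 * (b ^ 2 - a * c) ^ 3 -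
      3 * Q * (a ^ 2 - Q * b * c) * (Q * c ^ 2 - a * b) * (b ^ 2 - a * c) := by
    rw [h]; ring
  have hndvd : ¬ ((l : ℤ) ∣ a ^ 2 - Q * b * c ∧ (l : ℤ) ∣ Q * c ^ 2 - a * b ∧
      (l : ℤ) ∣ b ^ 2 - a * c) := by
    rintro ⟨⟨a', ha⟩, ⟨b', hb⟩, ⟨c', hc⟩⟩
    rw [ha, hb, hc] at hnorm
    have hl0 : (l : ℤ) ≠ 0 := by exact_mod_cast hl.ne_zero
    have h1 : (1 : ℤ) = l * (a' ^ 3 + Q * b' ^ 3 + Q ^ 2 * c' ^ 3 - 3 * Q * a' * b' * c') := by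
      refine mul_left_cancel₀ (pow_ne_zero 2 hl0) ?_
      linear_combination hnorm
    have : (l : ℤ) ∣ 1 := ⟨_, h1⟩
    have : l ∣ 1 := by exact_mod_cast this
    exact hl.one_lt.ne' (Nat.dvd_one.1 this)
  simp only [← ZMod.intCast_zmod_eq_zero_iff_dvd] at hndvd hxy hx ⊢
  have h' : (l : ZMod l) = a ^ 3 + Q * b ^ 3 + Q ^ 2 * c ^ 3 - 3 * Q * a * b * c := by
    exact_mod_cast congrArg (Int.cast (R := ZMod l)) h
  rw [CharP.cast_eq_zero] at h'
  push_cast at hndvd hxy hx ⊢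
  generalize (a : ZMod l) = a at *
  generalize (b : ZMod l) = b at *
  generalize (c : ZMod l) = c at *
  generalize (x : ZMod l) = x at *
  generalize (y : ZMod l) = y at *
  generalize (Q : ZMod l) = Q at *
  have hy : y ≠ 0 := by
    rintro rfl
    exact hx (pow_eq_zero_iff three_ne_zero |>.1 (by simpa using hxy))
  obtain ⟨r, rfl⟩ : ∃ r, x = -r * y := ⟨-x / y, by field_simp⟩
  have hr : r ≠ 0 := by
    rintro rfl
    simp at hx
  obtain rfl : Q = r ^ 3 := by
    refine mul_left_cancel₀ (pow_ne_zero 3 hy) ?_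
    linear_combination hxy
  have hfac : (a + b * r + c * r ^ 2) * (a ^ 2 + (b * r) ^ 2 + (c * r ^ 2) ^ 2 - a * (b * r) -
      b * r * (c * r ^ 2) - c * r ^ 2 * a) = 0 := by
    linear_combination -h'
  have hlin : a + b * r + c * r ^ 2 = 0 := by
    refine (mul_eq_zero.1 hfac).resolve_right fun h0 => ?_
    obtain ⟨h1, h2⟩ := ZMod.eq_of_sq_add_sq_add_sq_eq hl3 h0
    have hb : b = c * r := by
      refine mul_right_cancel₀ hr ?_
      linear_combination h2
    rw [hb] at h1
    refine hndvd ⟨?_, ?_, ?_⟩ <;> rw [h1, hb] <;> ring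
  have ha : a = -(b * r) - c * r ^ 2 := by linear_combination hlin
  rw [ha] at hndvd ⊢
  refine ⟨by ring, by ring, by ring, fun h0 => ?_⟩
  have h1 : 3 * (y ^ 2 * r ^ 2 * (b ^ 2 - (-(b * r) - c * r ^ 2) * c)) = 0 := by
    linear_combination h0
  have h3 : (3 : ZMod l) ≠ 0 := by
    intro h
    have : (l : ℤ) ∣ 3 := (ZMod.intCast_zmod_eq_zero_iff_dvd 3 l).1 (by exact_mod_cast h)
    have : l ∣ 3 := by exact_mod_cast this
    rcases (Nat.dvd_prime Nat.prime_three).1 this with rfl | rfl <;> omega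
  have h2 : b ^ 2 - (-(b * r) - c * r ^ 2) * c = 0 := by
    simpa [h3, hy, hr] using h1
  exact hndvd ⟨by linear_combination r ^ 2 * h2, by linear_combination r * h2, h2⟩

theorem isCoprime_of_cube_add {P ι l m n : ℕ} (hsq : Squarefree P) (h9 : P % 9 ≠ 1 ∧ P % 9 ≠ 8)
    (hι : ι = 1 ∨ ι = 2) (hl : l.Prime) (hl3 : l % 3 = 2) (hlP : ¬ l ∣ P) (hm : 0 < m)
    (hn : 3 ≤ n) {x y z : ℤ} (hgcd : Int.gcd x (Int.gcd y z) = 1)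
    (h : x ^ 3 + (P : ℤ) ^ ι * y ^ 3 = (l : ℤ) ^ m * z ^ n)
    (hlxy : ¬ ((l : ℤ) ∣ x ∧ (l : ℤ) ∣ y)) :
    ¬ (l : ℤ) ∣ x ∧ IsCoprime (3 * x * y * (P : ℤ) ^ ι) ((l : ℤ) ^ m * z ^ n) := by
  have hlp : Prime (l : ℤ) := Nat.prime_iff_prime_int.1 hl
  have hlPi : ¬ (l : ℤ) ∣ (P : ℤ) ^ ι := fun h0 =>
    hlP (Int.natCast_dvd_natCast.1 (hlp.dvd_of_dvd_pow h0))
  have hldvd : (l : ℤ) ∣ (l : ℤ) ^ m * z ^ n := (dvd_pow_self _ hm.ne').mul_right _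
  have hlx : ¬ (l : ℤ) ∣ x := fun hx => by
    refine hlxy ⟨hx, ?_⟩
    rw [← h] at hldvd
    have := (Int.dvd_add_right (hx.trans (dvd_pow_self x three_ne_zero))).1 hldvd
    exact hlp.dvd_of_dvd_pow ((hlp.dvd_or_dvd this).resolve_left hlPi)
  have hly : ¬ (l : ℤ) ∣ y := fun hy => by
    refine hlx ?_
    rw [← h] at hldvd
    have := (Int.dvd_add_left ((hy.trans (dvd_pow_self y three_ne_zero)).mul_left _)).1 hldvd
    exact hlp.dvd_of_dvd_pow this
  have hl3' : ¬ (l : ℤ) ∣ 3 := fun h0 => by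
    have : l ∣ 3 := by exact_mod_cast h0
    rcases (Nat.dvd_prime Nat.prime_three).1 this with rfl | rfl <;> omega
  refine ⟨hlx, ?_⟩
  rw [Int.isCoprime_iff_gcd_eq_one]
  by_contra hne
  obtain ⟨q, hq, hqd⟩ := Nat.exists_prime_and_dvd hne
  have hqp : Prime (q : ℤ) := Nat.prime_iff_prime_int.1 hq
  have hqd' := Int.natCast_dvd_natCast.2 hqd
  have hq1 : (q : ℤ) ∣ 3 * x * y * (P : ℤ) ^ ι := hqd'.trans (Int.gcd_dvd_left _ _)
  have hq2 : (q : ℤ) ∣ (l : ℤ) ^ m * z ^ n := hqd'.trans (Int.gcd_dvd_right _ _)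
  have hql : q ≠ l := by
    rintro rfl
    rcases hqp.dvd_or_dvd hq1 with h1 | h1
    · rcases hqp.dvd_or_dvd h1 with h1 | h1
      · rcases hqp.dvd_or_dvd h1 with h1 | h1
        · exact hl3' h1
        · exact hlx h1
      · exact hly h1
    · exact hlPi h1
  have hqz : (q : ℤ) ∣ z := by
    rcases hqp.dvd_or_dvd hq2 with h1 | h1
    · have := Int.natCast_dvd_natCast.1 (hqp.dvd_of_dvd_pow h1)
      exact absurd ((Nat.prime_dvd_prime_iff_eq hq hl).1 this) hql
    · exact hqp.dvd_of_dvd_pow h1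
  have hqxy : ¬ ((q : ℤ) ∣ x ∧ (q : ℤ) ∣ y) := by
    rintro ⟨h1, h2⟩
    have h3 : (q : ℤ) ∣ (Int.gcd x (Int.gcd y z) : ℤ) :=
      Int.dvd_coe_gcd h1 (Int.dvd_coe_gcd h2 hqz)
    rw [hgcd] at h3
    exact hqp.not_isUnit (isUnit_of_dvd_one h3)
  have hq3 : (q : ℤ) ^ 3 ∣ x ^ 3 + (P : ℤ) ^ ι * y ^ 3 := by
    rw [h]
    exact ((pow_dvd_pow _ hn).trans (pow_dvd_pow_of_dvd hqz n)).mul_left _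
  have hqq : (q : ℤ) ∣ x ^ 3 + (P : ℤ) ^ ι * y ^ 3 := (dvd_pow_self _ three_ne_zero).trans hq3
  have hqy : ¬ (q : ℤ) ∣ y := fun hy => by
    have := (Int.dvd_add_left ((hy.trans (dvd_pow_self y three_ne_zero)).mul_left _)).1 hqq
    exact hqxy ⟨hqp.dvd_of_dvd_pow this, hy⟩
  have hqx_iff : (q : ℤ) ∣ x → (q : ℤ) ∣ (P : ℤ) ^ ι := fun hx => by
    have := (Int.dvd_add_right (hx.trans (dvd_pow_self x three_ne_zero))).1 hqq
    exact (hqp.dvd_or_dvd this).resolve_right fun h0 => hqy (hqp.dvd_of_dvd_pow h0)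
  have hqP : ¬ (q : ℤ) ∣ (P : ℤ) ^ ι := fun hqP => by
    have hx : (q : ℤ) ∣ x :=
      hqp.dvd_of_dvd_pow ((Int.dvd_add_left (hqP.mul_right _)).1 hqq)
    have h1 : (q : ℤ) ^ 3 ∣ (P : ℤ) ^ ι * y ^ 3 :=
      (Int.dvd_add_right (pow_dvd_pow_of_dvd hx 3)).1 hq3
    have hcop : IsCoprime ((q : ℤ) ^ 3) (y ^ 3) := ((hqp.coprime_iff_not_dvd).2 hqy).pow
    have h2 : q ^ 3 ∣ P ^ ι := by exact_mod_cast hcop.dvd_of_dvd_mul_right h1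
    obtain ⟨P', hP'⟩ : q ∣ P := Int.natCast_dvd_natCast.1 (hqp.dvd_of_dvd_pow hqP)
    have hqP' : ¬ q ∣ P' := by
      rintro ⟨w, rfl⟩
      exact hq.one_lt.ne' (Nat.isUnit_iff.1 (hsq q ⟨w, by rw [hP']; ring⟩))
    have h3 : q ∣ P' ^ 2 := by
      rcases hι with rfl | rfl
      · refine (Nat.dvd_of_mul_dvd_mul_left hq.pos ?_).trans (dvd_pow_self P' two_ne_zero)
        rw [← hP']
        rw [pow_one] at h2
        exact (Dvd.intro q (by ring : q * q * q = q ^ 3)).trans h2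
      · refine Nat.dvd_of_mul_dvd_mul_left (pow_pos hq.pos 2) ?_
        rw [← mul_pow, ← hP']
        rwa [← pow_succ]
    exact hqP' (hq.dvd_of_dvd_pow h3)
  have hq3' : q = 3 := by
    rcases hqp.dvd_or_dvd hq1 with h1 | h1
    · rcases hqp.dvd_or_dvd h1 with h1 | h1
      · rcases hqp.dvd_or_dvd h1 with h1 | h1
        · exact (Nat.prime_dvd_prime_iff_eq hq Nat.prime_three).1 (by exact_mod_cast h1)
        · exact absurd (hqx_iff h1) hqP
      · exact absurd h1 hqy
    · exact absurd h1 hqP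
  subst hq3'
  have h9dvd : ((9 : ℕ) : ℤ) ∣ x ^ 3 + (P : ℤ) ^ ι * y ^ 3 :=
    (by norm_num : ((9 : ℕ) : ℤ) ∣ _).trans hq3
  have h9z := (ZMod.intCast_zmod_eq_zero_iff_dvd _ 9).2 h9dvd
  push_cast at h9z
  have key : ∀ u v w : ZMod 9, w ≠ 1 → w ≠ 8 → (u ^ 3 + w * v ^ 3 = 0 ∨ u ^ 3 + w ^ 2 * v ^ 3 = 0) →
      3 * w = 0 ∨ 3 * v = 0 := by decide
  have hP1 : (P : ZMod 9) ≠ 1 := by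
    rw [← Nat.cast_one, Ne, ZMod.natCast_eq_natCast_iff']
    omega
  have hP8 : (P : ZMod 9) ≠ 8 := by
    rw [show (8 : ZMod 9) = (8 : ℕ) from rfl, Ne, ZMod.natCast_eq_natCast_iff']
    omega
  have h3cases := key x y P hP1 hP8 (by
    rcases hι with rfl | rfl
    · exact Or.inl (by simpa using h9z)
    · exact Or.inr h9z)
  rcases h3cases with h0 | h0
  · have : ((9 : ℕ) : ℤ) ∣ 3 * P := by
      rw [← ZMod.intCast_zmod_eq_zero_iff_dvd]
      push_cast
      exact h0
    have hP3 : ((3 : ℕ) : ℤ) ∣ P := by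
      push_cast at this ⊢
      omega
    exact hqP (hP3.trans (dvd_pow_self _ (by omega)))
  · have : ((9 : ℕ) : ℤ) ∣ 3 * y := by
      rw [← ZMod.intCast_zmod_eq_zero_iff_dvd]
      push_cast
      exact h0
    refine hqy ?_
    push_cast at this ⊢
    omega

section

open NumberField

theorem exists_eq_pow_mul_of_mul_eq {R : Type*} [CommRing R] [IsDomain R] {A A' w w' z : R}
    {m n : ℕ} (hA : A * A' = (w * w') ^ m * z ^ n) (hw0 : w * w' ≠ 0) (hcop : IsCoprime A A')
    (hcop' : IsCoprime A w') (hdvd : w ∣ A) :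
    ∃ B B' : R, A = w ^ m * B ∧ B * B' = z ^ n ∧ IsCoprime B B' := by
  have h1 : w ^ m ∣ A := by
    refine ((hcop.of_isCoprime_of_dvd_left hdvd).pow_left (m := m)).dvd_of_dvd_mul_right ?_
    rw [hA, mul_pow, mul_assoc]
    exact dvd_mul_right _ _
  have h2 : w' ^ m ∣ A' := by
    refine (hcop'.symm.pow_left (m := m)).dvd_of_dvd_mul_left ?_
    rw [hA, mul_pow, mul_comm (w ^ m), mul_assoc]
    exact dvd_mul_right _ _
  obtain ⟨B, rfl⟩ := h1
  obtain ⟨B', rfl⟩ := h2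
  refine ⟨B, B', rfl, ?_, hcop.of_mul_left_right.of_mul_right_right⟩
  refine mul_left_cancel₀ (pow_ne_zero m hw0) ?_
  rw [← hA]
  ring

theorem isCoprime_add_of_isCoprime {R : Type*} [CommRing R] {θ x y Q : R} (hθ : θ ^ 3 = Q)
    (h : IsCoprime (3 * x * y * Q) (x ^ 3 + Q * y ^ 3)) :
    IsCoprime (x + y * θ) (x ^ 2 - x * y * θ + y ^ 2 * θ ^ 2) := by
  obtain ⟨u, v, huv⟩ := h
  rw [← hθ] at huv
  exact ⟨u * (x + y * θ) * θ ^ 2 + v * (x ^ 2 - x * y * θ + y ^ 2 * θ ^ 2), -u * θ ^ 2, by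
    linear_combination huv⟩

namespace PureCubic

variable {P : ℕ} {K : Type*} [Field K] [NumberField K] (S : PureCubic P K)

include S

theorem descent {η : (𝓞 K)ˣ} (hη : ∀ u : (𝓞 K)ˣ, ∃ k : ℤ, u = η ^ k ∨ u = -η ^ k) {ι l m n : ℕ}
    (hι : ι = 1 ∨ ι = 2) (hl : l.Prime) (hl3 : l % 3 = 2) (hlP : ¬ l ∣ P) (hm : 0 < m)
    (hn : 3 ≤ n) (hnodd : Odd n) (hcop : n.Coprime (Fintype.card (ClassGroup (𝓞 K)))) {a b c : ℤ}
    (habc : (l : ℤ) = a ^ 3 + (P : ℤ) ^ ι * b ^ 3 + (P : ℤ) ^ (2 * ι) * c ^ 3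
      - 3 * (P : ℤ) ^ ι * a * b * c) {x y z : ℤ} (hgcd : Int.gcd x (Int.gcd y z) = 1)
    (h : x ^ 3 + (P : ℤ) ^ ι * y ^ 3 = (l : ℤ) ^ m * z ^ n)
    (hlxy : ¬ ((l : ℤ) ∣ x ∧ (l : ℤ) ∣ y)) :
    ∃ (k : ℕ) (g : 𝓞 K), (x : 𝓞 K) + y * S.rootInt ^ ι =
      (η : 𝓞 K) ^ k * (a + b * S.rootInt ^ ι + c * (S.rootInt ^ ι) ^ 2) ^ m * g ^ n := by
  obtain ⟨hlx, hcopxy⟩ := isCoprime_of_cube_add S.sqfree S.mod9 hι hl hl3 hlP hm hn hgcd h hlxy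
  rw [← h] at hcopxy
  set Q : ℤ := (P : ℤ) ^ ι with hQ
  set θ : 𝓞 K := S.rootInt ^ ι with hθdef
  have hθ : θ ^ 3 = (Q : 𝓞 K) := by
    rw [hθdef, ← pow_mul, mul_comm, pow_mul, S.rootInt_cube, hQ]
    push_cast
    rfl
  rw [mul_comm 2 ι, pow_mul, ← hQ] at habc
  have hldvd : (l : ℤ) ∣ x ^ 3 + Q * y ^ 3 := by
    rw [h]
    exact (dvd_pow_self _ hm.ne').mul_right _
  obtain ⟨⟨d, hd⟩, ⟨e, he⟩, ⟨f, hf⟩, hndvd⟩ := dvd_mul_cofactor hl hl3 habc hldvd hlx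
  have habc' : (l : 𝓞 K) = a ^ 3 + Q * b ^ 3 + Q ^ 2 * c ^ 3 - 3 * Q * a * b * c := by
    exact_mod_cast congrArg (Int.cast (R := 𝓞 K)) habc
  have hd' : (x : 𝓞 K) * (a ^ 2 - Q * b * c) + Q * y * (b ^ 2 - a * c) = l * d := by
    exact_mod_cast congrArg (Int.cast (R := 𝓞 K)) hd
  have he' : (x : 𝓞 K) * (Q * c ^ 2 - a * b) + y * (a ^ 2 - Q * b * c) = l * e := by
    exact_mod_cast congrArg (Int.cast (R := 𝓞 K)) he
  have hf' : (x : 𝓞 K) * (b ^ 2 - a * c) + y * (Q * c ^ 2 - a * b) = l * f := by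
    exact_mod_cast congrArg (Int.cast (R := 𝓞 K)) hf
  have h' : (x : 𝓞 K) ^ 3 + Q * y ^ 3 = l ^ m * z ^ n := by
    exact_mod_cast congrArg (Int.cast (R := 𝓞 K)) h
  set w : 𝓞 K := a + b * θ + c * θ ^ 2 with hw
  set w' : 𝓞 K := (a ^ 2 - Q * b * c) + (Q * c ^ 2 - a * b) * θ + (b ^ 2 - a * c) * θ ^ 2 with hw'
  have hww : w * w' = l := by
    rw [habc', hw, hw']
    linear_combination (((a : 𝓞 K) * b * c * (-1) + Q * c ^ 3 + b ^ 3 - a * b * c) +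
      (b ^ 2 * c - a * c ^ 2) * θ) * hθ
  have hl0 : (l : 𝓞 K) ≠ 0 := by exact_mod_cast hl.ne_zero
  have hcopA : IsCoprime ((x : 𝓞 K) + y * θ) (x ^ 2 - x * y * θ + y ^ 2 * θ ^ 2) := by
    refine isCoprime_add_of_isCoprime hθ ?_
    exact_mod_cast isCoprime_intCast (K := K) hcopxy
  have hwA : w ∣ (x : 𝓞 K) + y * θ := by
    have hw'0 : w' ≠ 0 := right_ne_zero_of_mul (hww ▸ hl0)
    refine ⟨d + e * θ + f * θ ^ 2, mul_right_cancel₀ hw'0 ?_⟩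
    rw [mul_right_comm, hww, hw']
    linear_combination hd' + θ * he' + θ ^ 2 * hf' + (y : 𝓞 K) * (b ^ 2 - a * c) * hθ
  have hcopw' : IsCoprime ((x : 𝓞 K) + y * θ) w' := by
    have hcopl : IsCoprime (l : ℤ) (y ^ 2 * (a ^ 2 - Q * b * c) - x * y * (Q * c ^ 2 - a * b) +
        x ^ 2 * (b ^ 2 - a * c)) :=
      (Nat.prime_iff_prime_int.1 hl).coprime_iff_not_dvd.2 hndvd
    obtain ⟨u, v, huv⟩ := isCoprime_intCast (K := K) hcopl
    push_cast at huv
    refine ⟨-v * (y * (Q * c ^ 2 - a * b) + (b ^ 2 - a * c) * (y * θ - x)), u * w + v * y ^ 2, ?_⟩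
    rw [← huv, ← hww, hw']
    ring
  obtain ⟨B, B', hB, hBB, hcopB⟩ := exists_eq_pow_mul_of_mul_eq (m := m) (n := n) (z := (z : 𝓞 K))
    (w := w) (w' := w') (by rw [hww, ← h', ← hθ]; ring) (by rw [hww]; exact hl0) hcopA hcopw' hwA
  have hB0 : B ≠ 0 := by
    rintro rfl
    rw [mul_zero] at hB
    have h1 : (x : 𝓞 K) ^ 3 + Q * y ^ 3 = 0 := by
      rw [← hθ]
      linear_combination (x ^ 2 - x * y * θ + y ^ 2 * θ ^ 2) * hB
    have h2 : x ^ 3 + Q * y ^ 3 = 0 := by exact_mod_cast h1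
    rw [h2, isCoprime_zero_right, mul_assoc, mul_assoc] at hcopxy
    have := Int.isUnit_iff.1 (isUnit_of_mul_isUnit_left hcopxy)
    omega
  obtain ⟨I, hI⟩ := Ideal.exists_eq_pow_of_mul_eq_pow hcopB hBB
  obtain ⟨u, g, hg⟩ := Ideal.exists_span_singleton_of_pow_eq hcop (by omega) hB0 hI
  obtain ⟨k, hk⟩ := hη u
  obtain ⟨g', hg'⟩ : ∃ g' : 𝓞 K, B = ((η ^ k : (𝓞 K)ˣ) : 𝓞 K) * g' ^ n := by
    rcases hk with rfl | rfl
    · exact ⟨g, hg⟩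
    · exact ⟨-g, by rw [hg, hnodd.neg_pow]; push_cast; ring⟩
  have hn0 : (n : ℤ) ≠ 0 := by omega
  refine ⟨(k % n).toNat, ((η ^ (k / n) : (𝓞 K)ˣ) : 𝓞 K) * g', ?_⟩
  have hηk : ((η ^ k : (𝓞 K)ˣ) : 𝓞 K) = (η : 𝓞 K) ^ (k % n).toNat *
      ((η ^ (k / n) : (𝓞 K)ˣ) : 𝓞 K) ^ n := by
    rw [← Units.val_pow_eq_pow_val, ← Units.val_pow_eq_pow_val, ← Units.val_mul, ← zpow_natCast,
      ← zpow_natCast, ← zpow_mul, ← zpow_add, Int.toNat_of_nonneg (Int.emod_nonneg k hn0)]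
    congr 2
    rw [mul_comm, Int.emod_add_mul_ediv]
  rw [hB, hg', hηk]
  ring

end PureCubic

end

theorem sq_mul_truncated_pow {R : Type*} [CommRing R] {s t u v w E : R} (hss : s * s = E * t)
    (hst : s * t = 0) (htt : t * t = 0) (k : ℕ) :
    u ^ 2 * (u + v * s + w * t) ^ k =
      u ^ k * (u ^ 2 + k * u * v * s + (k * u * w + k.choose 2 * E * v ^ 2) * t) := by
  induction k with
  | zero => simp
  | succ k ih =>
    rw [pow_succ (u + v * s + w * t), ← mul_assoc, ih, Nat.choose_succ_succ' k 1,
      Nat.choose_one_right]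
    push_cast
    linear_combination u ^ k * (k * u * v ^ 2 * hss + (k * u * v * w + (k * u * w +
      k.choose 2 * E * v ^ 2) * v) * hst + (k * u * w + k.choose 2 * E * v ^ 2) * w * htt)

theorem sq_mul_truncated_mul {R : Type*} [CommRing R] {s t u v w a b c E : R} (hss : s * s = E * t)
    (hst : s * t = 0) (htt : t * t = 0) (hbt : b * t = 0) (k m : ℕ) :
    u ^ 2 * a ^ 2 * ((u + v * s + w * t) ^ k * (a + b * s + c * t) ^ m) =
      u ^ k * a ^ m * (u ^ 2 * a ^ 2 + (k * u * v * a ^ 2 + m * u ^ 2 * a * b) * s +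
        a * (a * (k * u * w + k.choose 2 * E * v ^ 2) + u ^ 2 * m * c) * t) := by
  have h1 := sq_mul_truncated_pow (u := u) (v := v) (w := w) hss hst htt k
  have h2 := sq_mul_truncated_pow (u := a) (v := b) (w := c) hss hst htt m
  calc _ = (u ^ 2 * (u + v * s + w * t) ^ k) * (a ^ 2 * (a + b * s + c * t) ^ m) := by ring
    _ = _ := by
      rw [h1, h2]
      linear_combination u ^ k * a ^ m * ((k * u * v * m * a * b) * hss +
        (k * u * v * (m * a * c + m.choose 2 * E * b ^ 2) +
          (k * u * w + k.choose 2 * E * v ^ 2) * (m * a * b)) * hst +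
        ((k * u * w + k.choose 2 * E * v ^ 2) * (m * a * c + m.choose 2 * E * b ^ 2)) * htt +
        (k * u * v * m * a * E + u ^ 2 * m.choose 2 * E * b) * hbt)

namespace PureCubic

open NumberField

variable {P : ℕ} {K : Type*} [Field K] [NumberField K] (S : PureCubic P K)

include S

theorem dvd_coords {N u v w : ℤ} (h : (N : 𝓞 K) ∣ u + v * S.rootInt + w * S.rootInt ^ 2) :
    N ∣ u ∧ N ∣ v ∧ N ∣ w := by
  obtain ⟨q, hq⟩ := h
  obtain ⟨d, e, f, rfl⟩ := S.exists_coords_int q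
  obtain ⟨h1, h2, h3⟩ := S.coords_int_ext (a := u) (b := v) (c := w) (a' := N * d) (b' := N * e)
    (c' := N * f) (by rw [hq]; push_cast; ring)
  exact ⟨⟨d, h1⟩, ⟨e, h2⟩, ⟨f, h3⟩⟩

theorem exists_dvd_pow_prime_pow_sub {p : ℕ} (hp : p.Prime) (hp3 : 3 ≤ p) (hpP : p ∣ P)
    (g : 𝓞 K) (i : ℕ) : ∃ d : ℤ, (((p : ℤ) ^ (i + 1) : ℤ) : 𝓞 K) ∣ g ^ p ^ (i + 1) - d := by
  obtain ⟨d, e, f, rfl⟩ := S.exists_coords_int g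
  have h1 : (p : 𝓞 K) ∣ (d + e * S.rootInt + f * S.rootInt ^ 2) ^ p - (d ^ p : ℤ) := by
    obtain ⟨r, hr⟩ := exists_add_pow_prime_eq hp (d : 𝓞 K) (S.rootInt * (e + f * S.rootInt))
    have h2 : (p : 𝓞 K) ∣ (S.rootInt * (e + f * S.rootInt)) ^ p := by
      obtain ⟨q, hq⟩ := Nat.exists_eq_add_of_le hp3
      rw [mul_pow, show S.rootInt ^ p = S.rootInt ^ 3 * S.rootInt ^ q by rw [hq, pow_add],
        S.rootInt_cube, mul_assoc]
      exact (Nat.cast_dvd_cast (α := 𝓞 K) hpP).mul_right _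
    rw [show (d : 𝓞 K) + e * S.rootInt + f * S.rootInt ^ 2 =
      d + S.rootInt * (e + f * S.rootInt) by ring, hr]
    push_cast
    rw [show ∀ A B C : 𝓞 K, A + B + C - A = B + C by intros; ring]
    exact dvd_add h2 (by rw [mul_assoc, mul_assoc]; exact dvd_mul_right _ _)
  refine ⟨(d ^ p) ^ p ^ i, ?_⟩
  have := dvd_sub_pow_of_dvd_sub h1 i
  rw [← pow_mul, ← pow_succ'] at this
  push_cast at this ⊢
  exact this

end PureCubic

theorem dvd_truncated_mul_sub {R : Type*} [CommRing R] {N s t u v w a b c E G d : R}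
    (hss : N ∣ s * s - E * t) (hst : N ∣ s * t) (htt : N ∣ t * t) (hbt : N ∣ b * t)
    (hG : N ∣ G - d) (k m : ℕ) :
    N ∣ u ^ 2 * a ^ 2 * ((u + v * s + w * t) ^ k * (a + b * s + c * t) ^ m * G) -
      d * (u ^ k * a ^ m * (u ^ 2 * a ^ 2 + (k * u * v * a ^ 2 + m * u ^ 2 * a * b) * s +
        a * (a * (k * u * w + k.choose 2 * E * v ^ 2) + u ^ 2 * m * c) * t)) := by
  have hmk (z : R) : N ∣ z ↔ Ideal.Quotient.mk (Ideal.span {N}) z = 0 := by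
    rw [Ideal.Quotient.eq_zero_iff_mem, Ideal.mem_span_singleton]
  simp only [hmk, map_sub, map_mul, map_add, map_pow, map_natCast] at *
  rw [sub_eq_zero] at hss hG ⊢
  rw [← sq_mul_truncated_mul hss hst htt hbt, hG]
  ring

theorem Prime.not_dvd_sq_mul_sq_mul {q u a x : ℤ} (hq : Prime q) (hu : ¬ q ∣ u) (ha : ¬ q ∣ a)
    (hx : ¬ q ∣ x) : ¬ q ∣ u ^ 2 * a ^ 2 * x := by
  simp [hq.dvd_mul, hq.dvd_pow_iff_dvd two_ne_zero, hu, ha, hx]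

theorem Prime.dvd_of_dvd_mul_pow_mul {q d u a X : ℤ} (hq : Prime q) (hd : ¬ q ∣ d) (hu : ¬ q ∣ u)
    (ha : ¬ q ∣ a) {k m : ℕ} (h : q ∣ d * (u ^ k * a ^ m * (a * X))) : q ∣ X := by
  have h1 := (hq.dvd_or_dvd h).resolve_left hd
  rcases hq.dvd_or_dvd h1 with h1 | h1
  · rcases hq.dvd_or_dvd h1 with h1 | h1
    · exact absurd (hq.dvd_of_dvd_pow h1) hu
    · exact absurd (hq.dvd_of_dvd_pow h1) ha
  · exact (hq.dvd_or_dvd h1).resolve_left ha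

namespace PureCubic

open NumberField

variable {P : ℕ} {K : Type*} [Field K] [NumberField K] (S : PureCubic P K)

include S

theorem dvd_of_eq_mul_pow_one {p : ℕ} (hp : p.Prime) (hp3 : 3 ≤ p) (hpP : p ∣ P)
    {α β γ a b c x y : ℤ} (hα : ¬ (p : ℤ) ∣ α) (ha : ¬ (p : ℤ) ∣ a) (hx : ¬ (p : ℤ) ∣ x)
    (hb : (p : ℤ) ∣ b) {k m : ℕ} {g : 𝓞 K}
    (h : (x : 𝓞 K) + y * S.rootInt = (α + β * S.rootInt + γ * S.rootInt ^ 2) ^ k *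
      (a + b * S.rootInt + c * S.rootInt ^ 2) ^ m * g ^ p) :
    (p : ℤ) ∣ a * (k * α * γ + k.choose 2 * β ^ 2) + α ^ 2 * m * c := by
  have hpp : Prime (p : ℤ) := Nat.prime_iff_prime_int.1 hp
  obtain ⟨d, hd⟩ := S.exists_dvd_pow_prime_pow_sub hp hp3 hpP g 0
  have hcube := S.rootInt_cube
  have hpP' : ((((p : ℤ) ^ (0 + 1) : ℤ)) : 𝓞 K) ∣ (P : 𝓞 K) := by
    simpa using Nat.cast_dvd_cast (α := 𝓞 K) hpP
  have hb' : ((((p : ℤ) ^ (0 + 1) : ℤ)) : 𝓞 K) ∣ (b : 𝓞 K) := by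
    simpa using Int.cast_dvd_cast (α := 𝓞 K) _ _ hb
  have key := dvd_truncated_mul_sub (N := ((((p : ℤ) ^ (0 + 1) : ℤ)) : 𝓞 K)) (s := S.rootInt)
    (t := S.rootInt ^ 2) (E := 1) (u := (α : 𝓞 K)) (v := (β : 𝓞 K)) (w := (γ : 𝓞 K))
    (a := (a : 𝓞 K)) (b := (b : 𝓞 K)) (c := (c : 𝓞 K)) (by simp [← sq])
    (by rw [← pow_succ', hcube]; exact hpP')
    (by rw [show S.rootInt ^ 2 * S.rootInt ^ 2 = S.rootInt ^ 3 * S.rootInt by ring, hcube]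
        exact hpP'.mul_right _) (hb'.mul_right _) hd k m
  rw [zero_add, pow_one p, ← h] at key
  obtain ⟨h0, -, h2⟩ := S.dvd_coords (N := (p : ℤ) ^ 1)
    (u := α ^ 2 * a ^ 2 * x - d * (α ^ k * a ^ m * (α ^ 2 * a ^ 2)))
    (v := α ^ 2 * a ^ 2 * y - d * (α ^ k * a ^ m * (k * α * β * a ^ 2 + m * α ^ 2 * a * b)))
    (w := -(d * (α ^ k * a ^ m * (a * (a * (k * α * γ + k.choose 2 * β ^ 2) + α ^ 2 * m * c)))))
    (by convert key using 1; push_cast; ring)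
  rw [pow_one] at h0 h2
  have hd0 : ¬ (p : ℤ) ∣ d := by
    intro hd0
    have h3 := dvd_add h0 (hd0.mul_right (α ^ k * a ^ m * (α ^ 2 * a ^ 2)))
    rw [sub_add_cancel] at h3
    exact hpp.not_dvd_sq_mul_sq_mul hα ha hx h3
  exact hpp.dvd_of_dvd_mul_pow_mul hd0 hα ha ((dvd_neg).1 h2)

theorem dvd_of_eq_mul_pow_two {p : ℕ} (hp : p.Prime) (hp3 : 3 ≤ p) {P' : ℕ} (hP' : P = p * P')
    {α β γ a b c x y : ℤ} (hα : ¬ (p : ℤ) ∣ α) (ha : ¬ (p : ℤ) ∣ a) (hx : ¬ (p : ℤ) ∣ x)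
    (hb : (p : ℤ) ∣ b) {k m : ℕ} {g : 𝓞 K}
    (h : (x : 𝓞 K) + y * S.rootInt ^ 2 = (α + (p * β : ℤ) * S.rootInt + γ * S.rootInt ^ 2) ^ k *
      (a + b * S.rootInt ^ 2 + c * (S.rootInt ^ 2) ^ 2) ^ m * g ^ p ^ 2) :
    (p : ℤ) ∣ a * (k * α * β + k.choose 2 * P' * γ ^ 2) + α ^ 2 * m * (c * P') := by
  have hpp : Prime (p : ℤ) := Nat.prime_iff_prime_int.1 hp
  obtain ⟨d, hd⟩ := S.exists_dvd_pow_prime_pow_sub hp hp3 ⟨P', hP'⟩ g 1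
  have hcube : S.rootInt ^ 3 = (p : 𝓞 K) * P' := by
    rw [S.rootInt_cube, hP']
    push_cast
    rfl
  obtain ⟨b', hb'⟩ := hb
  have hN : ((((p : ℤ) ^ (1 + 1) : ℤ)) : 𝓞 K) = p ^ 2 := by push_cast; ring
  rw [hN] at hd
  have key := dvd_truncated_mul_sub (N := (p : 𝓞 K) ^ 2) (s := S.rootInt ^ 2)
    (t := p * S.rootInt) (E := P') (u := (α : 𝓞 K)) (v := (γ : 𝓞 K)) (w := (β : 𝓞 K))
    (a := (a : 𝓞 K)) (b := (b : 𝓞 K)) (c := (c * P' : 𝓞 K))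
    ⟨0, by linear_combination S.rootInt * hcube⟩
    ⟨P', by linear_combination (p : 𝓞 K) * hcube⟩
    ⟨S.rootInt ^ 2, by ring⟩
    ⟨b' * S.rootInt, by rw [hb']; push_cast; ring⟩ hd k m
  have hw : (α + (p * β : ℤ) * S.rootInt + γ * S.rootInt ^ 2 : 𝓞 K) =
      α + γ * S.rootInt ^ 2 + β * (p * S.rootInt) := by
    push_cast
    ring
  have hw' : (a + b * S.rootInt ^ 2 + c * (S.rootInt ^ 2) ^ 2 : 𝓞 K) =
      a + b * S.rootInt ^ 2 + c * P' * (p * S.rootInt) := by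
    linear_combination c * S.rootInt * hcube
  rw [← hw, ← hw', ← h] at key
  obtain ⟨h0, h1, -⟩ := S.dvd_coords (N := (p : ℤ) ^ 2)
    (u := α ^ 2 * a ^ 2 * x - d * (α ^ k * a ^ m * (α ^ 2 * a ^ 2)))
    (v := p * -(d * (α ^ k * a ^ m * (a * (a * (k * α * β + k.choose 2 * P' * γ ^ 2) +
      α ^ 2 * m * (c * P'))))))
    (w := α ^ 2 * a ^ 2 * y - d * (α ^ k * a ^ m * (k * α * γ * a ^ 2 + m * α ^ 2 * a * b)))
    (by convert key using 1; push_cast; ring)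
  have hd0 : ¬ (p : ℤ) ∣ d := by
    intro hd0
    have h3 := dvd_add ((dvd_pow_self _ two_ne_zero).trans h0)
      (hd0.mul_right (α ^ k * a ^ m * (α ^ 2 * a ^ 2)))
    rw [sub_add_cancel] at h3
    exact hpp.not_dvd_sq_mul_sq_mul hα ha hx h3
  rw [sq] at h1
  exact hpp.dvd_of_dvd_mul_pow_mul hd0 hα ha
    ((dvd_neg).1 (Int.dvd_of_mul_dvd_mul_left hpp.ne_zero h1))

end PureCubic

theorem two_mul_sum_range_cast {R : Type*} [CommRing R] (n : ℕ) :
    2 * ∑ j ∈ Finset.range n, (j : R) = n * (n - 1) := by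
  induction n with
  | zero => simp
  | succ n ih =>
    rw [Finset.sum_range_succ, mul_add, ih]
    push_cast
    ring

theorem six_mul_sum_range_sq {R : Type*} [CommRing R] (n : ℕ) :
    6 * ∑ j ∈ Finset.range n, (j : R) ^ 2 = n * (n - 1) * (2 * n - 1) := by
  induction n with
  | zero => simp
  | succ n ih =>
    rw [Finset.sum_range_succ, mul_add, ih]
    push_cast
    ring

theorem thirty_mul_sum_range_pow_four {R : Type*} [CommRing R] (n : ℕ) :
    30 * ∑ j ∈ Finset.range n, (j : R) ^ 4 =
      n * (n - 1) * (2 * n - 1) * (3 * n ^ 2 - 3 * n - 1) := by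
  induction n with
  | zero => simp
  | succ n ih =>
    rw [Finset.sum_range_succ, mul_add, ih]
    push_cast
    ring

/-- The squares modulo an odd prime are `0², 1², …, ((p - 1) / 2)²`. -/
theorem ZMod.exists_sq_eq_of_isSquare {p : ℕ} [NeZero p] {x : ZMod p} (hx : IsSquare x) :
    ∃ j : ℕ, j ≤ p / 2 ∧ x = (j : ZMod p) ^ 2 := by
  obtain ⟨y, rfl⟩ := hx
  refine ⟨y.valMinAbs.natAbs, ZMod.natAbs_valMinAbs_le y, ?_⟩
  have h : ((y.valMinAbs.natAbs : ℤ) : ZMod p) ^ 2 = (y.valMinAbs : ZMod p) ^ 2 := by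
    rw [← Int.cast_pow, Int.natAbs_sq, Int.cast_pow]
  rw [Int.cast_natCast, ZMod.coe_valMinAbs] at h
  rw [h, sq]

/-- An arithmetic progression of length `(p + 1) / 2` starting at a square
contains a nonsquare when `p ≥ 7`. -/
theorem ZMod.exists_not_isSquare_sub_mul {p : ℕ} [Fact p.Prime] (hp7 : 7 ≤ p) {D s : ZMod p}
    (hD : IsSquare D) (hs : s ≠ 0) :
    ∃ j : ℕ, 0 < j ∧ j ≤ p / 2 ∧ ¬ IsSquare (D - s * j) := by
  classical
  by_contra! hcon
  have hp : p.Prime := Fact.out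
  have hpodd : p % 2 = 1 := hp.eq_two_or_odd.resolve_left (by omega)
  set N := p / 2 + 1 with hN
  have hsq (j : ℕ) (hj : j ∈ Finset.range N) : IsSquare (D - s * j) := by
    rcases j.eq_zero_or_pos with rfl | hj0
    · simpa using hD
    · exact hcon j hj0 (by rw [Finset.mem_range] at hj; omega)
  have hcast {i j : ℕ} (hi : i ∈ Finset.range N) (hj : j ∈ Finset.range N)
      (h : (i : ZMod p) = j) : i = j := by
    rw [Finset.mem_range] at hi hj
    rw [ZMod.natCast_eq_natCast_iff', Nat.mod_eq_of_lt (by omega), Nat.mod_eq_of_lt (by omega)] at h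
    exact h
  have hinj : Set.InjOn (fun j : ℕ => D - s * (j : ZMod p)) (Finset.range N) := by
    intro i hi j hj h
    refine hcast hi hj (mul_left_cancel₀ hs ?_)
    simpa using h
  have hsub : (Finset.range N).image (fun j : ℕ => D - s * (j : ZMod p)) ⊆
      (Finset.range N).image (fun j : ℕ => (j : ZMod p) ^ 2) := by
    intro x hx
    obtain ⟨j, hj, rfl⟩ := Finset.mem_image.1 hx
    obtain ⟨i, hi, h⟩ := ZMod.exists_sq_eq_of_isSquare (hsq j hj)
    exact Finset.mem_image.2 ⟨i, Finset.mem_range.2 (by omega), h.symm⟩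
  have hcard : ((Finset.range N).image (fun j : ℕ => D - s * (j : ZMod p))).card = N := by
    rw [Finset.card_image_of_injOn hinj, Finset.card_range]
  have hle : ((Finset.range N).image (fun j : ℕ => (j : ZMod p) ^ 2)).card ≤ N :=
    Finset.card_image_le.trans (Finset.card_range N).le
  have heq := Finset.eq_of_subset_of_card_le hsub (hle.trans hcard.ge)
  have hinj2 : Set.InjOn (fun j : ℕ => (j : ZMod p) ^ 2) (Finset.range N) := by
    rw [← Finset.card_image_iff, ← heq, hcard, Finset.card_range]
  have hsum (i : ℕ) : ∑ j ∈ Finset.range N, (D - s * (j : ZMod p)) ^ i =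
      ∑ j ∈ Finset.range N, ((j : ZMod p) ^ 2) ^ i := by
    rw [← Finset.sum_image (f := fun x => x ^ i) hinj, heq, Finset.sum_image hinj2]
  have h2N : 2 * (N : ZMod p) = 1 := by
    have : ((2 * N : ℕ) : ZMod p) = ((p + 1 : ℕ) : ZMod p) := by
      congr 1
      omega
    simpa using this
  have hne (n : ℕ) (hn : n.primeFactors ⊆ {2, 3, 5}) (hn0 : n ≠ 0) : (n : ZMod p) ≠ 0 := by
    rw [Ne, ZMod.natCast_eq_zero_iff]
    intro hdvd
    have := hn (Nat.mem_primeFactors.2 ⟨hp, hdvd, hn0⟩)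
    simp at this
    omega
  have h6 : (6 : ZMod p) ≠ 0 := by
    refine hne 6 ?_ (by norm_num)
    decide +kernel
  have h30 : (30 : ZMod p) ≠ 0 := by
    refine hne 30 ?_ (by norm_num)
    decide +kernel
  have h2 : (2 : ZMod p) ≠ 0 := by
    intro h
    exact h6 (by linear_combination 3 * h)
  have s1 := two_mul_sum_range_cast (R := ZMod p) N
  have s2 : ∑ j ∈ Finset.range N, (j : ZMod p) ^ 2 = 0 := by
    have := six_mul_sum_range_sq (R := ZMod p) N
    rw [h2N, sub_self, mul_zero] at this
    exact (mul_eq_zero.1 this).resolve_left h6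
  have s4 : ∑ j ∈ Finset.range N, (j : ZMod p) ^ 4 = 0 := by
    have := thirty_mul_sum_range_pow_four (R := ZMod p) N
    rw [h2N, sub_self, mul_zero, zero_mul] at this
    exact (mul_eq_zero.1 this).resolve_left h30
  have e1 := hsum 1
  have e2 := hsum 2
  simp only [pow_one, ← pow_mul] at e1 e2
  norm_num at e1 e2
  have hexp (j : ℕ) : (D - s * (j : ZMod p)) ^ 2 =
      D ^ 2 - 2 * D * s * j + s ^ 2 * (j : ZMod p) ^ 2 := by ring
  simp only [hexp] at e2
  rw [Finset.sum_add_distrib, Finset.sum_sub_distrib, ← Finset.mul_sum, ← Finset.mul_sum, s2, s4,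
    Finset.sum_const, Finset.card_range, nsmul_eq_mul] at e2
  rw [← Finset.mul_sum, s2] at e1
  generalize ∑ j ∈ Finset.range N, (j : ZMod p) = T at *
  have hT : 8 * T = -1 := by
    linear_combination 4 * s1 + (2 * (N : ZMod p) - 1) * h2N
  have hDs : 4 * D = -s := by
    linear_combination 8 * e1 + s * hT - 4 * D * h2N
  have hs2 : s ^ 2 = 0 := by
    linear_combination (4 * D + s) * hDs - 32 * e2 + 16 * D ^ 2 * h2N - 8 * D * s * hT
  exact hs (pow_eq_zero_iff two_ne_zero |>.1 hs2)

/-- For `p ≥ 7`, the quadratic `u k² + w k + v m` has no root modulo `p`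
for some positive even `m < p`. -/
theorem ZMod.exists_even_forall_quadratic_ne_zero {p : ℕ} [Fact p.Prime] (hp7 : 7 ≤ p)
    {u v w : ZMod p} (hu : u ≠ 0) (hv : v ≠ 0) :
    ∃ m : ℕ, 0 < m ∧ Even m ∧ m < p ∧ ∀ k : ZMod p, u * k ^ 2 + w * k + v * m ≠ 0 := by
  have hp : p.Prime := Fact.out
  have hpodd : p % 2 = 1 := hp.eq_two_or_odd.resolve_left (by omega)
  have h2 : (2 : ZMod p) ≠ 0 := by
    rw [← Nat.cast_ofNat, Ne, ZMod.natCast_eq_zero_iff]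
    intro h
    have := Nat.le_of_dvd two_pos h
    omega
  have h8 : 8 * u * v ≠ 0 := by
    rw [show 8 * u * v = 2 ^ 3 * u * v by ring]
    exact mul_ne_zero (mul_ne_zero (pow_ne_zero 3 h2) hu) hv
  obtain ⟨j, hj0, hj, hns⟩ := ZMod.exists_not_isSquare_sub_mul hp7 (D := w ^ 2) ⟨w, sq w⟩ h8
  refine ⟨2 * j, by omega, even_two_mul j, by omega, fun k hk => hns ⟨2 * u * k + w, ?_⟩⟩
  push_cast at hk
  linear_combination -4 * u * hk

theorem Nat.two_mul_cast_choose_two {R : Type*} [CommRing R] (k : ℕ) :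
    2 * (k.choose 2 : R) = k * (k - 1) := by
  induction k with
  | zero => simp
  | succ k ih =>
    rw [Nat.choose_succ_succ' k 1, Nat.choose_one_right]
    push_cast
    linear_combination ih

theorem exists_even_forall_not_dvd {p : ℕ} (hp : p.Prime) (hp7 : 7 ≤ p) {α δ E B a c : ℤ}
    (hα : ¬ (p : ℤ) ∣ α) (ha : (p : ℤ) ∣ a - 1 ∨ (p : ℤ) ∣ a + 1) (hc : ¬ (p : ℤ) ∣ c)
    (hE : ¬ (p : ℤ) ∣ E) (hB : ¬ (p : ℤ) ∣ B) :
    ∃ m : ℕ, 0 < m ∧ Even m ∧ m < p ∧ ∀ k : ℕ,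
      ¬ (p : ℤ) ∣ a * (k * α * δ + k.choose 2 * E * B ^ 2) + α ^ 2 * m * (c * E) := by
  have : Fact p.Prime := ⟨hp⟩
  have h2 : (2 : ZMod p) ≠ 0 := by
    rw [← Nat.cast_ofNat, Ne, ZMod.natCast_eq_zero_iff]
    intro h
    have := Nat.le_of_dvd two_pos h
    omega
  simp only [← ZMod.intCast_zmod_eq_zero_iff_dvd] at *
  push_cast at *
  have ha2 : (a : ZMod p) ^ 2 = 1 := by
    rcases ha with ha | ha
    · linear_combination (a + 1 : ZMod p) * ha
    · linear_combination (a - 1 : ZMod p) * ha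
  have ha0 : (a : ZMod p) ≠ 0 := by
    rintro h
    rw [h] at ha2
    simp at ha2
  obtain ⟨m, hm0, hm, hmp, h⟩ := ZMod.exists_even_forall_quadratic_ne_zero hp7
    (u := (E * B ^ 2 : ZMod p)) (v := 2 * α ^ 2 * c * a * E) (w := 2 * α * δ - E * B ^ 2)
    (mul_ne_zero hE (pow_ne_zero 2 hB))
    (mul_ne_zero (mul_ne_zero (mul_ne_zero (mul_ne_zero h2 (pow_ne_zero 2 hα)) hc) ha0) hE)
  refine ⟨m, hm0, hm, hmp, fun k hk => h k ?_⟩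
  have hch := Nat.two_mul_cast_choose_two (R := ZMod p) k
  linear_combination 2 * a * hk - (a ^ 2 * E * B ^ 2 : ZMod p) * hch -
    (2 * k * α * δ + E * B ^ 2 * k * (k - 1) : ZMod p) * ha2

theorem exists_even_forall_not_dvd_five {a c : ℤ} (ha : (5 : ℤ) ∣ a - 1 ∨ (5 : ℤ) ∣ a + 1)
    (hc : ¬ (5 : ℤ) ∣ c) (hca : ¬ (5 : ℤ) ∣ c + a) :
    ∃ m : ℕ, 0 < m ∧ Even m ∧ m < 5 ∧ ∀ k : ℕ,
      ¬ (5 : ℤ) ∣ a * (k * 41 * 14 + k.choose 2 * 24 ^ 2) + 41 ^ 2 * m * c := by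
  have hdec : ∀ a c : ZMod 5, (a - 1 = 0 ∨ a + 1 = 0) → c ≠ 0 → c + a ≠ 0 →
      (∀ k : ZMod 5, 2 * a * (k * 41 * 14) + a * 24 ^ 2 * (k * (k - 1)) + 2 * 41 ^ 2 * 2 * c ≠ 0) ∨
      (∀ k : ZMod 5, 2 * a * (k * 41 * 14) + a * 24 ^ 2 * (k * (k - 1)) + 2 * 41 ^ 2 * 4 * c ≠
        0) := by
    decide
  have h5 (n : ℤ) : (5 : ℤ) ∣ n ↔ (n : ZMod 5) = 0 := (ZMod.intCast_zmod_eq_zero_iff_dvd n 5).symm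
  simp only [h5] at *
  push_cast at *
  rcases hdec a c ha hc hca with h | h
  · refine ⟨2, by norm_num, by decide, by norm_num, fun k hk => h k ?_⟩
    push_cast at hk
    linear_combination 2 * hk - (a * 24 ^ 2 : ZMod 5) * Nat.two_mul_cast_choose_two (R := ZMod 5) k
  · refine ⟨4, by norm_num, by decide, by norm_num, fun k hk => h k ?_⟩
    push_cast at hk
    linear_combination 2 * hk - (a * 24 ^ 2 : ZMod 5) * Nat.two_mul_cast_choose_two (R := ZMod 5) k

theorem forall_not_dvd_three {a c : ℤ} (ha : (3 : ℤ) ∣ a - 1 ∨ (3 : ℤ) ∣ a + 1)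
    (hca : (3 : ℤ) ∣ c + a) (k : ℕ) :
    ¬ (3 : ℤ) ∣ a * (k * 4 * 1 + k.choose 2 * 1 * 2 ^ 2) + 4 ^ 2 * 2 * (c * 1) := by
  have hdec : ∀ a c k : ZMod 3, (a - 1 = 0 ∨ a + 1 = 0) → c + a = 0 →
      2 * a * (k * 4) + a * 4 * (k * (k - 1)) + 2 * 4 ^ 2 * 2 * c ≠ 0 := by
    decide
  have h3 (n : ℤ) : (3 : ℤ) ∣ n ↔ (n : ZMod 3) = 0 := (ZMod.intCast_zmod_eq_zero_iff_dvd n 3).symm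
  simp only [h3] at *
  push_cast at *
  intro hk
  refine hdec a c k ha hca ?_
  linear_combination 2 * hk - (a * 4 : ZMod 3) * Nat.two_mul_cast_choose_two (R := ZMod 3) k

open NumberField in
theorem PureCubic.exists_dvd_of_solution {p P : ℕ} {K : Type*} [Field K] [NumberField K]
    (S : PureCubic P K) (hp : p.Prime) (hp3 : 3 ≤ p) (hP : P = 2 * p ∨ P = p) {α β γ : ℤ} {ε : ℝ}
    (hε : ε = (α : ℝ) + (β : ℝ) * cbrt P + (γ : ℝ) * (cbrt P) ^ 2)
    (hfund : IsFundamentalUnit P ε) {ι l m : ℕ} (hι : ι = 1 ∨ ι = 2) (hl : l.Prime)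
    (hl3 : l % 3 = 2) (hlP : ¬ l ∣ P) (hm : 0 < m) {a b c : ℤ}
    (habc : (l : ℤ) = a ^ 3 + (P : ℤ) ^ ι * b ^ 3 + (P : ℤ) ^ (2 * ι) * c ^ 3
      - 3 * (P : ℤ) ^ ι * a * b * c) {x y z : ℤ} (hgcd : Int.gcd x (Int.gcd y z) = 1)
    (h : x ^ 3 + (P : ℤ) ^ ι * y ^ 3 = (l : ℤ) ^ m * z ^ p ^ ι)
    (hlxy : ¬ ((l : ℤ) ∣ x ∧ (l : ℤ) ∣ y)) :
    ¬ (p : ℤ) ∣ x ∧ ∃ (k : ℕ) (g : 𝓞 K), (x : 𝓞 K) + y * S.rootInt ^ ι =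
      (α + β * S.rootInt + γ * S.rootInt ^ 2) ^ k *
        (a + b * S.rootInt ^ ι + c * (S.rootInt ^ ι) ^ 2) ^ m * g ^ p ^ ι := by
  have hι0 : ι ≠ 0 := by omega
  have hpodd : Odd p := hp.odd_of_ne_two (by omega)
  have hn : 3 ≤ p ^ ι := hp3.trans (Nat.le_self_pow hι0 p)
  constructor
  · intro hx
    have hcop := (isCoprime_of_cube_add S.sqfree S.mod9 hι hl hl3 hlP hm hn hgcd h hlxy).2
    have hpP : (p : ℤ) ∣ (P : ℤ) ^ ι := by
      refine Dvd.dvd.trans ?_ (dvd_pow_self _ hι0)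
      rcases hP with rfl | rfl
      · exact ⟨2, by push_cast; ring⟩
      · exact dvd_rfl
    rw [← h] at hcop
    exact (Nat.prime_iff_prime_int.1 hp).not_isUnit (hcop.isUnit_of_dvd' (hpP.mul_left _)
      (dvd_add (hx.trans (dvd_pow_self _ three_ne_zero)) (hpP.mul_right _)))
  · obtain ⟨η, hη, hgen⟩ := S.exists_unit_zpow hfund
    have hη' : (η : 𝓞 K) = α + β * S.rootInt + γ * S.rootInt ^ 2 := by
      refine S.emb_coe_injective ?_
      rw [hη, hε]
      simp [S.coe_rootInt, S.emb_root]
    rw [← hη']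
    exact S.descent hgen hι hl hl3 hlP hm hn hpodd.pow
      ((S.coprime_classNumber hfund hp hpodd hP).pow_left ι) habc hgcd h hlxy

theorem small_or_seven_le {p P : ℕ} (hp : p.Prime) (hp3 : 3 ≤ p) (hP : P = 2 * p ∨ P = p)
    (hP9 : P % 9 ≠ 1 ∧ P % 9 ≠ 8) :
    (p = 3 ∧ (P = 3 ∨ P = 6)) ∨ (p = 5 ∧ P = 5) ∨ 7 ≤ p := by
  rcases lt_or_ge p 7 with h7 | h7
  · interval_cases p
    · omega
    · norm_num at hp
    · omega
    · norm_num at hp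
  · exact Or.inr (Or.inr h7)

theorem exists_exponent_one {p P : ℕ} (hp : p.Prime) (hp3 : 3 ≤ p) {α β γ a c : ℤ}
    (hthree : P = 3 → α = 4 ∧ β = 3 ∧ γ = 2) (hfive : P = 5 → α = 41 ∧ β = 24 ∧ γ = 14)
    (hsix : P = 6 → α = 109 ∧ β = 60 ∧ γ = 33)
    (hcases : (p = 3 ∧ (P = 3 ∨ P = 6)) ∨ (p = 5 ∧ P = 5) ∨ 7 ≤ p) (hα : ¬ (p : ℤ) ∣ α)
    (ha : (p : ℤ) ∣ a - 1 ∨ (p : ℤ) ∣ a + 1) (hc : ¬ (p : ℤ) ∣ c)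
    (hβγ : ¬ (p : ℤ) ∣ β ∨ ((p : ℤ) ∣ β ∧ (p : ℤ) ∣ γ)) (h3 : p = 5 → ¬ (5 : ℤ) ∣ (c + a)) :
    ∃ m : ℕ, 0 < m ∧ Even m ∧ m < p ∧ ∀ k : ℕ,
      ¬ (p : ℤ) ∣ a * (k * α * γ + k.choose 2 * β ^ 2) + α ^ 2 * m * c := by
  have hpp : Prime (p : ℤ) := Nat.prime_iff_prime_int.1 hp
  by_cases hboth : (p : ℤ) ∣ β ∧ (p : ℤ) ∣ γ
  · refine ⟨2, by norm_num, even_two, hp3, fun k hk => ?_⟩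
    have h1 : (p : ℤ) ∣ α ^ 2 * 2 * c := by
      refine (Int.dvd_add_right (Dvd.dvd.mul_left (dvd_add (hboth.2.mul_left _)
        (Dvd.dvd.mul_left (hboth.1.trans (dvd_pow_self _ two_ne_zero)) _)) _)).1 hk
    rcases hpp.dvd_or_dvd h1 with h1 | h1
    · rcases hpp.dvd_or_dvd h1 with h1 | h1
      · exact hα (hpp.dvd_of_dvd_pow h1)
      · have := Nat.le_of_dvd two_pos (Int.natCast_dvd_natCast.1 h1)
        omega
    · exact hc h1
  · have hβ : ¬ (p : ℤ) ∣ β := by tauto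
    rcases hcases with ⟨rfl, hP3 | hP6⟩ | ⟨rfl, hP5⟩ | hp7
    · obtain ⟨-, rfl, -⟩ := hthree hP3
      exact absurd (by norm_num) hβ
    · obtain ⟨-, rfl, -⟩ := hsix hP6
      exact absurd (by norm_num) hβ
    · obtain ⟨rfl, rfl, rfl⟩ := hfive hP5
      exact exists_even_forall_not_dvd_five ha hc (h3 rfl)
    · simpa using exists_even_forall_not_dvd hp hp7 (δ := γ) hα ha hc (E := 1)
        (fun h => hpp.not_isUnit (isUnit_of_dvd_one h)) hβ

theorem exists_exponent_two {p P P' : ℕ} (hp : p.Prime) {α β' γ a c : ℤ}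
    (hthree : P = 3 → α = 4 ∧ p * β' = 3 ∧ γ = 2) (hfive : P = 5 → α = 41 ∧ p * β' = 24 ∧ γ = 14)
    (hsix : P = 6 → α = 109 ∧ p * β' = 60 ∧ γ = 33)
    (hcases : (p = 3 ∧ (P = 3 ∨ P = 6)) ∨ (p = 5 ∧ P = 5) ∨ 7 ≤ p) (hα : ¬ (p : ℤ) ∣ α)
    (ha : (p : ℤ) ∣ a - 1 ∨ (p : ℤ) ∣ a + 1) (hc : ¬ (p : ℤ) ∣ c)
    (hP'p : P = p * P') (hP' : ¬ (p : ℤ) ∣ P') (hγ : ¬ (p : ℤ) ∣ γ)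
    (h4 : P = 3 → (3 : ℤ) ∣ (c + a)) :
    ∃ m : ℕ, 0 < m ∧ Even m ∧ m < p ∧ ∀ k : ℕ,
      ¬ (p : ℤ) ∣ a * (k * α * β' + k.choose 2 * P' * γ ^ 2) + α ^ 2 * m * (c * P') := by
  rcases hcases with ⟨rfl, hP3 | hP6⟩ | ⟨rfl, hP5⟩ | hp7
  · obtain ⟨rfl, hβ', rfl⟩ := hthree hP3
    obtain rfl : β' = 1 := by
      push_cast at hβ'
      omega
    obtain rfl : P' = 1 := by omega
    exact ⟨2, by norm_num, even_two, by norm_num, forall_not_dvd_three ha (h4 hP3)⟩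
  · obtain ⟨-, -, rfl⟩ := hsix hP6
    exact absurd (by norm_num) hγ
  · obtain ⟨-, hβ', -⟩ := hfive hP5
    push_cast at hβ'
    omega
  · exact exists_even_forall_not_dvd hp hp7 hα ha hc (by assumption) hγ

/-- **Proposition 3.2** (heuristic recipe). -/
theorem heuristic_recipe
    (p : ℕ) (hp : p.Prime) (hpodd : Odd p)
    (P : ℕ) (hP : P = 2 * p ∨ P = p) (hP9 : P % 9 ≠ 1 ∧ P % 9 ≠ 8)
    (α β γ : ℤ) (ε : ℝ)
    (hε : ε = (α : ℝ) + (β : ℝ) * cbrt P + (γ : ℝ) * (cbrt P) ^ 2)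
    (hfund : IsFundamentalUnit P ε)
    (ι : ℕ)
    (hι : (ι = 1 ∧ (¬ (p : ℤ) ∣ β ∨ ((p : ℤ) ∣ β ∧ (p : ℤ) ∣ γ))) ∨
          (ι = 2 ∧ (p : ℤ) ∣ β ∧ ¬ (p : ℤ) ∣ γ))
    (l : ℕ) (hl : l.Prime) (hl3 : l % 3 = 2) (hlP : ¬ l ∣ P)
    (a b c : ℤ)
    -- (1) `l = a³ + P^ι b³ + P^{2ι} c³ - 3 P^ι a b c`
    (h1 : (l : ℤ) = a ^ 3 + (P : ℤ) ^ ι * b ^ 3 + (P : ℤ) ^ (2 * ι) * c ^ 3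
      - 3 * (P : ℤ) ^ ι * a * b * c)
    -- (2) `a ≡ ±1 (mod p)`, `b ≡ 0 (mod p)`, `c ≢ 0 (mod p)`
    (h2 : ((p : ℤ) ∣ (a - 1) ∨ (p : ℤ) ∣ (a + 1)) ∧ (p : ℤ) ∣ b ∧ ¬ (p : ℤ) ∣ c)
    -- (3) if `p = 5` then additionally `c ≢ -a (mod 5)`
    (h3 : p = 5 → ¬ (5 : ℤ) ∣ (c + a))
    -- (4) if `P = 3` then additionally `c ≡ -a (mod 3)`
    (h4 : P = 3 → (3 : ℤ) ∣ (c + a)) :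
    ∃ m : ℕ, 0 < m ∧ Even m ∧ m < p ∧
      ∀ x y z : ℤ, Int.gcd x (Int.gcd y z) = 1 →
        x ^ 3 + (P : ℤ) ^ ι * y ^ 3 = (l : ℤ) ^ m * z ^ (p ^ ι) →
        (l : ℤ) ∣ x ∧ (l : ℤ) ∣ y := by
  obtain ⟨ha, hb, hc⟩ := h2
  have hpp : Prime (p : ℤ) := Nat.prime_iff_prime_int.1 hp
  have hp3 : 3 ≤ p := by
    have := hp.two_le
    obtain ⟨k, hk⟩ := hpodd
    omega
  have hsq : Squarefree P := by
    rcases hP with rfl | rfl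
    · exact (Nat.squarefree_mul (Nat.coprime_two_left.2 hpodd)).2
        ⟨Nat.prime_two.squarefree, hp.squarefree⟩
    · exact hp.squarefree
  have hP2 : 2 < P := by omega
  obtain ⟨P', hP'p, hP'⟩ : ∃ P' : ℕ, P = p * P' ∧ ¬ (p : ℤ) ∣ P' := by
    rcases hP with rfl | rfl
    · refine ⟨2, mul_comm _ _, fun h => ?_⟩
      have := Nat.le_of_dvd two_pos (Int.natCast_dvd_natCast.1 h)
      omega
    · refine ⟨1, (mul_one _).symm, fun h => ?_⟩
      have := Nat.le_of_dvd one_pos (Int.natCast_dvd_natCast.1 h)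
      omega
  obtain ⟨K, _, _, ⟨S⟩⟩ := exists_pureCubic hsq hP2 hP9
  have hα : ¬ (p : ℤ) ∣ α := by
    intro hα
    have hform := S.form_eq_one hε hfund.1 (by linarith [hfund.2.1])
    have hpP : (p : ℤ) ∣ P := ⟨P', by rw [hP'p]; push_cast; rfl⟩
    refine hpp.not_isUnit (isUnit_of_dvd_one ?_)
    rw [← hform, show α ^ 3 + P * β ^ 3 + (P : ℤ) ^ 2 * γ ^ 3 - 3 * P * α * β * γ =
      α * α ^ 2 + P * (β ^ 3 + P * γ ^ 3 - 3 * α * β * γ) by ring]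
    exact dvd_add (hα.mul_right _) (hpP.mul_right _)
  have hap : ¬ (p : ℤ) ∣ a := by
    intro h
    refine hpp.not_isUnit (isUnit_of_dvd_one ?_)
    rcases ha with ha | ha
    · simpa using dvd_sub h ha
    · simpa using dvd_sub ha h
  have hι' : ι = 1 ∨ ι = 2 := by omega
  have hthree : P = 3 → α = 4 ∧ β = 3 ∧ γ = 2 := by
    rintro rfl
    exact S.real_coords_ext (hε.symm.trans (PureCubic.fundamental_three S hfund))
  have hfive : P = 5 → α = 41 ∧ β = 24 ∧ γ = 14 := by
    rintro rfl
    exact S.real_coords_ext (hε.symm.trans (PureCubic.fundamental_five S hfund))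
  have hsix : P = 6 → α = 109 ∧ β = 60 ∧ γ = 33 := by
    rintro rfl
    exact S.real_coords_ext (hε.symm.trans (PureCubic.fundamental_six S hfund))
  have hcases := small_or_seven_le hp hp3 hP hP9
  rcases hι with ⟨rfl, hβγ⟩ | ⟨rfl, ⟨β', rfl⟩, hγ⟩
  · obtain ⟨m, hm0, hm, hmp, hk⟩ := exists_exponent_one hp hp3 hthree hfive hsix hcases hα ha
      hc hβγ h3
    refine ⟨m, hm0, hm, hmp, fun x y z hgcd h => ?_⟩
    by_contra hlxy
    obtain ⟨hx, k, g, hg⟩ := S.exists_dvd_of_solution hp hp3 hP hε hfund hι' hl hl3 hlP hm0 h1 hgcd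
      h hlxy
    simp only [pow_one] at hg
    exact hk k (S.dvd_of_eq_mul_pow_one hp hp3 ⟨P', hP'p⟩ hα hap hx hb hg)
  · obtain ⟨m, hm0, hm, hmp, hk⟩ := exists_exponent_two hp hthree hfive hsix hcases hα ha
      hc hP'p hP' hγ h4
    refine ⟨m, hm0, hm, hmp, fun x y z hgcd h => ?_⟩
    by_contra hlxy
    obtain ⟨hx, k, g, hg⟩ := S.exists_dvd_of_solution hp hp3 hP hε hfund hι' hl hl3 hlP hm0 h1 hgcd
      h hlxy
    exact hk k (S.dvd_of_eq_mul_pow_two hp hp3 hP'p hα hap hx hb hg)
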